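/- (Sphere Covering Inequality) Let Ω ⊂ ℝ² be a nonempty bounded open simply connected set, and let w₁, w₂ be twice continuously differentiable on an open neighborhood of the closure of Ω and satisfy Δw_i + e^{w_i} = f_i in Ω (i = 1, 2), where f₁, f₂ are functions with 0 ≤ f₁ ≤ f₂ on Ω. If w₂ > w₁ in Ω and w₂ = w₁ on ∂Ω, then ∫_Ω (e^{w₁} + e^{w₂}) dy ≥ 8π. Moreover, if equality holds then f₁ ≡ f₂ ≡ 0 on Ω. -/

import Mathlib

open Real MeasureTheory

noncomputable section

/-- Euclidean Laplacian on ℝ² via the second iterated derivative. -/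
def lap (w : ℝ × ℝ → ℝ) (y : ℝ × ℝ) : ℝ :=
  iteratedFDeriv ℝ 2 w y ![(1, 0), (1, 0)] + iteratedFDeriv ℝ 2 w y ![(0, 1), (0, 1)]

/-- The unit sphere S² ⊂ ℝ³ (vectors encoded as functions `Fin 3 → ℝ`). -/
def sphere3 : Set (Fin 3 → ℝ) := {x | x 0 ^ 2 + x 1 ^ 2 + x 2 ^ 2 = 1}

/-- Inverse stereographic projection from the north pole. -/
def stereoN (y : ℝ × ℝ) : Fin 3 → ℝ :=
  ![2 * y.1 / (1 + y.1 ^ 2 + y.2 ^ 2), 2 * y.2 / (1 + y.1 ^ 2 + y.2 ^ 2),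
    (y.1 ^ 2 + y.2 ^ 2 - 1) / (1 + y.1 ^ 2 + y.2 ^ 2)]

/-- South-pole parametrization of the sphere. -/
def stereoS (y : ℝ × ℝ) : Fin 3 → ℝ :=
  ![2 * y.1 / (1 + y.1 ^ 2 + y.2 ^ 2), 2 * y.2 / (1 + y.1 ^ 2 + y.2 ^ 2),
    (1 - y.1 ^ 2 - y.2 ^ 2) / (1 + y.1 ^ 2 + y.2 ^ 2)]

/-- `u` is a solution of the mean field equation `Δu = lam (1 - e^u)` on `S²`,
expressed in the two stereographic charts. -/
def IsMFSolution (lam : ℝ) (u : (Fin 3 → ℝ) → ℝ) : Prop :=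
  ContinuousOn u sphere3 ∧
  ContDiff ℝ 2 (fun y => u (stereoN y)) ∧
  ContDiff ℝ 2 (fun y => u (stereoS y)) ∧
  (∀ y : ℝ × ℝ, lap (fun z => u (stereoN z)) y =
    4 * lam * (1 - Real.exp (u (stereoN y))) / (1 + y.1 ^ 2 + y.2 ^ 2) ^ 2) ∧
  (∀ y : ℝ × ℝ, lap (fun z => u (stereoS z)) y =
    4 * lam * (1 - Real.exp (u (stereoS y))) / (1 + y.1 ^ 2 + y.2 ^ 2) ^ 2)

/-- `u` is axially symmetric on `S²`: constant on the level sets of `⟨·, e⟩`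
for some unit vector `e`. -/
def AxiallySymmetric (u : (Fin 3 → ℝ) → ℝ) : Prop :=
  ∃ e : Fin 3 → ℝ, e 0 ^ 2 + e 1 ^ 2 + e 2 ^ 2 = 1 ∧
    ∀ x ∈ sphere3, ∀ x' ∈ sphere3,
      x 0 * e 0 + x 1 * e 1 + x 2 * e 2 = x' 0 * e 0 + x' 1 * e 1 + x' 2 * e 2 →
      u x = u x'

/-- Surface integral over `S²`, written in the north-pole stereographic chart. -/
def sphereIntegral (f : (Fin 3 → ℝ) → ℝ) : ℝ :=
  ∫ y : ℝ × ℝ, f (stereoN y) * (4 / (1 + y.1 ^ 2 + y.2 ^ 2) ^ 2)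

namespace SCI

open Set Filter Topology Complex in
lemma integral_fderiv_zero {E : Type*} [NormedAddCommGroup E] [NormedSpace ℝ E]
    {f : ℂ → E} (hf : ContDiff ℝ 1 f) (hc : HasCompactSupport f) (v : ℂ) :
    ∫ z, fderiv ℝ f z v = 0 := by
  have hi : Integrable (fun z => fderiv ℝ f z v) := by
    apply Continuous.integrable_of_hasCompactSupport
    · exact (hf.continuous_fderiv one_ne_zero).clm_apply continuous_const
    · exact hc.fderiv_apply (𝕜 := ℝ) v
  have := integral_smul_fderiv_eq_neg_fderiv_smul_of_integrable (μ := volume) (f := fun _ : ℂ => (1:ℝ))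
    (g := f) (v := v) (by simp) (by simpa using hi)
    (by simpa using hf.continuous.integrable_of_hasCompactSupport hc)
    (fun x _ => differentiableAt_const _) (fun x _ => hf.differentiable one_ne_zero x)
  simpa using this

/-- The d-bar operator. -/
def dbar (f : ℂ → ℂ) (z : ℂ) : ℂ := (1/2) * (fderiv ℝ f z 1 + Complex.I * fderiv ℝ f z Complex.I)

open Set Filter Topology in
lemma polar_integrableOn {E : Type*} [NormedAddCommGroup E]
    {h : ℝ × ℝ → E} (hc : Continuous h) (R : ℝ) (hR : ∀ p : ℝ × ℝ, R < p.1 → h p = 0) :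
    IntegrableOn h (Ioi (0:ℝ) ×ˢ Ioo (-π) π) := by
  have h1 : IntegrableOn h (Icc (0:ℝ) R ×ˢ Icc (-π) π) :=
    hc.continuousOn.integrableOn_compact (isCompact_Icc.prod isCompact_Icc)
  refine IntegrableOn.of_forall_sdiff_eq_zero h1 (measurableSet_Ioi.prod measurableSet_Ioo) ?_
  rintro ⟨r, t⟩ ⟨⟨hr, ht⟩, hn⟩
  apply hR
  by_contra hle
  push Not at hle
  exact hn ⟨⟨le_of_lt hr, hle⟩, ⟨le_of_lt ht.1, le_of_lt ht.2⟩⟩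

open Set Filter Topology in
lemma pompeiu0 {f : ℂ → ℂ} (hf : ContDiff ℝ 1 f) (hc : HasCompactSupport f) :
    ∫ z, dbar f z / z = - π * f 0 := by
  obtain ⟨R, hRpos, hR⟩ : ∃ R > 0, ∀ z : ℂ, R < ‖z‖ → f z = 0 := by
    obtain ⟨R, hR⟩ := hc.isCompact.isBounded.subset_closedBall 0
    refine ⟨max R 1, by positivity, fun z hz => ?_⟩
    by_contra hne
    have := hR (subset_tsupport f hne)
    simp at this
    exact absurd (lt_of_le_of_lt (le_max_left R 1) hz) (not_lt.2 this)
  have hR' : ∀ z : ℂ, R < ‖z‖ → fderiv ℝ f z = 0 := by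
    intro z hz
    have : f =ᶠ[𝓝 z] fun _ => 0 := by
      filter_upwards [(isOpen_lt continuous_const continuous_norm).mem_nhds hz] with y hy using hR y hy
    rw [this.fderiv_eq]; simp
  have hcd := hf.continuous_fderiv one_ne_zero
  set e : ℝ → ℂ := fun t => Complex.exp (t * Complex.I) with he
  have hec : Continuous e := by fun_prop
  have hen : ∀ t, ‖e t‖ = 1 := fun t => Complex.norm_exp_ofReal_mul_I t
  have hed : ∀ t, HasDerivAt e (Complex.I * e t) t := by
    intro t
    have h1 : HasDerivAt (fun t : ℝ => (t:ℂ) * Complex.I) (1 * Complex.I) t :=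
      (Complex.ofRealCLM.hasDerivAt (x := t)).mul_const _
    have := h1.cexp
    simpa [he, mul_comm] using this
  set A : ℝ × ℝ → ℂ := fun p => fderiv ℝ f (p.1 * e p.2) (e p.2) with hA
  set B : ℝ × ℝ → ℂ := fun p => fderiv ℝ f (p.1 * e p.2) (Complex.I * e p.2) with hB
  have hAc : Continuous A := by
    exact (hcd.comp (by fun_prop)).clm_apply (by fun_prop)
  have hBc : Continuous B := by
    exact (hcd.comp (by fun_prop)).clm_apply (by fun_prop)
  have hbig : ∀ p : ℝ × ℝ, R < p.1 → fderiv ℝ f (p.1 * e p.2) = 0 := by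
    intro p hp
    apply hR'
    rw [norm_mul, hen, mul_one, Complex.norm_real, Real.norm_eq_abs]
    exact lt_of_lt_of_le hp (le_abs_self _)
  have hAi := polar_integrableOn hAc R (fun p hp => by simp [hA, hbig p hp])
  have hBi := polar_integrableOn hBc R (fun p hp => by simp [hB, hbig p hp])
  rw [← Complex.integral_comp_polarCoord_symm]
  have hsymm : ∀ p : ℝ × ℝ, Complex.polarCoord.symm p = p.1 * e p.2 := by
    intro p
    rw [Complex.polarCoord_symm_apply, he]; simp only [Complex.exp_mul_I]
    push_cast; ring
  have hcongr : ∀ p ∈ polarCoord.target, p.1 • (dbar f (Complex.polarCoord.symm p) / Complex.polarCoord.symm p)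
      = (1/2) * A p + (Complex.I/2) * B p := by
    rintro ⟨r, t⟩ hp
    have hr : (0:ℝ) < r := hp.1
    have hr' : (r:ℂ) ≠ 0 := by exact_mod_cast hr.ne'
    have hne : e t ≠ 0 := by intro h; have := hen t; rw [h] at this; simp at this
    rw [hsymm]
    set L := fderiv ℝ f ((r, t).1 * e (r, t).2) with hL
    have hlin : ∀ v : ℂ, L v = v.re * L 1 + v.im * L Complex.I := by
      intro v
      conv_lhs => rw [← Complex.re_add_im v]
      rw [show (v.re:ℂ) + v.im * Complex.I = v.re • (1:ℂ) + v.im • Complex.I by simp]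
      rw [map_add, map_smul, map_smul]; simp
    have e1 : A (r, t) = L (e t) := rfl
    have e2 : B (r, t) = L (Complex.I * e t) := rfl
    have e3 : dbar f ((r, t).1 * e (r, t).2) = (1/2) * (L 1 + Complex.I * L Complex.I) := rfl
    rw [e1, e2, e3, hlin (e t), hlin (Complex.I * e t)]
    simp only [Complex.mul_re, Complex.mul_im, Complex.I_re, Complex.I_im, Complex.real_smul]
    have e4 : (r:ℂ) * ((1/2) * (L 1 + Complex.I * L Complex.I) / (r * e t)) =
       (1/2) * (L 1 + Complex.I * L Complex.I) * (e t)⁻¹ := by field_simp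
    have e5 : (e t)⁻¹ = (e t).re - (e t).im * Complex.I := by
      rw [Complex.inv_def, Complex.normSq_eq_norm_sq, hen]
      apply Complex.ext <;> simp
    rw [e4, e5]
    push_cast
    ring_nf
    rw [Complex.I_sq]; ring
  have hm : MeasurableSet polarCoord.target := (measurableSet_Ioi.prod measurableSet_Ioo)
  rw [setIntegral_congr_fun hm hcongr]
  have ht : polarCoord.target = Ioi (0:ℝ) ×ˢ Ioo (-π) π := rfl
  rw [ht, integral_add (hAi.const_mul _) (hBi.const_mul _), integral_const_mul, integral_const_mul]
  have hBz : ∫ p in Ioi (0:ℝ) ×ˢ Ioo (-π) π, B p = 0 := by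
    rw [Measure.volume_eq_prod, setIntegral_prod _ hBi]
    apply setIntegral_eq_zero_of_forall_eq_zero
    intro r hr
    have hr : (0:ℝ) < r := hr
    have hr' : (r:ℂ) ≠ 0 := by exact_mod_cast hr.ne'
    have hd : ∀ t ∈ uIcc (-π) π, HasDerivAt (fun t => f (r * e t)) (fderiv ℝ f (r * e t) (r * (Complex.I * e t))) t := by
      intro t _
      exact (hf.differentiable one_ne_zero _).hasFDerivAt.comp_hasDerivAt t ((hed t).const_mul (r:ℂ))
    have hIntg : ∫ t in (-π)..π, fderiv ℝ f (r * e t) (r * (Complex.I * e t)) = f (r * e π) - f (r * e (-π)) := by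
      refine intervalIntegral.integral_eq_sub_of_hasDerivAt hd ?_
      apply Continuous.intervalIntegrable
      exact (hcd.comp (by fun_prop)).clm_apply (by fun_prop)
    have hpi : e π = e (-π) := by
      simp only [he]; push_cast
      rw [Complex.exp_pi_mul_I, neg_mul, Complex.exp_neg, Complex.exp_pi_mul_I]; norm_num
    rw [hpi, sub_self, intervalIntegral.integral_of_le (by linarith [pi_pos]), integral_Ioc_eq_integral_Ioo] at hIntg
    have : ∀ t, fderiv ℝ f (r * e t) (r * (Complex.I * e t)) = r • B (r, t) := by
      intro t
      rw [hB]; simp only; rw [← map_smul]; simp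
    simp only [this] at hIntg
    rw [integral_smul] at hIntg
    exact (smul_eq_zero.1 hIntg).resolve_left hr.ne'
  have hAz : ∫ p in Ioi (0:ℝ) ×ˢ Ioo (-π) π, A p = - (2 * π) * f 0 := by
    rw [Measure.volume_eq_prod, ← setIntegral_prod_swap, setIntegral_prod (fun z : ℝ × ℝ => A z.swap) hAi.swap]
    have : ∀ t : ℝ, ∫ r in Ioi (0:ℝ), A (r, t) = - f 0 := by
      intro t
      have hd : ∀ r ∈ Ici (0:ℝ), HasDerivAt (fun r : ℝ => f (r * e t)) (A (r, t)) r := by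
        intro r _
        have h1 : HasDerivAt (fun r : ℝ => (r:ℂ) * e t) (1 * e t) r :=
          (Complex.ofRealCLM.hasDerivAt (x := r)).mul_const _
        rw [one_mul] at h1
        exact (hf.differentiable one_ne_zero _).hasFDerivAt.comp_hasDerivAt r h1
      have hi : IntegrableOn (fun r => A (r, t)) (Ioi 0) := by
        have h1 : IntegrableOn (fun r => A (r, t)) (Icc 0 R) :=
          (hAc.comp (by fun_prop : Continuous fun r : ℝ => (r, t))).continuousOn.integrableOn_compact isCompact_Icc
        refine IntegrableOn.of_forall_sdiff_eq_zero h1 measurableSet_Ioi ?_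
        rintro r ⟨hr, hn⟩
        simp only [hA]
        rw [hbig (r, t)]; · simp
        by_contra hle; push Not at hle
        exact hn ⟨le_of_lt hr, hle⟩
      have hlim : Tendsto (fun r : ℝ => f (r * e t)) atTop (𝓝 0) := by
        apply tendsto_const_nhds.congr'
        filter_upwards [eventually_gt_atTop R] with r hr
        symm; apply hR
        rw [norm_mul, hen, mul_one, Complex.norm_real, Real.norm_eq_abs]
        exact lt_of_lt_of_le hr (le_abs_self _)
      have := integral_Ioi_of_hasDerivAt_of_tendsto' hd hi hlim
      rw [this]; simp
    simp only [Prod.swap, this]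
    simp [Complex.ofReal_ofNat]
    left
    rw [max_eq_left (by linarith [pi_pos])]; push_cast; ring
  rw [hAz, hBz]; ring

/-- Euclidean inner product of gradients. -/
def gdot (f g : ℂ → ℝ) (z : ℂ) : ℝ :=
  fderiv ℝ f z 1 * fderiv ℝ g z 1 + fderiv ℝ f z Complex.I * fderiv ℝ g z Complex.I

/-- Euclidean norm of the gradient. -/
def gn (f : ℂ → ℝ) (z : ℂ) : ℝ := √(gdot f f z)

lemma gdot_self_nonneg (f : ℂ → ℝ) (z : ℂ) : 0 ≤ gdot f f z := by
  unfold gdot; nlinarith [sq_nonneg (fderiv ℝ f z 1), sq_nonneg (fderiv ℝ f z Complex.I)]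

lemma gn_nonneg (f : ℂ → ℝ) (z : ℂ) : 0 ≤ gn f z := Real.sqrt_nonneg _

lemma gn_sq (f : ℂ → ℝ) (z : ℂ) : gn f z ^ 2 = gdot f f z := Real.sq_sqrt (gdot_self_nonneg f z)

open Set Filter Topology in
lemma exists_cutoff {K V : Set ℂ} (hK : IsCompact K) (hV : IsOpen V) (hKV : K ⊆ V) :
    ∃ θ : ℂ → ℝ, ContDiff ℝ (⊤ : ℕ∞) θ ∧ HasCompactSupport θ ∧ tsupport θ ⊆ V ∧ (∀ᶠ z in 𝓝ˢ K, θ z = 1) ∧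
      (∀ z, 0 ≤ θ z) ∧ (∀ z, θ z ≤ 1) := by
  obtain ⟨L, hL, hKL, hLV⟩ := exists_compact_between hK hV hKV
  obtain ⟨f, hf0, hf1, hf⟩ := exists_contMDiffMap_zero_one_nhds_of_isClosed (n := (⊤ : ℕ∞)) (modelWithCornersSelf ℝ ℂ)
    (s := (interior L)ᶜ) (t := K) isOpen_interior.isClosed_compl hK.isClosed
    (by rw [Set.disjoint_left]; intro x hx hxK; exact hx (hKL hxK))
  have hsub : Function.support f ⊆ L := by
    intro z hz
    by_contra hzL
    apply hz
    have : z ∈ (interior L)ᶜ := fun h => hzL (interior_subset h)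
    exact (hf0.self_of_nhdsSet z this)
  have hts : tsupport f ⊆ L := closure_minimal hsub hL.isClosed
  refine ⟨f, f.contMDiff.contDiff, HasCompactSupport.of_support_subset_isCompact hL hsub, hts.trans hLV, hf1,
    fun z => (hf z).1, fun z => (hf z).2⟩

lemma det_mulC (a : ℂ) : ((ContinuousLinearMap.toSpanSingleton ℂ a).restrictScalars ℝ : ℂ →L[ℝ] ℂ).det = ‖a‖ ^ 2 := by
  simp [ContinuousLinearMap.det, LinearMap.det_restrictScalars,
      Algebra.norm_complex_eq, Complex.normSq_eq_norm_sq]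

lemma hasFDerivAt_real {g : ℂ → ℂ} {z a : ℂ} (h : HasDerivAt g a z) :
    HasFDerivAt g ((ContinuousLinearMap.toSpanSingleton ℂ a).restrictScalars ℝ : ℂ →L[ℝ] ℂ) z :=
  h.hasFDerivAt.restrictScalars ℝ

lemma fderiv_real_apply {g : ℂ → ℂ} {z : ℂ} (h : DifferentiableAt ℂ g z) (v : ℂ) :
    fderiv ℝ g z v = v * deriv g z := by
  rw [(hasFDerivAt_real h.hasDerivAt).fderiv]; simp

open Set Filter Topology in
lemma contDiff_of_tsupport {E : Type*} [NormedAddCommGroup E] [NormedSpace ℝ E] {f : ℂ → E} {O : Set ℂ}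
    (hO : IsOpen O) (hf : ContDiffOn ℝ 1 f O) (hs : tsupport f ⊆ O) : ContDiff ℝ 1 f := by
  rw [contDiff_iff_contDiffAt]
  intro x
  by_cases hx : x ∈ O
  · exact hf.contDiffAt (hO.mem_nhds hx)
  · have : f =ᶠ[𝓝 x] fun _ => 0 := notMem_tsupport_iff_eventuallyEq.1 (fun h => hx (hs h))
    exact contDiffAt_const.congr_of_eventuallyEq this

open Set Filter Topology in
lemma contDiff_mul_of_tsupport {ψ : ℂ → ℝ} {a : ℂ → ℂ} {O : Set ℂ}
    (hO : IsOpen O) (hψ : ContDiff ℝ 1 ψ) (ha : ContDiffOn ℝ 1 a O) (hs : tsupport ψ ⊆ O) :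
    ContDiff ℝ 1 (fun z => (ψ z : ℂ) * a z) := by
  refine contDiff_of_tsupport hO ?_ ?_
  · exact (Complex.ofRealCLM.contDiff.comp hψ).contDiffOn.mul ha
  · refine Subset.trans (closure_mono ?_) hs
    intro z hz hz0
    apply hz; simp [hz0]

lemma lin_re_im (L : ℂ →L[ℝ] ℂ) (v : ℂ) : L v = v.re * L 1 + v.im * L Complex.I := by
  conv_lhs => rw [← Complex.re_add_im v]
  rw [show (v.re:ℂ) + v.im * Complex.I = v.re • (1:ℂ) + v.im • Complex.I by simp]
  rw [map_add, map_smul, map_smul]; simp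

lemma lin_re_imR (L : ℂ →L[ℝ] ℝ) (v : ℂ) : L v = v.re * L 1 + v.im * L Complex.I := by
  conv_lhs => rw [← Complex.re_add_im v]
  rw [show (v.re:ℂ) + v.im * Complex.I = v.re • (1:ℂ) + v.im • Complex.I by simp]
  rw [map_add, map_smul, map_smul]; simp

open Set Filter Topology in
/-- image area of a holomorphic map -/
lemma volume_image_le {O K : Set ℂ} (hO : IsOpen O) {g : ℂ → ℂ} (hg : DifferentiableOn ℂ g O)
    (hK : MeasurableSet K) (hKO : K ⊆ O) :
    volume (g '' K) ≤ ∫⁻ z in K, ENNReal.ofReal (‖deriv g z‖ ^ 2) := by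
  have := addHaar_image_le_lintegral_abs_det_fderiv volume hK (f := g)
    (f' := fun z => ((ContinuousLinearMap.toSpanSingleton ℂ (deriv g z)).restrictScalars ℝ : ℂ →L[ℝ] ℂ))
    (fun z hz => (hasFDerivAt_real (hg.differentiableAt (hO.mem_nhds (hKO hz))).hasDerivAt).hasFDerivWithinAt)
  simpa only [det_mulC, abs_sq, abs_pow, abs_norm] using this

open Set Filter Topology in
lemma polar_symm_eq (p : ℝ × ℝ) : Complex.polarCoord.symm p = p.1 * Complex.exp (p.2 * Complex.I) := by
  rw [Complex.polarCoord_symm_apply, Complex.exp_mul_I]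
  push_cast; ring

open Set Filter Topology in
lemma locInt_inv : LocallyIntegrable (fun z : ℂ => z⁻¹) := by
  rw [locallyIntegrable_iff]
  intro K hK
  obtain ⟨R, hR⟩ := hK.isBounded.subset_closedBall 0
  refine IntegrableOn.mono_set ?_ hR
  rw [← integrable_indicator_iff Metric.isClosed_closedBall.measurableSet]
  refine ⟨?_, ?_⟩
  · exact (measurable_id.inv.indicator Metric.isClosed_closedBall.measurableSet).aestronglyMeasurable
  · rw [HasFiniteIntegral, ← Complex.lintegral_comp_polarCoord_symm]
    have hm : MeasurableSet polarCoord.target := (measurableSet_Ioi.prod measurableSet_Ioo)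
    have hm' : MeasurableSet (Icc (0:ℝ) R ×ˢ Icc (-π) π) := measurableSet_Icc.prod measurableSet_Icc
    calc _ ≤ ∫⁻ p in polarCoord.target, (Icc (0:ℝ) R ×ˢ Icc (-π) π).indicator 1 p := by
          apply setLIntegral_mono' hm
          rintro ⟨r, t⟩ ⟨hr, ht⟩
          have hr : 0 < r := hr
          have hn : ‖Complex.polarCoord.symm (r, t)‖ = r := by
            rw [Complex.norm_polarCoord_symm]; exact abs_of_pos hr
          by_cases hrR : r ≤ R
          · rw [indicator_of_mem (by simpa [abs_of_pos hr] using hrR),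
              indicator_of_mem (show (r, t) ∈ Icc (0:ℝ) R ×ˢ Icc (-π) π from ⟨⟨hr.le, hrR⟩, ⟨ht.1.le, ht.2.le⟩⟩)]
            rw [← ofReal_norm, norm_inv, hn, smul_eq_mul, ← ENNReal.ofReal_mul hr.le, mul_inv_cancel₀ hr.ne']
            simp
          · rw [indicator_of_notMem (by simpa [abs_of_pos hr] using hrR)]
            simp
      _ ≤ ∫⁻ p, (Icc (0:ℝ) R ×ˢ Icc (-π) π).indicator 1 p := setLIntegral_le_lintegral _ _
      _ < ⊤ := by
          rw [lintegral_indicator_one hm']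
          exact (isCompact_Icc.prod isCompact_Icc).measure_lt_top

/-- The Cauchy transform. -/
def cau (g : ℂ → ℂ) (x : ℂ) : ℂ := ∫ t, t⁻¹ * g (x - t)

lemma cau_eq_conv (g : ℂ → ℂ) :
    cau g = convolution (fun z : ℂ => z⁻¹) g (ContinuousLinearMap.mul ℝ ℂ) volume := by
  ext x; simp [cau, convolution]

lemma contDiff_cau {g : ℂ → ℂ} (hg : ContDiff ℝ 1 g) (hc : HasCompactSupport g) :
    ContDiff ℝ 1 (cau g) := by
  rw [cau_eq_conv]
  exact hc.contDiff_convolution_right _ locInt_inv hg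

lemma integrable_inv_mul {g : ℂ → ℂ} (hg : Continuous g) (hc : HasCompactSupport g) :
    Integrable (fun t : ℂ => t⁻¹ * g t) := by
  have := locInt_inv.integrable_smul_right_of_hasCompactSupport hg hc
  simpa [smul_eq_mul] using this

lemma hasCompactSupport_sub_left {E : Type*} [Zero E] {g : ℂ → E} (hc : HasCompactSupport g) (x : ℂ) :
    HasCompactSupport (fun t => g (x - t)) :=
  hc.comp_homeomorph (Homeomorph.subLeft x)

lemma fderiv_cau {g : ℂ → ℂ} (hg : ContDiff ℝ 1 g) (hc : HasCompactSupport g) (x v : ℂ) :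
    fderiv ℝ (cau g) x v = ∫ t, t⁻¹ * fderiv ℝ g (x - t) v := by
  have h := hc.hasFDerivAt_convolution_right (ContinuousLinearMap.mul ℝ ℂ) locInt_inv hg x
  rw [cau_eq_conv, h.fderiv, convolution_precompR_apply _ locInt_inv (hc.fderiv ℝ) (hg.continuous_fderiv one_ne_zero)]
  simp [convolution]

lemma dbar_cau {g : ℂ → ℂ} (hg : ContDiff ℝ 1 g) (hc : HasCompactSupport g) (x : ℂ) :
    dbar (cau g) x = π * g x := by
  have hF : ContDiff ℝ 1 (fun t => g (x - t)) := hg.comp (contDiff_const.sub contDiff_id)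
  have hFc := hasCompactSupport_sub_left hc x
  have h := pompeiu0 hF hFc
  have hi : ∀ v, Integrable (fun t : ℂ => t⁻¹ * fderiv ℝ g (x - t) v) := by
    intro v
    refine integrable_inv_mul (g := fun t => fderiv ℝ g (x - t) v) ?_ ?_
    · exact ((hg.continuous_fderiv one_ne_zero).comp (by fun_prop)).clm_apply continuous_const
    · exact hasCompactSupport_sub_left (hc.fderiv_apply (𝕜 := ℝ) v) x
  have hd : ∀ t v, fderiv ℝ (fun t => g (x - t)) t v = - fderiv ℝ g (x - t) v := by
    intro t v
    have h1 : HasFDerivAt (fun t : ℂ => x - t) (-(ContinuousLinearMap.id ℝ ℂ)) t :=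
      (hasFDerivAt_id t).const_sub x
    have h2 := (hg.differentiable one_ne_zero (x - t)).hasFDerivAt.comp t h1
    have h3 := h2.fderiv
    simp only [Function.comp_def] at h3
    rw [h3]; simp
  rw [dbar, fderiv_cau hg hc, fderiv_cau hg hc, ← integral_const_mul, ← integral_add (hi _) ((hi _).const_mul _),
    ← integral_const_mul]
  rw [sub_zero] at h
  rw [← neg_inj, ← integral_neg]
  rw [neg_mul] at h
  rw [← h]
  congr 1
  ext t
  rw [dbar, hd, hd]
  ring

open Set Filter Topology in
lemma integral_cospos : ∫ t in Ioo (-π) π, (max (Real.cos t) 0)^2 = π / 2 := by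
  have hp := pi_pos
  have hI : ∀ a b : ℝ, IntervalIntegrable (fun t => (max (Real.cos t) 0)^2) volume a b := by
    intro a b; apply Continuous.intervalIntegrable; fun_prop
  rw [← integral_Ioc_eq_integral_Ioo, ← intervalIntegral.integral_of_le (by linarith)]
  rw [← intervalIntegral.integral_add_adjacent_intervals (hI (-π) (-(π/2))) (hI (-(π/2)) π),
    ← intervalIntegral.integral_add_adjacent_intervals (hI (-(π/2)) (π/2)) (hI (π/2) π)]
  have h1 : ∫ t in (-π)..(-(π/2)), (max (Real.cos t) 0)^2 = 0 := by
    rw [intervalIntegral.integral_congr (g := fun _ => 0)]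
    · simp
    · intro t ht
      rw [uIcc_of_le (by linarith)] at ht
      have : Real.cos t ≤ 0 := by
        rw [← Real.cos_neg]; exact cos_nonpos_of_pi_div_two_le_of_le (by linarith [ht.2]) (by linarith [ht.1])
      simp [this]
  have h3 : ∫ t in (π/2)..π, (max (Real.cos t) 0)^2 = 0 := by
    rw [intervalIntegral.integral_congr (g := fun _ => 0)]
    · simp
    · intro t ht
      rw [uIcc_of_le (by linarith)] at ht
      have : Real.cos t ≤ 0 := cos_nonpos_of_pi_div_two_le_of_le (by linarith [ht.1]) (by linarith [ht.2])
      simp [this]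
  have h2 : ∫ t in (-(π/2))..(π/2), (max (Real.cos t) 0)^2 = π/2 := by
    rw [intervalIntegral.integral_congr (g := fun t => Real.cos t ^ 2)]
    · rw [integral_cos_sq]; simp
    · intro t ht
      rw [uIcc_of_le (by linarith)] at ht
      have : 0 ≤ Real.cos t := cos_nonneg_of_mem_Icc ht
      simp [this]
  rw [h1, h2, h3]; ring

open Set Filter Topology in
lemma re_cau_bound_aux {η : ℂ → ℝ} (hη : Continuous η) (hc : HasCompactSupport η)
    (h0 : ∀ z, 0 ≤ η z) (h1 : ∀ z, η z ≤ 1) {c : ℝ} (hcpos : 0 < c) :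
    (∫ z, z⁻¹ * (η z : ℂ)).re ≤ c * (∫ z, η z) + π / (4 * c) := by
  obtain ⟨R, hRpos, hR⟩ : ∃ R > 0, ∀ z : ℂ, R < ‖z‖ → η z = 0 := by
    obtain ⟨R, hR⟩ := hc.isCompact.isBounded.subset_closedBall 0
    refine ⟨max R 1, by positivity, fun z hz => ?_⟩
    by_contra hne
    have := hR (subset_tsupport η hne)
    simp at this
    exact absurd (lt_of_le_of_lt (le_max_left R 1) hz) (not_lt.2 this)
  have hηc : HasCompactSupport (fun z => (η z : ℂ)) := hc.comp_left (g := fun x : ℝ => (x:ℂ)) (by simp)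
  have hIntg : Integrable (fun z : ℂ => z⁻¹ * (η z : ℂ)) :=
    integrable_inv_mul (Complex.continuous_ofReal.comp hη) hηc
  have hre : (∫ z, z⁻¹ * (η z : ℂ)).re = ∫ z, (z⁻¹).re * η z := by
    have h := integral_re (𝕜 := ℂ) hIntg
    simp only [RCLike.re_to_complex] at h
    rw [← h]
    congr 1; ext z; simp
  rw [hre, ← Complex.integral_comp_polarCoord_symm, ← Complex.integral_comp_polarCoord_symm (f := η)]
  have ht : polarCoord.target = Ioi (0:ℝ) ×ˢ Ioo (-π) π := rfl
  have hm : MeasurableSet (Ioi (0:ℝ) ×ˢ Ioo (-π) π) := (measurableSet_Ioi.prod measurableSet_Ioo)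
  rw [ht]
  set E : ℝ × ℝ → ℂ := fun p => p.1 * Complex.exp (p.2 * Complex.I) with hE
  have hEc : Continuous E := by fun_prop
  have hEn : ∀ p : ℝ × ℝ, R < p.1 → R < ‖E p‖ := by
    intro p hp
    rw [hE]; simp only
    rw [norm_mul, Complex.norm_exp_ofReal_mul_I, mul_one, Complex.norm_real, Real.norm_eq_abs]
    exact lt_of_lt_of_le hp (le_abs_self _)
  have hi1 : IntegrableOn (fun p : ℝ × ℝ => p.1 * η (E p)) (Ioi (0:ℝ) ×ˢ Ioo (-π) π) :=
    polar_integrableOn (by fun_prop) R (fun p hp => by simp [hR _ (hEn p hp)])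
  have hi2 : IntegrableOn (fun p : ℝ × ℝ => Real.cos p.2 * η (E p)) (Ioi (0:ℝ) ×ˢ Ioo (-π) π) :=
    polar_integrableOn (by fun_prop) R (fun p hp => by simp [hR _ (hEn p hp)])
  have hi3 : IntegrableOn (fun p : ℝ × ℝ => max (Real.cos p.2 - c * p.1) 0) (Ioi (0:ℝ) ×ˢ Ioo (-π) π) := by
    refine polar_integrableOn (by fun_prop) (1/c) (fun p hp => ?_)
    rw [max_eq_right]
    have : 1 < c * p.1 := by rwa [div_lt_iff₀' hcpos] at hp
    linarith [Real.cos_le_one p.2]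
  have e1 : ∫ p in Ioi (0:ℝ) ×ˢ Ioo (-π) π, p.1 • ((Complex.polarCoord.symm p)⁻¹.re * η (Complex.polarCoord.symm p))
      = ∫ p in Ioi (0:ℝ) ×ˢ Ioo (-π) π, Real.cos p.2 * η (E p) := by
    apply setIntegral_congr_fun hm
    rintro ⟨r, t⟩ ⟨hr, _⟩
    have hr : 0 < r := hr
    simp only [polar_symm_eq]
    have : ((r:ℂ) * Complex.exp (t * Complex.I))⁻¹.re = Real.cos t / r := by
      rw [mul_inv, ← Complex.exp_neg, ← neg_mul, ← Complex.ofReal_neg, ← Complex.ofReal_inv, Complex.re_ofReal_mul,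
        Complex.exp_ofReal_mul_I_re, Real.cos_neg]
      ring
    rw [this, smul_eq_mul]
    field_simp
    rfl
  have e2 : ∫ p in Ioi (0:ℝ) ×ˢ Ioo (-π) π, p.1 • η (Complex.polarCoord.symm p)
      = ∫ p in Ioi (0:ℝ) ×ˢ Ioo (-π) π, p.1 * η (E p) := by
    simp only [polar_symm_eq, smul_eq_mul, hE]
  have e3 : ∫ p in Ioi (0:ℝ) ×ˢ Ioo (-π) π, max (Real.cos p.2 - c * p.1) 0 = π / (4 * c) := by
    rw [Measure.volume_eq_prod, ← setIntegral_prod_swap,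
      setIntegral_prod (fun z : ℝ × ℝ => (fun p : ℝ × ℝ => max (Real.cos p.2 - c * p.1) 0) z.swap) hi3.swap]
    have hinner : ∀ t : ℝ, ∫ r in Ioi (0:ℝ), max (Real.cos t - c * r) 0 = (max (Real.cos t) 0)^2 / (2 * c) := by
      intro t
      by_cases hcos : Real.cos t ≤ 0
      · rw [max_eq_right hcos, setIntegral_eq_zero_of_forall_eq_zero]; · simp
        intro r hr
        have : 0 < c * r := mul_pos hcpos hr
        rw [max_eq_right]; linarith
      · push Not at hcos
        rw [max_eq_left hcos.le]
        have hsub : ∫ r in Ioi (0:ℝ), max (Real.cos t - c * r) 0 = ∫ r in Ioc (0:ℝ) (Real.cos t / c), max (Real.cos t - c * r) 0 := by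
          apply setIntegral_eq_of_subset_of_forall_sdiff_eq_zero measurableSet_Ioi (fun r hr => hr.1)
          rintro r ⟨hr, hn⟩
          rw [max_eq_right]
          by_contra hlt; push Not at hlt
          exact hn ⟨hr, by rw [le_div_iff₀' hcpos]; linarith⟩
        rw [hsub, ← intervalIntegral.integral_of_le (by positivity)]
        rw [intervalIntegral.integral_congr (g := fun r => Real.cos t - c * r)]
        · rw [intervalIntegral.integral_sub (by simp) (by apply Continuous.intervalIntegrable; fun_prop)]
          rw [intervalIntegral.integral_const, intervalIntegral.integral_const_mul, integral_id, smul_eq_mul]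
          field_simp; ring
        · intro r hr
          rw [uIcc_of_le (by positivity)] at hr
          have := hr.2
          rw [le_div_iff₀' hcpos] at this
          exact max_eq_left (by linarith)
    simp only [Prod.swap, hinner]
    rw [integral_div, integral_cospos]; field_simp; norm_num
  rw [e1, e2, ← e3, ← integral_const_mul, ← integral_add (hi1.const_mul c) hi3]
  apply setIntegral_mono_on hi2 ((hi1.const_mul c).add hi3) hm
  rintro ⟨r, t⟩ _
  simp only [Pi.add_apply]
  have a0 := h0 (E (r, t)); have a1 := h1 (E (r, t))
  have m1 := le_max_left (Real.cos t - c * r) 0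
  have m2 := le_max_right (Real.cos t - c * r) 0
  nlinarith

lemma re_cau_bound {η : ℂ → ℝ} (hη : Continuous η) (hc : HasCompactSupport η)
    (h0 : ∀ z, 0 ≤ η z) (h1 : ∀ z, η z ≤ 1) {m : ℝ} (hm : 0 < m) (hηm : ∫ z, η z ≤ m) :
    (∫ z, z⁻¹ * (η z : ℂ)).re ≤ √(π * m) := by
  have hp := pi_pos
  set s := √(π * m) with hs
  have hspos : 0 < s := Real.sqrt_pos.2 (by positivity)
  have hsq : s ^ 2 = π * m := Real.sq_sqrt (by positivity)
  have := re_cau_bound_aux hη hc h0 h1 (c := s / (2 * m)) (by positivity)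
  refine this.trans ?_
  have h2 : s / (2 * m) * (∫ z, η z) ≤ s / (2 * m) * m := by gcongr
  have h3 : s / (2 * m) * m = s / 2 := by field_simp
  have h4 : π / (4 * (s / (2 * m))) = s / 2 := by
    field_simp; nlinarith
  linarith

lemma norm_cau_bound {θ : ℂ → ℝ} (hη : Continuous θ) (hc : HasCompactSupport θ)
    (h0 : ∀ z, 0 ≤ θ z) (h1 : ∀ z, θ z ≤ 1) {m : ℝ} (hm : 0 < m) (hηm : ∫ z, θ z ≤ m) (x : ℂ) :
    ‖cau (fun z => (θ z : ℂ)) x‖ ≤ √(π * m) := by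
  set w := cau (fun z => (θ z : ℂ)) x with hw
  by_cases hw0 : w = 0
  · rw [hw0]; simp
  -- rotate
  obtain ⟨a, ha1, ha⟩ : ∃ a : ℂ, ‖a‖ = 1 ∧ (a * w).re = ‖w‖ := by
    refine ⟨(starRingEnd ℂ) w / ‖w‖, ?_, ?_⟩
    · rw [norm_div]; simp [hw0]
    · rw [div_mul_eq_mul_div, mul_comm, Complex.mul_conj, ← Complex.ofReal_div, Complex.ofReal_re,
        Complex.normSq_eq_norm_sq, sq, mul_div_assoc, div_self (by simpa using hw0), mul_one]
  have ha0 : a ≠ 0 := by intro h; rw [h] at ha1; simp at ha1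
  let A : Circle := ⟨a, by simpa [Submonoid.unitSphere] using ha1⟩
  have hmp := (rotation A).measurePreserving
  have hme : MeasurableEmbedding (rotation A) := (rotation A).toHomeomorph.measurableEmbedding
  have e : a * w = ∫ z, z⁻¹ * ((fun z => θ (x - a * z)) z : ℂ) := by
    rw [hw, cau, ← integral_const_mul, ← hmp.integral_comp hme]
    congr 1
    ext z
    have : rotation A z = a * z := rfl
    rw [this]
    rw [mul_inv]
    field_simp
  rw [← ha, e]
  refine re_cau_bound (η := fun z => θ (x - a * z)) (by fun_prop) ?_ (fun z => h0 _) (fun z => h1 _) hm ?_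
  · have := hasCompactSupport_sub_left hc x
    exact this.comp_homeomorph (Homeomorph.mulLeft₀ a ha0)
  · have h5 := hmp.integral_comp hme (g := fun z => θ (x - z))
    have : ∀ z, rotation A z = a * z := fun _ => rfl
    simp only [this] at h5
    rw [h5, integral_sub_left_eq_self θ volume x]
    exact hηm

open Set Filter Topology in
lemma dbar_comp_aux {O : Set ℂ} (hO : IsOpen O) {g : ℂ → ℂ} (hg : DifferentiableOn ℂ g O)
    {C : ℂ → ℂ} (hC : ContDiff ℝ 1 C) {z : ℂ} (hz : z ∈ O) :
    dbar (fun z => deriv g z * C (g z)) z = ‖deriv g z‖ ^ 2 * dbar C (g z) := by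
  have hgz : DifferentiableAt ℂ g z := hg.differentiableAt (hO.mem_nhds hz)
  have hg'z : DifferentiableAt ℂ (deriv g) z := (hg.deriv hO).differentiableAt (hO.mem_nhds hz)
  have h1 := hasFDerivAt_real hgz.hasDerivAt
  have h2 := hasFDerivAt_real hg'z.hasDerivAt
  have h3 := (hC.differentiable one_ne_zero (g z)).hasFDerivAt.comp z h1
  have h4 := (h2.mul h3).fderiv
  simp only [Function.comp_def] at h4
  have h5 : fderiv ℝ (fun z => deriv g z * C (g z)) z = _ := h4
  rw [dbar, h5]
  set L := fderiv ℝ C (g z) with hL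
  have e : ((‖deriv g z‖ : ℂ))^2 = deriv g z * (starRingEnd ℂ) (deriv g z) := by
    rw [Complex.mul_conj, Complex.normSq_eq_norm_sq]; push_cast; rfl
  rw [dbar, e, ← hL]
  simp only [add_apply, smul_apply,
    ContinuousLinearMap.comp_apply, ContinuousLinearMap.coe_restrictScalars', ContinuousLinearMap.toSpanSingleton_apply,
    smul_eq_mul, one_mul]
  rw [lin_re_im L (deriv g z), lin_re_im L (Complex.I * deriv g z)]
  have e2 : (starRingEnd ℂ) (deriv g z) = (deriv g z).re - (deriv g z).im * Complex.I := by
    apply Complex.ext <;> simp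
  rw [e2]
  simp only [Complex.mul_re, Complex.mul_im, Complex.I_re, Complex.I_im]
  push_cast
  ring_nf
  rw [Complex.I_sq]; ring

open Set Filter Topology in
lemma FI_aux {O : Set ℂ} (hO : IsOpen O) {g : ℂ → ℂ} (hg : DifferentiableOn ℂ g O)
    {ψ : ℂ → ℝ} (hψ : ContDiff ℝ 1 ψ) (hc : HasCompactSupport ψ) (hs : tsupport ψ ⊆ O) {m : ℝ}
    (hm : volume.real (g '' tsupport ψ) < m) :
    2 * √π * ∫ z, ψ z * ‖deriv g z‖ ^ 2 ≤ (∫ z, gn ψ z * ‖deriv g z‖) * √m := by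
  have hgc : ContinuousOn g O := hg.continuousOn
  set K := g '' tsupport ψ with hK
  have hKc : IsCompact K := hc.isCompact.image_of_continuousOn (hgc.mono hs)
  have hmpos : 0 < m := lt_of_le_of_lt measureReal_nonneg hm
  -- open set
  obtain ⟨V, hKV, hVo, hVm⟩ : ∃ V, K ⊆ V ∧ IsOpen V ∧ volume V < ENNReal.ofReal m := by
    refine K.exists_isOpen_lt_of_lt _ ?_
    rw [← ofReal_measureReal (hKc.measure_lt_top).ne]
    exact (ENNReal.ofReal_lt_ofReal_iff hmpos).2 hm
  obtain ⟨θ, hθ, hθc, hθV, hθ1, hθ0, hθle⟩ := exists_cutoff hKc hVo hKV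
  have hθ' : ContDiff ℝ 1 θ := hθ.of_le (by exact_mod_cast le_top)
  have hθm : ∫ z, θ z ≤ m := by
    have hVr : volume.real V ≤ m := by
      rw [measureReal_def]; exact ENNReal.toReal_le_of_le_ofReal hmpos.le hVm.le
    refine le_trans ?_ hVr
    rw [← integral_indicator_one hVo.measurableSet]
    apply integral_mono (hθ'.continuous.integrable_of_hasCompactSupport hθc)
    · exact (integrable_indicator_iff hVo.measurableSet).2 (integrableOn_const (hVm.trans_le le_top).ne)
    · intro z
      by_cases hz : z ∈ V
      · simp [hz, hθle z]
      · have : θ z = 0 := by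
          by_contra h; exact hz (hθV (subset_tsupport θ h))
        simp [hz, this]
  set C := cau (fun z => (θ z : ℂ)) with hC
  have hθC : ContDiff ℝ 1 (fun z => (θ z : ℂ)) := Complex.ofRealCLM.contDiff.comp hθ'
  have hθCc : HasCompactSupport (fun z => (θ z : ℂ)) := hθc.comp_left (g := fun x : ℝ => (x:ℂ)) (by simp)
  have hCd : ContDiff ℝ 1 C := contDiff_cau hθC hθCc
  have hCb : ∀ x, ‖C x‖ ≤ √(π * m) := norm_cau_bound hθ'.continuous hθc hθ0 hθle hmpos hθm
  set a : ℂ → ℂ := fun z => deriv g z * C (g z) with ha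
  have hgC : ContDiffOn ℝ 1 g O := ((hg.contDiffOn (n := 1) hO).restrict_scalars ℝ)
  have hg'C : ContDiffOn ℝ 1 (deriv g) O := (((hg.deriv hO).contDiffOn (n := 1) hO).restrict_scalars ℝ)
  have haC : ContDiffOn ℝ 1 a O := hg'C.mul (hCd.comp_contDiffOn hgC)
  set F : ℂ → ℂ := fun z => (ψ z : ℂ) * a z with hF
  have hFC : ContDiff ℝ 1 F := contDiff_mul_of_tsupport hO hψ haC hs
  have hFc : HasCompactSupport F := by
    refine hc.mono ?_
    intro z hz hz0
    apply hz; simp [hF, hz0]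
  have hFz : ∫ z, dbar F z = 0 := by
    have hi : ∀ v, Integrable (fun z => fderiv ℝ F z v) := fun v =>
      ((hFC.continuous_fderiv one_ne_zero).clm_apply continuous_const).integrable_of_hasCompactSupport
        (hFc.fderiv_apply (𝕜 := ℝ) v)
    simp only [dbar]
    rw [integral_const_mul, integral_add (hi _) ((hi _).const_mul _), integral_const_mul,
      integral_fderiv_zero hFC hFc, integral_fderiv_zero hFC hFc]
    simp
  -- pointwise formula
  set dψ : ℂ → ℂ := fun z => (1/2) * ((fderiv ℝ ψ z 1 : ℝ) + Complex.I * (fderiv ℝ ψ z Complex.I : ℝ)) with hdψ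
  have hdn : ∀ z, ‖dψ z‖ = (1/2) * gn ψ z := by
    intro z
    rw [hdψ]; simp only
    rw [norm_mul, mul_comm Complex.I, Complex.norm_add_mul_I, gn, gdot]
    norm_num
    congr 1; ring
  have hpt : ∀ z, dbar F z = (π * (ψ z * ‖deriv g z‖ ^ 2) : ℝ) + dψ z * a z := by
    intro z
    by_cases hz : z ∈ tsupport ψ
    · have hzO := hs hz
      have h1 : HasFDerivAt (fun z => (ψ z : ℂ)) (Complex.ofRealCLM ∘L fderiv ℝ ψ z) z :=
        Complex.ofRealCLM.hasFDerivAt.comp z (hψ.differentiable one_ne_zero z).hasFDerivAt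
      have h2 : HasFDerivAt a (fderiv ℝ a z) z :=
        ((haC.contDiffAt (hO.mem_nhds hzO)).differentiableAt one_ne_zero).hasFDerivAt
      have h3 : fderiv ℝ F z = _ := (h1.mul h2).fderiv
      have h4 : dbar a z = _ := dbar_comp_aux hO hg hCd hzO
      rw [hC, dbar_cau hθC hθCc, hθ1.self_of_nhdsSet (g z) ⟨z, hz, rfl⟩] at h4
      have h5 : dbar F z = ψ z * dbar a z + dψ z * a z := by
        rw [dbar, h3, dbar]
        simp [hdψ]; ring
      rw [h5, h4]; push_cast; ring
    · have h0 : F =ᶠ[𝓝 z] fun _ => 0 := by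
        filter_upwards [notMem_tsupport_iff_eventuallyEq.1 hz] with y hy
        simp [hF, hy]
      have h1 := (notMem_tsupport_iff_eventuallyEq.1 hz).fderiv_eq (𝕜 := ℝ)
      have h2 : ψ z = 0 := image_eq_zero_of_notMem_tsupport hz
      have h3 : dψ z = 0 := by
        rw [hdψ]; simp only; rw [h1]; simp
      rw [dbar, h0.fderiv_eq, h2, h3]; simp
  have hgn0 : ∀ z, z ∉ tsupport ψ → gn ψ z = 0 := by
    intro z hz
    have h1 := (notMem_tsupport_iff_eventuallyEq.1 hz).fderiv_eq (𝕜 := ℝ)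
    rw [gn, gdot, h1]; simp
  have hdc := hψ.continuous_fderiv one_ne_zero
  have hgnc : Continuous (gn ψ) := by
    unfold gn gdot
    refine Continuous.sqrt ?_
    exact ((hdc.clm_apply continuous_const).mul (hdc.clm_apply continuous_const)).add
      ((hdc.clm_apply continuous_const).mul (hdc.clm_apply continuous_const))
  have hi1 : Integrable (fun z => ψ z * ‖deriv g z‖ ^ 2) := by
    refine (integrableOn_iff_integrable_of_support_subset (s := tsupport ψ) ?_).1 ?_
    · intro z hz
      by_contra h
      apply hz; simp [image_eq_zero_of_notMem_tsupport h]
    · refine ContinuousOn.integrableOn_compact hc ?_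
      exact hψ.continuous.continuousOn.mul ((hg'C.continuousOn.mono hs).norm.pow 2)
  have hi2 : Integrable (fun z => gn ψ z * ‖deriv g z‖) := by
    refine (integrableOn_iff_integrable_of_support_subset (s := tsupport ψ) ?_).1 ?_
    · intro z hz
      by_contra h
      apply hz; simp [hgn0 z h]
    · refine ContinuousOn.integrableOn_compact hc ?_
      exact hgnc.continuousOn.mul ((hg'C.continuousOn.mono hs).norm)
  have hi3 : Integrable (fun z => dψ z * a z) := by
    have : (fun z => dψ z * a z) = fun z => dbar F z - (π * (ψ z * ‖deriv g z‖ ^ 2) : ℝ) := by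
      ext z; rw [hpt]; ring
    rw [this]
    refine Integrable.sub ?_ (hi1.const_mul π).ofReal
    have hi : ∀ v, Integrable (fun z => fderiv ℝ F z v) := fun v =>
      ((hFC.continuous_fderiv one_ne_zero).clm_apply continuous_const).integrable_of_hasCompactSupport
        (hFc.fderiv_apply (𝕜 := ℝ) v)
    exact ((hi _).add ((hi _).const_mul _)).const_mul _
  have hkey : ((π * ∫ z, ψ z * ‖deriv g z‖ ^ 2 : ℝ) : ℂ) = - ∫ z, dψ z * a z := by
    rw [eq_neg_iff_add_eq_zero, ← hFz, ← integral_const_mul, ← integral_complex_ofReal]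
    simp only [hpt]
    exact (integral_add (hi1.const_mul π).ofReal hi3).symm
  have hnorm : π * ∫ z, ψ z * ‖deriv g z‖ ^ 2 ≤ (1/2) * √(π * m) * ∫ z, gn ψ z * ‖deriv g z‖ := by
    calc π * ∫ z, ψ z * ‖deriv g z‖ ^ 2 ≤ ‖((π * ∫ z, ψ z * ‖deriv g z‖ ^ 2 : ℝ) : ℂ)‖ := by
          rw [Complex.norm_real]; exact le_abs_self _
      _ = ‖∫ z, dψ z * a z‖ := by rw [hkey, norm_neg]
      _ ≤ ∫ z, (1/2) * √(π * m) * (gn ψ z * ‖deriv g z‖) := by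
          refine norm_integral_le_of_norm_le (hi2.const_mul _) (Eventually.of_forall fun z => ?_)
          rw [norm_mul, hdn, ha, norm_mul]
          have := mul_le_mul_of_nonneg_left (hCb (g z)) (mul_nonneg (gn_nonneg ψ z) (norm_nonneg (deriv g z)))
          linarith
      _ = _ := integral_const_mul _ _
  have hsp : √π * √π = π := Real.mul_self_sqrt pi_pos.le
  have hsq : 0 < √π := Real.sqrt_pos.2 pi_pos
  rw [Real.sqrt_mul pi_pos.le] at hnorm
  have : √π * (√π * ∫ z, ψ z * ‖deriv g z‖ ^ 2) ≤ √π * ((1/2) * √m * ∫ z, gn ψ z * ‖deriv g z‖) := by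
    rw [← mul_assoc, hsp]; linarith
  have := le_of_mul_le_mul_left this hsq
  linarith

open Set Filter Topology in
/-- Flat isoperimetric inequality in weak conformal form. -/
theorem FI {O : Set ℂ} (hO : IsOpen O) {g : ℂ → ℂ} (hg : DifferentiableOn ℂ g O)
    {ψ : ℂ → ℝ} (hψ : ContDiff ℝ 1 ψ) (hc : HasCompactSupport ψ) (hs : tsupport ψ ⊆ O) :
    2 * √π * ∫ z, ψ z * ‖deriv g z‖ ^ 2 ≤
      (∫ z, gn ψ z * ‖deriv g z‖) * √(∫ z in tsupport ψ, ‖deriv g z‖ ^ 2) := by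
  set A := ∫ z in tsupport ψ, ‖deriv g z‖ ^ 2 with hA
  have hi : IntegrableOn (fun z => ‖deriv g z‖ ^ 2) (tsupport ψ) :=
    ContinuousOn.integrableOn_compact hc (((hg.deriv hO).continuousOn.mono hs).norm.pow 2)
  have hvol : volume.real (g '' tsupport ψ) ≤ A := by
    have h := volume_image_le hO hg hc.isCompact.isClosed.measurableSet hs
    rw [← ofReal_integral_eq_lintegral_ofReal hi (Eventually.of_forall fun z => by positivity)] at h
    rw [measureReal_def]
    exact ENNReal.toReal_le_of_le_ofReal (integral_nonneg fun z => by positivity) h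
  have hlim : Tendsto (fun m => (∫ z, gn ψ z * ‖deriv g z‖) * √m) (𝓝[>] A)
      (𝓝 ((∫ z, gn ψ z * ‖deriv g z‖) * √A)) := by
    apply Tendsto.mono_left _ nhdsWithin_le_nhds
    exact (Real.continuous_sqrt.tendsto A).const_mul _
  refine ge_of_tendsto hlim ?_
  filter_upwards [self_mem_nhdsWithin] with m hm
  exact FI_aux hO hg hψ hc hs (lt_of_le_of_lt hvol hm)

lemma G_identity (P κ a b m m' n n' : ℝ) :
    (a * m * (P - κ * m) - n * (P - n)) - (b * m' * (P - κ * m') - n' * (P - n')) =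
    -(b - a) * (m' * (P - κ * m')) + a * (m - m') * (2 * n - 2 * κ * m + κ * (m - m') - (n - n'))
      - ((n - n') - a * (m - m')) * (P - 2 * n + (n - n')) := by ring

/-- elementary one-step estimate -/
lemma G_step {P κ a b m m' n n' N M : ℝ} {h ε ε' : ℝ} (hP : 0 < P) (hκ0 : 0 ≤ κ) (hκ1 : κ ≤ 1)
    (ha : 1 ≤ a) (hab : a ≤ b) (hba : b - a ≤ b * h) (hh : 0 < h) (hm : m' ≤ m) (hm' : 0 ≤ m')
    (hD1 : a * (m - m') ≤ n - n') (hD2 : n - n' ≤ b * (m - m')) (hn' : κ * m' ≤ n') (hnN : n ≤ N)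
    (hε : 0 < ε) (hε1 : ε ≤ 1) 
    (hloc : h * ((1/2) * m' * (P - κ * m') - ε) ≤ (1 + ε) * (n' - κ * m' + ε) * (m - m'))
    (hsm1 : 2 * b * ε ≤ ε') (hsm2 : 2 * b * ε * (N + 2) + b * h * (P + 5 * N) ≤ ε') :
    (b * m' * (P - κ * m') - n' * (P - n')) - ε' * ((m - m') + h) ≤ a * m * (P - κ * m) - n * (P - n) := by
  have hid := G_identity P κ a b m m' n n'
  have hb0 : 0 < b := by linarith
  have ha0 : 0 < a := by linarith
  set d := m - m' with hd
  set D := n - n' with hDd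
  have hd0 : 0 ≤ d := by linarith
  have hκm' : 0 ≤ κ * m' := by positivity
  have hn'0 : 0 ≤ n' := by linarith
  have hdD : d ≤ D := by nlinarith
  have hκd : κ * d ≤ d := by nlinarith
  have hN0 : 0 ≤ N := by linarith
  set x := n' - κ * m' with hx
  have hx0 : 0 ≤ x := by linarith
  have hxN : x ≤ N := by linarith
  have hDN : D ≤ N := by linarith
  set J := (1/2) * m' * (P - κ * m') with hJ
  have e0 : m' * (P - κ * m') = 2 * J := by rw [hJ]; ring
  have e1 : (b - a) * (2 * J) ≤ 2 * b * (h * ε + (1 + ε) * (x + ε) * d) := by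
    have hR : 0 ≤ h * ε + (1 + ε) * (x + ε) * d := by positivity
    have hhJ : h * J ≤ h * ε + (1 + ε) * (x + ε) * d := by linarith
    rcases le_total 0 J with hJ0 | hJ0
    · have : (b - a) * (2 * J) ≤ b * h * (2 * J) := by gcongr
      have h2 : b * (h * J) ≤ b * (h * ε + (1 + ε) * (x + ε) * d) := mul_le_mul_of_nonneg_left hhJ (by linarith)
      linarith
    · have : (b - a) * (2 * J) ≤ 0 := mul_nonpos_of_nonneg_of_nonpos (by linarith) (by linarith)
      have h2 : 0 ≤ 2 * b * (h * ε + (1 + ε) * (x + ε) * d) := by positivity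
      linarith
  have e2 : 2 * n - 2 * κ * m + κ * d - D = 2 * x + (D - κ * d) := by
    rw [hx, hd, hDd]; ring
  have e3 : a * d * (2 * x) ≤ a * d * (2 * n - 2 * κ * m + κ * d - D) := by
    rw [e2]; gcongr; linarith
  have e4 : (D - a * d) * (P - 2 * n + D) ≤ (b * h * d) * (P + 3 * N) := by
    have g1 : D - a * d ≤ b * h * d := by
      have : (b - a) * d ≤ b * h * d := by gcongr
      linarith
    calc (D - a * d) * (P - 2 * n + D) ≤ (D - a * d) * (P + 3 * N) :=
          mul_le_mul_of_nonneg_left (by linarith) (by linarith)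
      _ ≤ _ := mul_le_mul_of_nonneg_right g1 (by positivity)
  have e5 : b * d * (2 * x) - a * d * (2 * x) ≤ b * h * d * (2 * N) := by
    have : (b - a) * (d * (2 * x)) ≤ (b * h) * (d * (2 * N)) := by gcongr
    linarith
  have e6 : 2 * b * ((1 + ε) * (x + ε) * d) ≤ b * d * (2 * x) + 2 * b * ε * (N + 2) * d := by
    have : (1 + ε) * (x + ε) ≤ x + ε * (N + 2) := by nlinarith
    have h2 : 2 * b * d * ((1 + ε) * (x + ε)) ≤ 2 * b * d * (x + ε * (N + 2)) := by gcongr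
    linarith
  have e7 := mul_le_mul_of_nonneg_right hsm1 hh.le
  have e8 := mul_le_mul_of_nonneg_right hsm2 hd0
  rw [e0] at hid
  have e9 : a * m * (P - κ * m) - n * (P - n) - (b * m' * (P - κ * m') - n' * (P - n')) =
    -((b - a) * (2 * J)) + a * d * (2 * n - 2 * κ * m + κ * d - D) - (D - a * d) * (P - 2 * n + D) := by
    rw [hid]; ring
  linarith

open Set Filter Topology in
set_option maxHeartbeats 1000000 in
lemma ode_lemma {P κ : ℝ} (hP : 0 < P) (hκ0 : 0 ≤ κ) (hκ1 : κ ≤ 1) {μ ν : ℝ → ℝ} {T M N : ℝ} (hT : 0 < T)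
    (hμ : ∀ t s, 0 < t → t ≤ s → μ s ≤ μ t) (hμT : μ T = 0) (hνT : ν T = 0)
    (hD1 : ∀ t s, 0 < t → t ≤ s → Real.exp t * (μ t - μ s) ≤ ν t - ν s)
    (hD2 : ∀ t s, 0 < t → t ≤ s → ν t - ν s ≤ Real.exp s * (μ t - μ s))
    (hμl : Tendsto μ (𝓝[>] 0) (𝓝 M)) (hνl : Tendsto ν (𝓝[>] 0) (𝓝 N))
    (hloc : ∀ t, 0 < t → t ≤ T → ∀ ε > 0, ∃ h0 > 0, ∀ h, 0 < h → h < h0 → h < t →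
      h * ((1/2) * μ t * (P - κ * μ t) - ε) ≤ (1 + ε) * (ν t - κ * μ t + ε) * (μ (t - h) - μ t)) :
    N * (P - N) ≤ M * (P - κ * M) := by
  set G : ℝ → ℝ := fun t => Real.exp t * μ t * (P - κ * μ t) - ν t * (P - ν t) with hG
  set B := Real.exp T with hB
  have hexp1 : ∀ t, 0 < t → 1 ≤ Real.exp t := fun t ht => Real.one_le_exp ht.le
  have hμ0 : ∀ t, 0 < t → t ≤ T → 0 ≤ μ t := fun t h0 ht => hμT ▸ hμ t T h0 ht
  have hμM : ∀ t, 0 < t → μ t ≤ M := by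
    intro t ht
    refine ge_of_tendsto hμl ?_
    filter_upwards [self_mem_nhdsWithin, nhdsWithin_le_nhds (eventually_lt_nhds ht)] with s h1 h2
    exact hμ s t h1 h2.le
  have hνanti : ∀ t s, 0 < t → t ≤ s → ν s ≤ ν t := by
    intro t s h0 h1
    have := hD1 t s h0 h1
    have h2 : 0 ≤ Real.exp t * (μ t - μ s) := mul_nonneg (Real.exp_pos _).le (sub_nonneg.2 (hμ t s h0 h1))
    linarith
  have hνN : ∀ t, 0 < t → ν t ≤ N := by
    intro t ht
    refine ge_of_tendsto hνl ?_
    filter_upwards [self_mem_nhdsWithin, nhdsWithin_le_nhds (eventually_lt_nhds ht)] with s h1 h2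
    exact hνanti s t h1 h2.le
  have hνκ : ∀ t, 0 < t → t ≤ T → κ * μ t ≤ ν t := by
    intro t h0 hT'
    have := hD1 t T h0 hT'
    rw [hμT, hνT, sub_zero, sub_zero] at this
    have h1 := hexp1 t h0
    have h2 := hμ0 t h0 hT'
    nlinarith
  have hν0 : ∀ t, 0 < t → t ≤ T → 0 ≤ ν t := fun t h0 h1 =>
    (mul_nonneg hκ0 (hμ0 t h0 h1)).trans (hνκ t h0 h1)
  have hM0 : 0 ≤ M := (hμ0 T hT le_rfl).trans (hμM T hT)
  have hN0 : 0 ≤ N := (hν0 T hT le_rfl).trans (hνN T hT)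
  have hB0 : 1 ≤ B := hexp1 T hT
  have hexpd : ∀ t s, t ≤ s → Real.exp s - Real.exp t ≤ Real.exp s * (s - t) := by
    intro t s hts
    have h1 : Real.exp s - Real.exp t = Real.exp s * (1 - Real.exp (t - s)) := by
      rw [mul_sub, ← Real.exp_add]; simp
    have h2 : 1 - Real.exp (t - s) ≤ s - t := by linarith [Real.add_one_le_exp (t - s)]
    rw [h1]; gcongr
  -- left estimate
  set C := B * (M * (P + M) + M * (P + 3 * N)) with hC
  have hleft : ∀ t s, 0 < t → t ≤ s → s ≤ T → G s ≤ G t + C * (s - t) := by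
    intro t s ht hts hs
    have hid : G t - G s = _ := G_identity P κ (Real.exp t) (Real.exp s) (μ t) (μ s) (ν t) (ν s)
    clear_value G
    have e1 := hD1 t s ht hts
    have e2 := hD2 t s ht hts
    have hs0 : 0 < s := ht.trans_le hts
    have e3 := hνκ s hs0 hs
    have m0 := hμ0 s hs0 hs
    have m1 := hμM s hs0
    have m2 : μ s ≤ μ t := hμ t s ht hts
    have m3 := hμM t ht
    have n0 := hν0 s hs0 hs
    have n1 := hνN t ht
    have a1 := hexp1 t ht
    have hba : Real.exp s - Real.exp t ≤ B * (s - t) := by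
      refine (hexpd t s hts).trans ?_
      have h3 : Real.exp s ≤ B := Real.exp_le_exp.2 hs
      exact mul_le_mul_of_nonneg_right h3 (by linarith)
    have hba0 : 0 ≤ Real.exp s - Real.exp t := sub_nonneg.2 (Real.exp_le_exp.2 hts)
    generalize Real.exp t = a at *
    generalize Real.exp s = b at *
    set d := μ t - μ s with hd
    set D := ν t - ν s with hDd
    have hd0 : 0 ≤ d := by linarith
    have hdM : d ≤ M := by linarith
    have hκμ : κ * μ s = κ * μ t - κ * d := by rw [hd]; ring
    have hκd : κ * d ≤ d := by nlinarith
    have hdD : d ≤ D := by nlinarith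
    have f1 : 0 ≤ 2 * ν t - 2 * κ * μ t + κ * d - D := by nlinarith
    have f2 : 0 ≤ a * d * (2 * ν t - 2 * κ * μ t + κ * d - D) := by positivity
    have f3 : (b - a) * (μ s * (P - κ * μ s)) ≤ (b - a) * (M * (P + M)) := by
      apply mul_le_mul_of_nonneg_left _ hba0
      have : 0 ≤ κ * μ s := by positivity
      nlinarith
    have hDN : D ≤ N := by linarith
    have f4 : (D - a * d) * (P - 2 * ν t + D) ≤ (b - a) * (M * (P + 3 * N)) := by
      have g1 : (D - a * d) ≤ (b - a) * M := by
        have : (b - a) * d ≤ (b - a) * M := mul_le_mul_of_nonneg_left hdM hba0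
        linarith
      have g2 : P - 2 * ν t + D ≤ P + 3 * N := by linarith
      have g3 : 0 ≤ D - a * d := by linarith
      calc (D - a * d) * (P - 2 * ν t + D) ≤ (D - a * d) * (P + 3 * N) := mul_le_mul_of_nonneg_left g2 g3
        _ ≤ ((b - a) * M) * (P + 3 * N) := mul_le_mul_of_nonneg_right g1 (by positivity)
        _ = _ := by ring
    have f5 : (b - a) * (M * (P + M) + M * (P + 3 * N)) ≤ B * (s - t) * (M * (P + M) + M * (P + 3 * N)) :=
      mul_le_mul_of_nonneg_right hba (by positivity)
    have : G t - G s ≥ - (C * (s - t)) := by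
      have : G t - G s = -(b - a) * (μ s * (P - κ * μ s)) + a * d * (2 * ν t - 2 * κ * μ t + κ * d - D)
        - (D - a * d) * (P - 2 * ν t + D) := hid
      rw [this, hC]
      linarith
    linarith
  -- step estimate
  have hstep : ∀ ε' > 0, ∀ t, 0 < t → t ≤ T → ∃ h0 > 0, ∀ h, 0 < h → h < h0 → h < t →
      G t - ε' * ((μ (t - h) - μ t) + h) ≤ G (t - h) := by
    intro ε' hε' t ht htT
    have b1 : 1 ≤ Real.exp t := hexp1 t ht
    have hbe : 0 < 4 * Real.exp t * (N + 2) := by positivity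
    set ε := min 1 (ε' / (4 * Real.exp t * (N + 2))) with hεd
    have hε : 0 < ε := lt_min one_pos (by positivity)
    have hεle : 4 * Real.exp t * (N + 2) * ε ≤ ε' := by
      have : ε ≤ ε' / (4 * Real.exp t * (N + 2)) := min_le_right _ _
      rw [le_div_iff₀ hbe] at this
      linarith
    obtain ⟨h0, hh0, hl⟩ := hloc t ht htT ε hε
    have hbe2 : 0 < 2 * Real.exp t * (P + 5 * N) := by positivity
    refine ⟨min h0 (ε' / (2 * Real.exp t * (P + 5 * N))), lt_min hh0 (by positivity), ?_⟩
    intro h hpos hlt hht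
    have hlt1 := lt_of_lt_of_le hlt (min_le_left _ _)
    have hlt2 := lt_of_lt_of_le hlt (min_le_right _ _)
    rw [lt_div_iff₀ hbe2] at hlt2
    have hl := hl h hpos hlt1 hht
    have hp' : 0 < t - h := by linarith
    have hle : t - h ≤ t := by linarith
    refine G_step (N := N) (M := M) (ε := ε) hP hκ0 hκ1 (hexp1 _ hp') (Real.exp_le_exp.2 hle) ?_ hpos (hμ _ _ hp' hle) (hμ0 t ht htT)
      (hD1 _ _ hp' hle) (hD2 _ _ hp' hle) (hνκ t ht htT) (hνN _ hp') hε (min_le_left _ _) hl ?_ ?_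
    · have := hexpd (t - h) t hle
      simpa using this
    · have : 0 ≤ Real.exp t * N * ε := by positivity
      have h2 : 0 ≤ Real.exp t * ε := by positivity
      nlinarith
    · nlinarith
  -- real induction
  have hC0 : 0 ≤ C := by positivity
  have hGT : G T = 0 := by simp [hG, hμT, hνT]
  have hmain : ∀ t0, 0 < t0 → t0 < T → 0 ≤ G t0 := by
    intro t0 ht0 ht0T
    refine le_of_forall_pos_le_add fun δ hδ => ?_
    set ε' := δ / (M + T) with hε'
    have hε'0 : 0 < ε' := by positivity
    set H : ℝ → ℝ := fun t => G t + ε' * (μ t - t) with hH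
    set S := {t | t0 ≤ t ∧ t ≤ T ∧ H T ≤ H t} with hS
    have hSne : S.Nonempty := ⟨T, ht0T.le, le_rfl, le_rfl⟩
    have hSb : BddBelow S := ⟨t0, fun t ht => ht.1⟩
    set s := sInf S with hs
    have hs0 : s ≤ T := csInf_le hSb ⟨ht0T.le, le_rfl, le_rfl⟩
    have hsT : t0 ≤ s := le_csInf hSne fun t ht => ht.1
    have hsp : 0 < s := by linarith
    have hsS : H T ≤ H s := by
      refine le_of_forall_pos_le_add fun η hη => ?_
      obtain ⟨t, htS, hts⟩ := exists_lt_of_csInf_lt hSne (show s < s + η / (C + 1) by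
        have : 0 < η / (C + 1) := by positivity
        linarith)
      have hle : s ≤ t := csInf_le hSb htS
      have h1 := hleft s t hsp hle htS.2.1
      have h2 : μ t ≤ μ s := hμ s t hsp hle
      have h3 : C * (t - s) ≤ η := by
        have : t - s ≤ η / (C + 1) := by linarith
        calc C * (t - s) ≤ (C + 1) * (η / (C + 1)) := by
              apply mul_le_mul (by linarith) this (by linarith) (by linarith)
          _ = η := by field_simp
      have h4 := htS.2.2
      simp only [hH] at h4 ⊢
      nlinarith
    have hsT' : s = t0 := by
      by_contra hne
      have hlt : t0 < s := lt_of_le_of_ne hsT (Ne.symm hne)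
      obtain ⟨h0, hh0, hr⟩ := hstep ε' hε'0 s (by linarith) hs0
      set h := min (h0 / 2) (s - t0) with hh
      have hp : 0 < h := lt_min (by linarith) (by linarith)
      have hh1 : h < h0 := lt_of_le_of_lt (min_le_left _ _) (by linarith)
      have hh2 : h ≤ s - t0 := min_le_right _ _
      have := hr h hp hh1 (by linarith)
      have hmem : s - h ∈ S := by
        refine ⟨by linarith, by linarith, ?_⟩
        simp only [hH] at hsS ⊢
        nlinarith
      have := csInf_le hSb hmem
      linarith
    rw [hsT'] at hsS
    simp only [hH, hGT, hμT] at hsS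
    have h1 : ε' * (μ t0 - t0) + ε' * T ≤ ε' * (M + T) := by
      have := hμM t0 ht0
      nlinarith
    have h2 : ε' * (M + T) = δ := by rw [hε']; field_simp
    nlinarith
  -- limit to zero
  have hGl : Tendsto G (𝓝[>] 0) (𝓝 (Real.exp 0 * M * (P - κ * M) - N * (P - N))) := by
    have he : Tendsto Real.exp (𝓝[>] 0) (𝓝 (Real.exp 0)) := (Real.continuous_exp.tendsto 0).mono_left nhdsWithin_le_nhds
    exact ((he.mul hμl).mul (tendsto_const_nhds.sub (hμl.const_mul κ))).sub (hνl.mul (tendsto_const_nhds.sub hνl))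
  have : 0 ≤ Real.exp 0 * M * (P - κ * M) - N * (P - N) := by
    refine ge_of_tendsto hGl ?_
    filter_upwards [self_mem_nhdsWithin, nhdsWithin_le_nhds (eventually_lt_nhds hT)] with t h1 h2 using hmain t h1 h2
  rw [Real.exp_zero] at this
  linarith

/-- A `C¹` monotone step from `0` (left of `t1`) to `1` (right of `t2`). -/
def IsStep (T : ℝ → ℝ) (t1 t2 : ℝ) : Prop :=
  t1 < t2 ∧ ContDiff ℝ 1 T ∧ (∀ x ≤ t1, T x = 0) ∧ (∀ x, t2 ≤ x → T x = 1) ∧ (∀ x, 0 ≤ deriv T x)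

lemma IsStep.mono {T : ℝ → ℝ} {t1 t2 : ℝ} (h : IsStep T t1 t2) : Monotone T :=
  monotone_of_deriv_nonneg (h.2.1.differentiable one_ne_zero) h.2.2.2.2

lemma IsStep.nonneg {T : ℝ → ℝ} {t1 t2 : ℝ} (h : IsStep T t1 t2) (x : ℝ) : 0 ≤ T x := by
  rcases le_total x t1 with hx | hx
  · rw [h.2.2.1 x hx]
  · rw [← h.2.2.1 t1 le_rfl]; exact h.mono hx

lemma IsStep.le_one {T : ℝ → ℝ} {t1 t2 : ℝ} (h : IsStep T t1 t2) (x : ℝ) : T x ≤ 1 := by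
  rcases le_total x t2 with hx | hx
  · rw [← h.2.2.2.1 t2 le_rfl]; exact h.mono hx
  · rw [h.2.2.2.1 x hx]

open Set Filter Topology in
lemma IsStep.deriv_left {T : ℝ → ℝ} {t1 t2 : ℝ} (h : IsStep T t1 t2) {x : ℝ} (hx : x < t1) : deriv T x = 0 := by
  have : T =ᶠ[𝓝 x] fun _ => 0 := by
    filter_upwards [eventually_lt_nhds hx] with y hy using h.2.2.1 y hy.le
  rw [this.deriv_eq]; simp

open Set Filter Topology in
lemma IsStep.deriv_right {T : ℝ → ℝ} {t1 t2 : ℝ} (h : IsStep T t1 t2) {x : ℝ} (hx : t2 < x) : deriv T x = 0 := by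
  have : T =ᶠ[𝓝 x] fun _ => 1 := by
    filter_upwards [eventually_gt_nhds hx] with y hy using h.2.2.2.1 y hy.le
  rw [this.deriv_eq]; simp

open Set Filter Topology in
lemma exists_step_aux {a b δ : ℝ} (hab : a < b) (hδ : 0 < δ) :
    ∃ T, IsStep T a (b + δ) ∧ ∀ x, deriv T x ≤ 1 / (b - a) := by
  set c : ℝ → ℝ := fun x => max 0 (min 1 ((x - a) / (b - a))) with hc
  have hcc : Continuous c := by rw [hc]; fun_prop
  have hba : 0 < b - a := by linarith
  have hcm : Monotone c := by
    intro x y hxy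
    simp only [hc]
    gcongr
  have hcl : ∀ x, c x - c (x - δ) ≤ δ / (b - a) := by
    intro x
    have h1 : (x - δ - a) / (b - a) = (x - a) / (b - a) - δ / (b - a) := by ring
    have h2 : 0 < δ / (b - a) := by positivity
    simp only [hc, h1]
    generalize (x - a) / (b - a) = y
    generalize δ / (b - a) = d at *
    rcases max_cases 0 (min 1 y) with h | h <;> rcases max_cases 0 (min 1 (y - d)) with h' | h' <;>
      rcases min_cases 1 y with h3 | h3 <;> rcases min_cases 1 (y - d) with h4 | h4 <;> linarith
  set R : ℝ → ℝ := fun x => ∫ y in a..x, c y with hR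
  have hRd : ∀ x, HasDerivAt R (c x) x := fun x => 
    intervalIntegral.integral_hasDerivAt_right (hcc.intervalIntegrable _ _)
      (hcc.stronglyMeasurableAtFilter _ _) hcc.continuousAt
  set T : ℝ → ℝ := fun x => (R x - R (x - δ)) / δ with hT
  have hTd : ∀ x, HasDerivAt T ((c x - c (x - δ)) / δ) x := by
    intro x
    refine HasDerivAt.div_const ((hRd x).sub ?_) δ
    have := (hRd (x - δ)).comp x ((hasDerivAt_id x).sub_const δ)
    simpa [Function.comp_def] using this
  have hTd' : deriv T = fun x => (c x - c (x - δ)) / δ := funext fun x => (hTd x).deriv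
  have hc0 : ∀ x ≤ a, c x = 0 := by
    intro x hx
    simp only [hc]
    have : (x - a) / (b - a) ≤ 0 := div_nonpos_of_nonpos_of_nonneg (by linarith) hba.le
    rw [max_eq_left]; exact (min_le_right _ _).trans this
  have hc1 : ∀ x, b ≤ x → c x = 1 := by
    intro x hx
    simp only [hc]
    have : 1 ≤ (x - a) / (b - a) := by rw [le_div_iff₀ hba]; linarith
    rw [min_eq_left this]; simp
  have hR0 : ∀ x ≤ a, R x = 0 := by
    intro x hx
    simp only [hR]
    rw [intervalIntegral.integral_congr (g := fun _ => 0)]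
    · simp
    · intro y hy
      rw [uIcc_of_ge hx] at hy
      exact hc0 y hy.2
  refine ⟨T, ⟨by linarith, ?_, ?_, ?_, ?_⟩, ?_⟩
  · rw [contDiff_one_iff_deriv]
    refine ⟨fun x => (hTd x).differentiableAt, ?_⟩
    rw [hTd']; fun_prop
  · intro x hx
    simp only [hT]
    rw [hR0 x hx, hR0 (x - δ) (by linarith)]; simp
  · intro x hx
    simp only [hT, hR]
    rw [intervalIntegral.integral_interval_sub_left (hcc.intervalIntegrable _ _) (hcc.intervalIntegrable _ _),
      intervalIntegral.integral_congr (g := fun _ => 1)]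
    · simp [hδ.ne']
    · intro y hy
      rw [uIcc_of_le (by linarith)] at hy
      exact hc1 y (by linarith [hy.1])
  · intro x
    rw [hTd']
    exact div_nonneg (sub_nonneg.2 (hcm (by linarith))) hδ.le
  · intro x
    rw [hTd']
    have := hcl x
    simp only
    rw [div_le_iff₀ hδ]
    calc _ ≤ _ := this
      _ = _ := by ring

lemma exists_step {t h ε : ℝ} (hh : 0 < h) (hε : 0 < ε) :
    ∃ T t1 t2, IsStep T t1 t2 ∧ t - h < t1 ∧ t2 < t ∧ ∀ x, deriv T x ≤ (1 + ε) / h := by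
  set η := ε / (4 * (1 + ε)) with hη
  have hη0 : 0 < η := by positivity
  have hη1 : η * (4 * (1 + ε)) = ε := by rw [hη]; field_simp
  have hη2 : η < 1 / 4 := by nlinarith
  obtain ⟨T, hT, hd⟩ := exists_step_aux (a := t - h + η * h) (b := t - 2 * η * h) (δ := η * h)
    (by nlinarith) (by positivity)
  refine ⟨T, _, _, hT, by nlinarith, by nlinarith, fun x => (hd x).trans ?_⟩
  have e : t - 2 * η * h - (t - h + η * h) = (1 - 3 * η) * h := by ring
  rw [e, div_le_div_iff₀ (mul_pos (by linarith) hh) hh]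
  have : 1 ≤ (1 + ε) * (1 - 3 * η) := by nlinarith
  nlinarith

lemma cs_lemma {α : Type*} [MeasurableSpace α] {m : Measure α} {a b c : α → ℝ} (ha : Integrable a m) (hb : Integrable b m)
    (hc : Integrable c m) (ha0 : ∀ᵐ x ∂m, 0 ≤ a x) (hb0 : ∀ᵐ x ∂m, 0 ≤ b x) (h : ∀ᵐ x ∂m, c x ^ 2 ≤ a x * b x) :
    (∫ x, c x ∂m) ^ 2 ≤ (∫ x, a x ∂m) * (∫ x, b x ∂m) := by
  have key : ∀ y : ℝ, 0 ≤ (∫ x, a x ∂m) * (y * y) + (-2 * ∫ x, c x ∂m) * y + ∫ x, b x ∂m := by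
    intro y
    have : (∫ x, a x ∂m) * (y * y) + (-2 * ∫ x, c x ∂m) * y + ∫ x, b x ∂m
        = ∫ x, (a x * (y * y) + (-2 * c x) * y + b x) ∂m := by
      have i1 : Integrable (fun x => a x * (y * y)) m := ha.mul_const _
      have i2 : Integrable (fun x => (-2 * c x) * y) m := (hc.const_mul _).mul_const _
      have i3 : Integrable (fun x => a x * (y * y) + (-2 * c x) * y) m := i1.add i2
      rw [integral_add i3 hb, integral_add i1 i2, integral_mul_const, integral_mul_const, integral_const_mul]
    rw [this]
    apply integral_nonneg_of_ae
    filter_upwards [ha0, hb0, h] with x h1 h2 h3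
    simp only [Pi.zero_apply]
    rcases h1.eq_or_lt with h0 | h0
    · rw [← h0] at h3 ⊢
      have : c x = 0 := by nlinarith [sq_nonneg (c x)]
      rw [this]; linarith
    · by_contra hneg
      push Not at hneg
      have := mul_neg_of_pos_of_neg h0 hneg
      nlinarith [sq_nonneg (a x * y - c x)]
  have := discrim_le_zero key
  rw [discrim] at this
  nlinarith

open Set Filter Topology in
lemma step_comp {O : Set ℂ} (hO : IsOpen O) {φ : ℂ → ℝ} (hφ : ContDiffOn ℝ 1 φ O) {T : ℝ → ℝ} {t1 t2 : ℝ}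
    (hT : IsStep T t1 t2) (hc : IsCompact {z | z ∈ O ∧ t1 ≤ φ z}) :
    ContDiff ℝ 1 (O.indicator (T ∘ φ)) ∧ HasCompactSupport (O.indicator (T ∘ φ)) ∧
    tsupport (O.indicator (T ∘ φ)) ⊆ {z | z ∈ O ∧ t1 ≤ φ z} ∧
    (∀ z ∈ O, fderiv ℝ (O.indicator (T ∘ φ)) z = deriv T (φ z) • fderiv ℝ φ z) := by
  have hts : tsupport (O.indicator (T ∘ φ)) ⊆ {z | z ∈ O ∧ t1 ≤ φ z} := by
    refine closure_minimal ?_ hc.isClosed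
    intro z hz
    rw [Function.mem_support] at hz
    have hzO : z ∈ O := by
      by_contra h; exact hz (indicator_of_notMem h _)
    refine ⟨hzO, ?_⟩
    by_contra h
    push Not at h
    apply hz
    rw [indicator_of_mem hzO, Function.comp_apply, hT.2.2.1 _ h.le]
  refine ⟨?_, ?_, hts, ?_⟩
  · refine contDiff_of_tsupport hO ?_ (hts.trans fun z hz => hz.1)
    refine (hT.2.1.comp_contDiffOn hφ).congr ?_
    intro z hz
    rw [indicator_of_mem hz]
  · exact hc.of_isClosed_subset (isClosed_tsupport _) hts
  · intro z hz
    have h1 : O.indicator (T ∘ φ) =ᶠ[𝓝 z] T ∘ φ := by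
      filter_upwards [hO.mem_nhds hz] with y hy using indicator_of_mem hy _
    rw [h1.fderiv_eq]
    have h2 := (hT.2.1.differentiable one_ne_zero (φ z)).hasDerivAt
    have h3 := ((hφ.contDiffAt (hO.mem_nhds hz)).differentiableAt one_ne_zero).hasFDerivAt
    exact (h2.comp_hasFDerivAt z h3).fderiv

lemma gdot_smul_right {f g k : ℂ → ℝ} {z : ℂ} {c : ℝ} (h : fderiv ℝ k z = c • fderiv ℝ g z) :
    gdot f k z = c * gdot f g z := by
  unfold gdot; rw [h]; simp only [smul_apply, smul_eq_mul]; ring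

lemma gn_smul {g k : ℂ → ℝ} {z : ℂ} {c : ℝ} (hc : 0 ≤ c) (h : fderiv ℝ k z = c • fderiv ℝ g z) :
    gn k z = c * gn g z := by
  have : gdot k k z = c ^ 2 * gdot g g z := by
    unfold gdot; rw [h]; simp only [smul_apply, smul_eq_mul]; ring
  rw [gn, gn, this, Real.sqrt_mul (sq_nonneg c), Real.sqrt_sq hc]

open Set Filter Topology in
lemma gdot_continuousOn {O : Set ℂ} (hO : IsOpen O) {f g : ℂ → ℝ} (hf : ContDiffOn ℝ 1 f O) (hg : ContDiffOn ℝ 1 g O) :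
    ContinuousOn (gdot f g) O := by
  have h1 := hf.continuousOn_fderiv_of_isOpen hO le_rfl
  have h2 := hg.continuousOn_fderiv_of_isOpen hO le_rfl
  unfold gdot
  exact ((h1.clm_apply continuousOn_const).mul (h2.clm_apply continuousOn_const)).add
    ((h1.clm_apply continuousOn_const).mul (h2.clm_apply continuousOn_const))

open Set Filter Topology in
lemma gn_continuousOn {O : Set ℂ} (hO : IsOpen O) {f : ℂ → ℝ} (hf : ContDiffOn ℝ 1 f O) :
    ContinuousOn (gn f) O := (gdot_continuousOn hO hf hf).sqrt

open Set Filter Topology in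
lemma integrableOn_of_zero_off {O K : Set ℂ} (hK : IsCompact K) (hKO : K ⊆ O) (hO : MeasurableSet O) {f : ℂ → ℝ} (hf : ContinuousOn f K)
    (h0 : ∀ z ∈ O, z ∉ K → f z = 0) : IntegrableOn f O := by
  have h1 : IntegrableOn f K := hf.integrableOn_compact hK
  refine h1.of_forall_sdiff_eq_zero hO ?_
  rintro z ⟨h1, h2⟩
  exact h0 z h1 h2

open Set Filter Topology in
lemma tendsto_setInt {l : Filter ℝ} [l.IsCountablyGenerated] {A : ℝ → Set ℂ} {A0 D : Set ℂ} {f : ℂ → ℝ}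
    (hf : IntegrableOn f D) (hD : MeasurableSet D) (hA : ∀ᶠ s in l, MeasurableSet (A s) ∧ A s ⊆ D) (hA0 : MeasurableSet A0)
    (h : ∀ z, ∀ᶠ s in l, (z ∈ A s ↔ z ∈ A0)) :
    Tendsto (fun s => ∫ z in A s, f z) l (𝓝 (∫ z in A0, f z)) := by
  have h1 : (fun s => ∫ z, (A s).indicator f z) =ᶠ[l] fun s => ∫ z in A s, f z := by
    filter_upwards [hA] with s hs
    rw [integral_indicator hs.1]
  refine Tendsto.congr' h1 ?_
  rw [← integral_indicator hA0]
  refine tendsto_integral_filter_of_dominated_convergence (D.indicator fun z => ‖f z‖) ?_ ?_ ?_ ?_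
  · filter_upwards [hA] with s hs
    exact ((hf.mono_set hs.2).integrable_indicator hs.1).aestronglyMeasurable
  · filter_upwards [hA] with s hs
    refine Eventually.of_forall fun z => ?_
    by_cases hz : z ∈ A s
    · rw [indicator_of_mem hz, indicator_of_mem (hs.2 hz)]
    · rw [indicator_of_notMem hz]; simp only [norm_zero]
      exact indicator_nonneg (fun _ _ => norm_nonneg _) _
  · exact (integrable_indicator_iff hD).2 hf.norm
  · refine Eventually.of_forall fun z => ?_
    refine tendsto_const_nhds.congr' ?_
    filter_upwards [h z] with s hs
    by_cases hz : z ∈ A0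
    · rw [indicator_of_mem hz, indicator_of_mem (hs.2 hz)]
    · rw [indicator_of_notMem hz, indicator_of_notMem (fun h => hz (hs.1 h))]

/-- superlevel set -/
def lev (O : Set ℂ) (φ : ℂ → ℝ) (s : ℝ) : Set ℂ := {z | z ∈ O ∧ s ≤ φ z}

open Set Filter Topology in
lemma lev_tendsto_left {O : Set ℂ} {φ : ℂ → ℝ} {f : ℂ → ℝ} (hS : ∀ s, 0 < s → IsCompact (lev O φ s))
    (hf : IntegrableOn f {z | z ∈ O ∧ 0 < φ z}) {t : ℝ} (ht : 0 < t) :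
    Tendsto (fun s => ∫ z in lev O φ s, f z) (𝓝[<] t) (𝓝 (∫ z in lev O φ t, f z)) := by
  have hev : ∀ᶠ s in 𝓝[<] t, t / 2 < s := by
    filter_upwards [nhdsWithin_le_nhds (eventually_gt_nhds (show t / 2 < t by linarith))] with s hs using hs
  refine tendsto_setInt (D := lev O φ (t / 2)) (hf.mono_set ?_) (hS _ (by linarith)).measurableSet ?_ (hS _ ht).measurableSet ?_
  · rintro z ⟨h1, h2⟩; exact ⟨h1, by linarith⟩
  · filter_upwards [hev] with s hs
    refine ⟨(hS _ (by linarith)).measurableSet, ?_⟩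
    rintro z ⟨h1, h2⟩; exact ⟨h1, by linarith⟩
  · intro z
    by_cases hz : t ≤ φ z
    · filter_upwards [self_mem_nhdsWithin] with s hs
      have : s < t := hs
      simp only [lev, mem_ofPred_eq, hz, this.le.trans hz]
    · push Not at hz
      filter_upwards [nhdsWithin_le_nhds (eventually_gt_nhds hz)] with s hs
      simp only [lev, mem_ofPred_eq, not_le.2 hz, not_le.2 hs]

open Set Filter Topology in
lemma lev_tendsto_zero {O : Set ℂ} {φ : ℂ → ℝ} {f : ℂ → ℝ} (hS : ∀ s, 0 < s → IsCompact (lev O φ s))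
    (hm : MeasurableSet {z | z ∈ O ∧ 0 < φ z})
    (hf : IntegrableOn f {z | z ∈ O ∧ 0 < φ z}) :
    Tendsto (fun s => ∫ z in lev O φ s, f z) (𝓝[>] 0) (𝓝 (∫ z in {z | z ∈ O ∧ 0 < φ z}, f z)) := by
  refine tendsto_setInt hf hm ?_ hm ?_
  · filter_upwards [self_mem_nhdsWithin] with s hs
    have hs : 0 < s := hs
    refine ⟨(hS _ hs).measurableSet, ?_⟩
    rintro z ⟨h1, h2⟩; exact ⟨h1, by linarith⟩
  · intro z
    by_cases hz : 0 < φ z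
    · filter_upwards [nhdsWithin_le_nhds (eventually_lt_nhds hz)] with s hs
      simp only [lev, mem_ofPred_eq, hz, hs.le]
    · filter_upwards [self_mem_nhdsWithin] with s hs
      have hs : 0 < s := hs
      have : ¬ s ≤ φ z := by push Not at hz ⊢; linarith
      simp only [lev, mem_ofPred_eq, hz, this]

open Set Filter Topology in
set_option maxHeartbeats 2000000 in
theorem talenti {P κ : ℝ} (hP : 0 < P) (hκ0 : 0 ≤ κ) (hκ1 : κ ≤ 1) {O : Set ℂ} (hO : IsOpen O) {φ ρ : ℂ → ℝ}
    (hφ : ContDiffOn ℝ 1 φ O) (hρ : ContinuousOn ρ O) (hρ0 : ∀ z ∈ O, 0 ≤ ρ z) (hρi : IntegrableOn ρ O)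
    (hS : ∀ s, 0 < s → IsCompact (lev O φ s))
    (hweak : ∀ ψ : ℂ → ℝ, ContDiff ℝ 1 ψ → HasCompactSupport ψ → tsupport ψ ⊆ O → (∀ z, 0 ≤ ψ z) →
      ∫ z, gdot φ ψ z ≤ ∫ z, ρ z * (exp (φ z) - κ) * ψ z)
    (hiso : ∀ t, 0 < t → ∀ ε, 0 < ε → ∃ h0, 0 < h0 ∧ ∀ T t1 t2, IsStep T t1 t2 → t - h0 < t1 → 0 < t1 → t2 < t →
      (1/2) * (∫ z in lev O φ t, ρ z) * (P - κ * ∫ z in lev O φ t, ρ z) - ε ≤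
        (∫ z in O, deriv T (φ z) * gn φ z * √(ρ z)) ^ 2) :
    (∫ z in {z | z ∈ O ∧ 0 < φ z}, ρ z * exp (φ z)) * (P - ∫ z in {z | z ∈ O ∧ 0 < φ z}, ρ z * exp (φ z)) ≤
      (∫ z in {z | z ∈ O ∧ 0 < φ z}, ρ z) * (P - κ * ∫ z in {z | z ∈ O ∧ 0 < φ z}, ρ z) := by
  have hφc : ContinuousOn φ O := hφ.continuousOn
  have hsub : {z | z ∈ O ∧ 0 < φ z} ⊆ O := fun z hz => hz.1
  have hmo : IsOpen {z | z ∈ O ∧ 0 < φ z} := by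
    have := hφc.isOpen_inter_preimage hO (isOpen_Ioi (a := (0:ℝ)))
    exact this
  have hm := hmo.measurableSet
  obtain ⟨B, hB0, hB⟩ : ∃ B : ℝ, 0 < B ∧ ∀ z ∈ O, φ z ≤ B := by
    obtain ⟨B, hB⟩ := (hS 1 one_pos).bddAbove_image (f := φ) (hφc.mono fun z hz => hz.1)
    refine ⟨max B 1, by positivity, fun z hz => ?_⟩
    by_cases h : 1 ≤ φ z
    · exact (hB (mem_image_of_mem _ ⟨hz, h⟩)).trans (le_max_left _ _)
    · push Not at h; exact h.le.trans (le_max_right _ _)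
  have hρe : ContinuousOn (fun z => ρ z * exp (φ z)) O := hρ.mul hφc.rexp
  have hρei : IntegrableOn (fun z => ρ z * exp (φ z)) O := by
    refine Integrable.mono' (hρi.mul_const (exp B)) (hρe.aestronglyMeasurable hO.measurableSet) ?_
    rw [ae_restrict_iff' hO.measurableSet]
    refine Eventually.of_forall fun z hz => ?_
    rw [Real.norm_of_nonneg (mul_nonneg (hρ0 z hz) (exp_pos _).le)]
    exact mul_le_mul_of_nonneg_left (exp_le_exp.2 (hB z hz)) (hρ0 z hz)
  set μ : ℝ → ℝ := fun t => ∫ z in lev O φ t, ρ z with hμ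
  set ν : ℝ → ℝ := fun t => ∫ z in lev O φ t, ρ z * exp (φ z) with hν
  have hlevO : ∀ t, lev O φ t ⊆ O := fun t z hz => hz.1
  have hlev : ∀ {t s}, t ≤ s → lev O φ s ⊆ lev O φ t := fun hts z hz => ⟨hz.1, hts.trans hz.2⟩
  have hdiff : ∀ {f : ℂ → ℝ} (_ : IntegrableOn f O) {t s : ℝ}, 0 < t → t ≤ s →
      (∫ z in lev O φ t, f z) - (∫ z in lev O φ s, f z) = ∫ z in lev O φ t \ lev O φ s, f z := by
    intro f hf t s ht hts
    rw [setIntegral_sdiff (hS s (ht.trans_le hts)).measurableSet (hf.mono_set (hlevO t)) (hlev hts)]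
  have hTe : lev O φ (B + 1) = ∅ := by
    rw [eq_empty_iff_forall_notMem]; rintro z ⟨h1, h2⟩; linarith [hB z h1]
  have hms : ∀ {t s : ℝ}, 0 < t → t ≤ s → MeasurableSet (lev O φ t \ lev O φ s) := fun ht hts =>
    (hS _ ht).measurableSet.diff (hS _ (ht.trans_le hts)).measurableSet
  have hsubd : ∀ t s : ℝ, lev O φ t \ lev O φ s ⊆ O := fun t s z hz => hz.1.1
  refine ode_lemma hP hκ0 hκ1 (μ := μ) (ν := ν) (T := B + 1) (by linarith) ?_ ?_ ?_ ?_ ?_ ?_ ?_ ?_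
  · intro t s ht hts
    have := hdiff hρi ht hts
    have h2 : 0 ≤ ∫ z in lev O φ t \ lev O φ s, ρ z := setIntegral_nonneg (hms ht hts) fun z hz => hρ0 z hz.1.1
    simp only [hμ]; linarith
  · simp [hμ, hTe]
  · simp [hν, hTe]
  · intro t s ht hts
    simp only [hμ, hν]
    rw [hdiff hρi ht hts, hdiff hρei ht hts, ← integral_const_mul]
    refine setIntegral_mono_on ((hρi.mono_set (hsubd t s)).const_mul _) (hρei.mono_set (hsubd t s)) (hms ht hts) ?_
    intro z hz
    rw [mul_comm]
    exact mul_le_mul_of_nonneg_left (exp_le_exp.2 hz.1.2) (hρ0 z hz.1.1)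
  · intro t s ht hts
    simp only [hμ, hν]
    rw [hdiff hρi ht hts, hdiff hρei ht hts, ← integral_const_mul]
    refine setIntegral_mono_on (hρei.mono_set (hsubd t s)) ((hρi.mono_set (hsubd t s)).const_mul _) (hms ht hts) ?_
    intro z hz
    rw [mul_comm (exp s)]
    refine mul_le_mul_of_nonneg_left (exp_le_exp.2 ?_) (hρ0 z hz.1.1)
    by_contra h
    push Not at h
    exact hz.2 ⟨hz.1.1, h.le⟩
  · exact lev_tendsto_zero hS hm (hρi.mono_set hsub)
  · exact lev_tendsto_zero hS hm (hρei.mono_set hsub)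
  intro t ht htT ε hε
  obtain ⟨h0, hh0, hiso'⟩ := hiso t ht ε hε
  have hlim : ∀ᶠ s in 𝓝[<] t, ν s < ν t + ε :=
    (lev_tendsto_left hS (hρei.mono_set hsub) ht).eventually (eventually_lt_nhds (by linarith))
  obtain ⟨l, hl, hlim'⟩ := (mem_nhdsLT_iff_exists_Ioo_subset).1 hlim
  have hl : l < t := hl
  refine ⟨min h0 (t - l), lt_min hh0 (by linarith), ?_⟩
  intro h hh hhm hht
  have hhh0 : h < h0 := hhm.trans_le (min_le_left _ _)
  have hhl : h < t - l := hhm.trans_le (min_le_right _ _)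
  have hνt : ν (t - h) < ν t + ε := hlim' ⟨by linarith, by linarith⟩
  obtain ⟨T, t1, t2, hT, ht1, ht2, hTd⟩ := exists_step (t := t) hh hε
  have ht10 : 0 < t1 := by linarith
  have hJ := hiso' T t1 t2 hT (by linarith) ht10 ht2
  have hTc : Continuous (deriv T) := hT.2.1.continuous_deriv le_rfl
  have hTφ : ContinuousOn (fun z => deriv T (φ z)) O := hTc.comp_continuousOn hφc
  obtain ⟨hψ1, hψ2, hψ3, hψ4⟩ := step_comp hO hφ hT (hS t1 ht10)
  set ψ := O.indicator (T ∘ φ) with hψ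
  have hoff : ∀ z ∈ O, z ∉ lev O φ t1 → deriv T (φ z) = 0 := by
    intro z hz hzn
    apply hT.deriv_left
    by_contra h; push Not at h; exact hzn ⟨hz, h⟩
  have hgnc := gn_continuousOn hO hφ
  have hgdc := gdot_continuousOn hO hφ hφ
  have ia : IntegrableOn (fun z => deriv T (φ z) * gdot φ φ z) O := by
    refine integrableOn_of_zero_off (hS t1 ht10) (hlevO t1) hO.measurableSet ((hTφ.mul hgdc).mono (hlevO t1)) ?_
    intro z hz hzn; simp only [hoff z hz hzn, zero_mul]
  have ib : IntegrableOn (fun z => deriv T (φ z) * ρ z) O := by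
    refine integrableOn_of_zero_off (hS t1 ht10) (hlevO t1) hO.measurableSet ((hTφ.mul hρ).mono (hlevO t1)) ?_
    intro z hz hzn; simp only [hoff z hz hzn, zero_mul]
  have ic : IntegrableOn (fun z => deriv T (φ z) * gn φ z * √(ρ z)) O := by
    refine integrableOn_of_zero_off (hS t1 ht10) (hlevO t1) hO.measurableSet (((hTφ.mul hgnc).mul hρ.sqrt).mono (hlevO t1)) ?_
    intro z hz hzn; simp only [hoff z hz hzn, zero_mul]
  have hcs := cs_lemma ia ib ic
    (by rw [ae_restrict_iff' hO.measurableSet]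
        exact Eventually.of_forall fun z hz => mul_nonneg (hT.2.2.2.2 _) (gdot_self_nonneg _ _))
    (by rw [ae_restrict_iff' hO.measurableSet]
        exact Eventually.of_forall fun z hz => mul_nonneg (hT.2.2.2.2 _) (hρ0 z hz))
    (by rw [ae_restrict_iff' hO.measurableSet]
        refine Eventually.of_forall fun z hz => le_of_eq ?_
        rw [mul_pow, mul_pow, gn_sq, Real.sq_sqrt (hρ0 z hz)]; ring)
  have hA : ∫ z in O, deriv T (φ z) * gdot φ φ z ≤ ν (t - h) - κ * μ (t - h) := by
    have e1 : ∫ z in O, deriv T (φ z) * gdot φ φ z = ∫ z, gdot φ ψ z := by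
      rw [← setIntegral_eq_integral_of_forall_compl_eq_zero (s := O) (f := gdot φ ψ)]
      · refine setIntegral_congr_fun hO.measurableSet fun z hz => ?_
        exact (gdot_smul_right (hψ4 z hz)).symm
      · intro z hz
        have : z ∉ tsupport ψ := fun h => hz (hψ3 h).1
        have h2 : ψ =ᶠ[𝓝 z] fun _ => 0 := notMem_tsupport_iff_eventuallyEq.1 this
        unfold gdot; rw [h2.fderiv_eq]; simp
    rw [e1]
    have hψ0 : ∀ z, 0 ≤ ψ z := fun z => indicator_nonneg (fun z _ => hT.nonneg _) z
    refine (hweak ψ hψ1 hψ2 (hψ3.trans fun z hz => hz.1) hψ0).trans ?_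
    have hth : 0 < t - h := by linarith
    have hsub1 : lev O φ t1 ⊆ lev O φ (t - h) := hlev (by linarith)
    have i1 : IntegrableOn (fun z => ρ z * exp (φ z)) (lev O φ (t - h)) := hρei.mono_set (hlevO _)
    have i2 : IntegrableOn (fun z => κ * ρ z) (lev O φ (t - h)) := (hρi.mono_set (hlevO _)).const_mul κ
    simp only [hμ, hν]
    rw [← integral_const_mul, ← integral_sub i1 i2]
    have hzero : ∀ z, z ∉ lev O φ (t - h) → ρ z * (exp (φ z) - κ) * ψ z = 0 := by
      intro z hz
      have : ψ z = 0 := by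
        apply image_eq_zero_of_notMem_tsupport
        exact fun h => hz (hsub1 (hψ3 h))
      rw [this, mul_zero]
    rw [← setIntegral_eq_integral_of_forall_compl_eq_zero hzero]
    have hcpt := hS (t - h) hth
    refine setIntegral_mono_on ?_ (i1.sub i2) hcpt.measurableSet ?_
    · refine ContinuousOn.integrableOn_compact hcpt ?_
      exact ((hρ.mul (hφc.rexp.sub continuousOn_const)).mono (hlevO _)).mul hψ1.continuous.continuousOn
    · intro z hz
      have h1 : ψ z ≤ 1 := by
        rw [hψ, indicator_of_mem hz.1]; exact hT.le_one _
      have h2 : 0 ≤ ρ z * (exp (φ z) - κ) := by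
        refine mul_nonneg (hρ0 z hz.1) ?_
        have : 1 ≤ exp (φ z) := Real.one_le_exp (by linarith [hz.2])
        linarith
      calc ρ z * (exp (φ z) - κ) * ψ z ≤ ρ z * (exp (φ z) - κ) * 1 := mul_le_mul_of_nonneg_left h1 h2
        _ = _ := by ring
  have hBb : ∫ z in O, deriv T (φ z) * ρ z ≤ (1 + ε) / h * (μ (t - h) - μ t) := by
    simp only [hμ]
    have hth : 0 < t - h := by linarith
    rw [hdiff hρi hth (by linarith), ← integral_const_mul]
    rw [setIntegral_eq_of_subset_of_forall_sdiff_eq_zero hO.measurableSet (hsubd (t - h) t)]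
    · refine setIntegral_mono_on (ib.mono_set (hsubd _ _)) ((hρi.mono_set (hsubd _ _)).const_mul _) (hms hth (by linarith)) ?_
      intro z hz
      exact mul_le_mul_of_nonneg_right (hTd _) (hρ0 z hz.1.1)
    · rintro z ⟨hzO, hz⟩
      have : deriv T (φ z) = 0 := by
        by_cases h1 : t ≤ φ z
        · exact hT.deriv_right (by linarith)
        · refine hT.deriv_left ?_
          by_contra h2
          push Not at h2
          exact hz ⟨⟨hzO, by linarith⟩, fun h3 => h1 h3.2⟩
      simp [this]
  have hμm : μ t ≤ μ (t - h) := by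
    have := hdiff hρi (show 0 < t - h by linarith) (show t - h ≤ t by linarith)
    have h2 : 0 ≤ ∫ z in lev O φ (t - h) \ lev O φ t, ρ z :=
      setIntegral_nonneg (hms (by linarith) (by linarith)) fun z hz => hρ0 z hz.1.1
    simp only [hμ]; linarith
  have hA0 : 0 ≤ ∫ z in O, deriv T (φ z) * gdot φ φ z :=
    setIntegral_nonneg hO.measurableSet fun z _ => mul_nonneg (hT.2.2.2.2 _) (gdot_self_nonneg _ _)
  have hA' : ∫ z in O, deriv T (φ z) * gdot φ φ z ≤ ν t - κ * μ t + ε := by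
    nlinarith [mul_le_mul_of_nonneg_left hμm hκ0]
  have hB0' : 0 ≤ (1 + ε) / h * (μ (t - h) - μ t) := mul_nonneg (by positivity) (by linarith)
  have hfin : (∫ z in O, deriv T (φ z) * gdot φ φ z) * (∫ z in O, deriv T (φ z) * ρ z) ≤
      (ν t - κ * μ t + ε) * ((1 + ε) / h * (μ (t - h) - μ t)) :=
    (mul_le_mul_of_nonneg_left hBb hA0).trans (mul_le_mul_of_nonneg_right hA' hB0')
  have := mul_le_mul_of_nonneg_left ((hJ.trans hcs).trans hfin) hh.le
  refine this.trans (le_of_eq ?_)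
  field_simp

open Set Filter Topology in
set_option maxHeartbeats 1000000 in
/-- Bol inequality relative to a flat metric. -/
theorem bolA {O : Set ℂ} (hO : IsOpen O) {φ : ℂ → ℝ} {g : ℂ → ℂ}
    (hφ : ContDiffOn ℝ 1 φ O) (hg : DifferentiableOn ℂ g O) (hρi : IntegrableOn (fun z => ‖deriv g z‖ ^ 2) O)
    (hS : ∀ s, 0 < s → IsCompact (lev O φ s))
    (hweak : ∀ ψ : ℂ → ℝ, ContDiff ℝ 1 ψ → HasCompactSupport ψ → tsupport ψ ⊆ O → (∀ z, 0 ≤ ψ z) →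
      ∫ z, gdot φ ψ z ≤ ∫ z, ‖deriv g z‖ ^ 2 * exp (φ z) * ψ z) :
    (∫ z in {z | z ∈ O ∧ 0 < φ z}, ‖deriv g z‖ ^ 2 * exp (φ z)) *
      (8 * π - ∫ z in {z | z ∈ O ∧ 0 < φ z}, ‖deriv g z‖ ^ 2 * exp (φ z)) ≤
      (∫ z in {z | z ∈ O ∧ 0 < φ z}, ‖deriv g z‖ ^ 2) * (8 * π) := by
  have hφc : ContinuousOn φ O := hφ.continuousOn
  have hgc : ContinuousOn (fun z => ‖deriv g z‖) O := (hg.deriv hO).continuousOn.norm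
  have key := talenti (P := 8 * π) (κ := 0) (by positivity) le_rfl zero_le_one hO hφ (ρ := fun z => ‖deriv g z‖ ^ 2)
    (hgc.pow 2) (fun z _ => by positivity) hρi hS
    (by simpa only [sub_zero] using hweak) ?_
  · simpa only [zero_mul, sub_zero] using key
  intro t ht ε hε
  have hsub : {z | z ∈ O ∧ 0 < φ z} ⊆ O := fun z hz => hz.1
  set μ : ℝ → ℝ := fun t => ∫ z in lev O φ t, ‖deriv g z‖ ^ 2 with hμ
  have hμ0 : ∀ t, 0 ≤ μ t := fun t => integral_nonneg fun z => by positivity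
  set δ := ε / (4 * π) with hδ
  have hδ0 : 0 < δ := by positivity
  have hlim : ∀ᶠ s in 𝓝[<] t, μ s < μ t + δ :=
    (lev_tendsto_left hS (hρi.mono_set hsub) ht).eventually (eventually_lt_nhds (by simp only [hμ]; linarith))
  obtain ⟨l, hl, hlim'⟩ := (mem_nhdsLT_iff_exists_Ioo_subset).1 hlim
  have hl : l < t := hl
  set s := (max l 0 + t) / 2 with hs
  have hmx : max l 0 < t := max_lt hl ht
  have hsl : l < s := by rw [hs]; linarith [le_max_left l 0]
  have hs0 : 0 < s := by rw [hs]; linarith [le_max_right l 0]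
  have hst : s < t := by rw [hs]; linarith
  have hμs : μ s < μ t + δ := hlim' ⟨hsl, hst⟩
  refine ⟨t - s, by linarith, ?_⟩
  intro T t1 t2 hT ht1 ht10 ht2
  have ht1s : s ≤ t1 := by linarith
  obtain ⟨hψ1, hψ2, hψ3, hψ4⟩ := step_comp hO hφ hT (hS t1 ht10)
  set ψ := O.indicator (T ∘ φ) with hψ
  have hψ0 : ∀ z, 0 ≤ ψ z := fun z => indicator_nonneg (fun z _ => hT.nonneg _) z
  have hψO : tsupport ψ ⊆ O := hψ3.trans fun z hz => hz.1
  have fi := FI hO hg hψ1 hψ2 hψO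
  have hgd2 : ContinuousOn (fun z => ‖deriv g z‖ ^ 2) O := hgc.pow 2
  have iψ : Integrable (fun z => ψ z * ‖deriv g z‖ ^ 2) := by
    rw [← integrableOn_iff_integrable_of_support_subset (s := tsupport ψ)]
    · exact (hψ1.continuous.continuousOn.mul (hgd2.mono hψO)).integrableOn_compact hψ2
    · intro z hz
      by_contra h
      exact hz (by simp [image_eq_zero_of_notMem_tsupport h])
  have e1 : μ t ≤ ∫ z, ψ z * ‖deriv g z‖ ^ 2 := by
    calc μ t = ∫ z in lev O φ t, ψ z * ‖deriv g z‖ ^ 2 := by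
          refine setIntegral_congr_fun (hS t ht).measurableSet fun z hz => ?_
          have : ψ z = 1 := by
            rw [hψ, indicator_of_mem hz.1]; exact hT.2.2.2.1 _ (by linarith [hz.2])
          simp [this]
      _ ≤ _ := setIntegral_le_integral iψ (Eventually.of_forall fun z => mul_nonneg (hψ0 z) (by positivity))
  have e2 : ∫ z, gn ψ z * ‖deriv g z‖ = ∫ z in O, deriv T (φ z) * gn φ z * √(‖deriv g z‖ ^ 2) := by
    rw [← setIntegral_eq_integral_of_forall_compl_eq_zero (s := O)]
    · refine setIntegral_congr_fun hO.measurableSet fun z hz => ?_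
      rw [gn_smul (hT.2.2.2.2 _) (hψ4 z hz), Real.sqrt_sq (norm_nonneg _)]
    · intro z hz
      have h2 : ψ =ᶠ[𝓝 z] fun _ => 0 := notMem_tsupport_iff_eventuallyEq.1 (fun h => hz (hψO h))
      have : gn ψ z = 0 := by unfold gn gdot; rw [h2.fderiv_eq]; simp
      rw [this, zero_mul]
  have e3 : ∫ z in tsupport ψ, ‖deriv g z‖ ^ 2 ≤ μ s := by
    refine setIntegral_mono_set (hρi.mono_set fun z hz => hz.1) (Eventually.of_forall fun z => by positivity) ?_
    refine LE.le.eventuallyLE ?_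
    exact hψ3.trans fun z hz => ⟨hz.1, by linarith [hz.2]⟩
  rw [e2] at fi
  set Λ := ∫ z in O, deriv T (φ z) * gn φ z * √(‖deriv g z‖ ^ 2) with hΛ
  have hΛ0 : 0 ≤ Λ := setIntegral_nonneg hO.measurableSet fun z hz =>
    mul_nonneg (mul_nonneg (hT.2.2.2.2 _) (gn_nonneg _ _)) (Real.sqrt_nonneg _)
  have f1 : 2 * √π * μ t ≤ Λ * √(μ t + δ) := by
    calc 2 * √π * μ t ≤ 2 * √π * ∫ z, ψ z * ‖deriv g z‖ ^ 2 := by gcongr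
      _ ≤ _ := fi
      _ ≤ _ := by gcongr; linarith
  have f2 : 4 * π * μ t ^ 2 ≤ Λ ^ 2 * (μ t + δ) := by
    have h1 : 0 ≤ 2 * √π * μ t := mul_nonneg (by positivity) (hμ0 t)
    have := pow_le_pow_left₀ h1 f1 2
    rw [mul_pow, mul_pow, mul_pow, Real.sq_sqrt pi_pos.le, Real.sq_sqrt (by linarith [hμ0 t])] at this
    linarith
  have f3 : 4 * π * δ = ε := by rw [hδ]; field_simp
  have : 4 * π * (μ t - δ) ≤ Λ ^ 2 := by
    by_contra hcon
    push Not at hcon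
    have := mul_lt_mul_of_pos_right hcon (show 0 < μ t + δ by linarith [hμ0 t])
    nlinarith [mul_pos pi_pos (mul_pos hδ0 hδ0)]
  change 1 / 2 * μ t * (8 * π - 0 * μ t) - ε ≤ Λ ^ 2
  nlinarith

/-- uniformly approximable by polynomials on `K` -/
def Pp (K : Set ℂ) (f : ℂ → ℂ) : Prop := ∀ ε : ℝ, 0 < ε → ∃ P : Polynomial ℂ, ∀ z ∈ K, ‖f z - P.eval z‖ ≤ ε

/-- uniformly approximable by real parts of polynomials on `K` -/
def Rp (K : Set ℂ) (f : ℂ → ℝ) : Prop := ∀ ε : ℝ, 0 < ε → ∃ P : Polynomial ℂ, ∀ z ∈ K, |f z - (P.eval z).re| ≤ ε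

lemma Pp.closed {K : Set ℂ} {f : ℂ → ℂ} (h : ∀ ε : ℝ, 0 < ε → ∃ g, Pp K g ∧ ∀ z ∈ K, ‖f z - g z‖ ≤ ε) : Pp K f := by
  intro ε hε
  obtain ⟨g, hg, hfg⟩ := h (ε / 2) (by positivity)
  obtain ⟨P, hP⟩ := hg (ε / 2) (by positivity)
  refine ⟨P, fun z hz => ?_⟩
  calc ‖f z - P.eval z‖ = ‖(f z - g z) + (g z - P.eval z)‖ := by congr 1; ring
    _ ≤ ‖f z - g z‖ + ‖g z - P.eval z‖ := norm_add_le _ _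
    _ ≤ ε := by linarith [hfg z hz, hP z hz]

lemma Rp.closed {K : Set ℂ} {f : ℂ → ℝ} (h : ∀ ε : ℝ, 0 < ε → ∃ g, Rp K g ∧ ∀ z ∈ K, |f z - g z| ≤ ε) : Rp K f := by
  intro ε hε
  obtain ⟨g, hg, hfg⟩ := h (ε / 2) (by positivity)
  obtain ⟨P, hP⟩ := hg (ε / 2) (by positivity)
  refine ⟨P, fun z hz => ?_⟩
  calc |f z - (P.eval z).re| = |(f z - g z) + (g z - (P.eval z).re)| := by congr 1; ring
    _ ≤ |f z - g z| + |g z - (P.eval z).re| := abs_add_le _ _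
    _ ≤ ε := by linarith [hfg z hz, hP z hz]

lemma Pp.congr {K : Set ℂ} {f g : ℂ → ℂ} (hg : Pp K g) (h : ∀ z ∈ K, f z = g z) : Pp K f :=
  Pp.closed fun ε hε => ⟨g, hg, fun z hz => by rw [h z hz]; simpa using hε.le⟩

lemma Rp.congr {K : Set ℂ} {f g : ℂ → ℝ} (hg : Rp K g) (h : ∀ z ∈ K, f z = g z) : Rp K f :=
  Rp.closed fun ε hε => ⟨g, hg, fun z hz => by rw [h z hz]; simpa using hε.le⟩

lemma Pp.poly {K : Set ℂ} (P : Polynomial ℂ) : Pp K (fun z => P.eval z) := fun ε hε => ⟨P, fun z _ => by simpa using hε.le⟩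

lemma Pp.const {K : Set ℂ} (c : ℂ) : Pp K (fun _ => c) := (Pp.poly (Polynomial.C c)).congr fun z _ => by simp

lemma Pp.id {K : Set ℂ} : Pp K (fun z => z) := (Pp.poly Polynomial.X).congr fun z _ => by simp

lemma Pp.add {K : Set ℂ} {f g : ℂ → ℂ} (hf : Pp K f) (hg : Pp K g) : Pp K (fun z => f z + g z) := by
  intro ε hε
  obtain ⟨P, hP⟩ := hf (ε / 2) (by positivity)
  obtain ⟨Q, hQ⟩ := hg (ε / 2) (by positivity)
  refine ⟨P + Q, fun z hz => ?_⟩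
  rw [Polynomial.eval_add]
  calc _ = ‖(f z - P.eval z) + (g z - Q.eval z)‖ := by congr 1; ring
    _ ≤ ‖f z - P.eval z‖ + ‖g z - Q.eval z‖ := norm_add_le _ _
    _ ≤ ε := by linarith [hP z hz, hQ z hz]

lemma Pp.bdd {K : Set ℂ} (hK : IsCompact K) {f : ℂ → ℂ} (hf : Pp K f) : ∃ B : ℝ, 0 < B ∧ ∀ z ∈ K, ‖f z‖ ≤ B := by
  obtain ⟨P, hP⟩ := hf 1 one_pos
  obtain ⟨B, hB⟩ := hK.exists_bound_of_continuousOn (f := fun z => P.eval z) P.continuous.continuousOn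
  refine ⟨max B 0 + 1, by positivity, fun z hz => ?_⟩
  calc ‖f z‖ = ‖(f z - P.eval z) + P.eval z‖ := by congr 1; ring
    _ ≤ ‖f z - P.eval z‖ + ‖P.eval z‖ := norm_add_le _ _
    _ ≤ _ := by linarith [hP z hz, hB z hz, le_max_left B 0]

lemma Pp.mul {K : Set ℂ} (hK : IsCompact K) {f g : ℂ → ℂ} (hf : Pp K f) (hg : Pp K g) : Pp K (fun z => f z * g z) := by
  obtain ⟨A, hA0, hA⟩ := hf.bdd hK
  intro ε hε
  obtain ⟨Q, hQ⟩ := hg (ε / (2 * A)) (by positivity)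
  obtain ⟨B, hB⟩ := hK.exists_bound_of_continuousOn (f := fun z => Q.eval z) Q.continuous.continuousOn
  set B' := max B 1 with hB'
  have hB0 : 0 < B' := by positivity
  obtain ⟨P, hP⟩ := hf (ε / (2 * B')) (by positivity)
  refine ⟨P * Q, fun z hz => ?_⟩
  rw [Polynomial.eval_mul]
  calc _ = ‖f z * (g z - Q.eval z) + (f z - P.eval z) * Q.eval z‖ := by congr 1; ring
    _ ≤ ‖f z * (g z - Q.eval z)‖ + ‖(f z - P.eval z) * Q.eval z‖ := norm_add_le _ _
    _ = ‖f z‖ * ‖g z - Q.eval z‖ + ‖f z - P.eval z‖ * ‖Q.eval z‖ := by rw [norm_mul, norm_mul]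
    _ ≤ A * (ε / (2 * A)) + ε / (2 * B') * B' := by
        gcongr
        · exact hA z hz
        · exact hQ z hz
        · exact hP z hz
        · exact (hB z hz).trans (le_max_left _ _)
    _ = ε := by field_simp; ring

lemma Pp.pow {K : Set ℂ} (hK : IsCompact K) {f : ℂ → ℂ} (hf : Pp K f) (n : ℕ) : Pp K (fun z => f z ^ n) := by
  induction n with
  | zero => simpa using Pp.const 1
  | succ n ih => exact (Pp.mul hK ih hf).congr fun z _ => pow_succ _ _

lemma Pp.sum {K : Set ℂ} {ι : Type*} (s : Finset ι) {f : ι → ℂ → ℂ} (hf : ∀ i, Pp K (f i)) :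
    Pp K (fun z => ∑ i ∈ s, f i z) := by
  classical
  induction s using Finset.induction_on with
  | empty => simpa using Pp.const 0
  | insert a s ha ih => exact ((hf a).add ih).congr fun z _ => Finset.sum_insert ha

lemma Pp.re {K : Set ℂ} {f : ℂ → ℂ} (hf : Pp K f) : Rp K (fun z => (f z).re) := by
  intro ε hε
  obtain ⟨P, hP⟩ := hf ε hε
  refine ⟨P, fun z hz => ?_⟩
  rw [← Complex.sub_re]
  exact (Complex.abs_re_le_norm _).trans (hP z hz)

lemma Rp.const {K : Set ℂ} (c : ℝ) : Rp K (fun _ => c) := (Pp.const (c : ℂ)).re.congr fun z _ => by simp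

lemma Rp.add {K : Set ℂ} {f g : ℂ → ℝ} (hf : Rp K f) (hg : Rp K g) : Rp K (fun z => f z + g z) := by
  intro ε hε
  obtain ⟨P, hP⟩ := hf (ε / 2) (by positivity)
  obtain ⟨Q, hQ⟩ := hg (ε / 2) (by positivity)
  refine ⟨P + Q, fun z hz => ?_⟩
  rw [Polynomial.eval_add, Complex.add_re]
  calc _ = |(f z - (P.eval z).re) + (g z - (Q.eval z).re)| := by congr 1; ring
    _ ≤ |f z - (P.eval z).re| + |g z - (Q.eval z).re| := abs_add_le _ _
    _ ≤ ε := by linarith [hP z hz, hQ z hz]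

lemma Rp.smul {K : Set ℂ} {f : ℂ → ℝ} (c : ℝ) (hf : Rp K f) : Rp K (fun z => c * f z) := by
  intro ε hε
  obtain ⟨P, hP⟩ := hf (ε / (|c| + 1)) (by positivity)
  refine ⟨Polynomial.C (c : ℂ) * P, fun z hz => ?_⟩
  rw [Polynomial.eval_mul, Polynomial.eval_C, Complex.re_ofReal_mul, ← mul_sub, abs_mul]
  calc |c| * _ ≤ |c| * (ε / (|c| + 1)) := by gcongr; exact hP z hz
    _ ≤ (|c| + 1) * (ε / (|c| + 1)) := by gcongr; linarith
    _ = ε := by field_simp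

lemma Rp.sum {K : Set ℂ} {ι : Type*} (s : Finset ι) {f : ι → ℂ → ℝ} (hf : ∀ i ∈ s, Rp K (f i)) :
    Rp K (fun z => ∑ i ∈ s, f i z) := by
  classical
  induction s using Finset.induction_on with
  | empty => simpa using Rp.const 0
  | insert a s ha ih =>
    exact ((hf a (Finset.mem_insert_self _ _)).add (ih fun i hi => hf i (Finset.mem_insert_of_mem hi))).congr
      fun z _ => Finset.sum_insert ha

lemma Pp.one_sub {K : Set ℂ} (hK : IsCompact K) {a : ℂ → ℂ} (ha : Pp K a) (h : ∀ z ∈ K, ‖a z‖ ≤ 1 / 2) :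
    Pp K (fun z => (1 - a z)⁻¹) ∧ Rp K (fun z => Real.log ‖1 - a z‖) := by
  have hne : ∀ z ∈ K, 1 / 2 ≤ ‖1 - a z‖ := by
    intro z hz
    have := norm_sub_norm_le (1 : ℂ) (a z)
    rw [norm_one] at this
    linarith [h z hz]
  have hlim : ∀ ε : ℝ, 0 < ε → ∃ n : ℕ, 2 * (1 / 2 : ℝ) ^ n ≤ ε := by
    intro ε hε
    obtain ⟨n, hn⟩ := exists_pow_lt_of_lt_one (show 0 < ε / 2 by positivity) (show (1 / 2 : ℝ) < 1 by norm_num)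
    exact ⟨n, by linarith⟩
  constructor
  · refine Pp.closed fun ε hε => ?_
    obtain ⟨n, hn⟩ := hlim ε hε
    refine ⟨_, Pp.sum (Finset.range n) (fun i => ha.pow hK i), fun z hz => ?_⟩
    have h1 : (1 - a z) ≠ 0 := by
      rw [← norm_pos_iff]; linarith [hne z hz]
    have h2 : (∑ i ∈ Finset.range n, a z ^ i) = (1 - a z)⁻¹ * (1 - a z ^ n) := by
      have := mul_neg_geom_sum (a z) n
      rw [← this]; field_simp
    rw [h2]
    have : (1 - a z)⁻¹ - (1 - a z)⁻¹ * (1 - a z ^ n) = (1 - a z)⁻¹ * a z ^ n := by ring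
    rw [this, norm_mul, norm_inv, norm_pow]
    calc _ ≤ 2 * (1 / 2 : ℝ) ^ n := by
          gcongr
          · rw [inv_le_comm₀ (by linarith [hne z hz]) two_pos]; linarith [hne z hz]
          · exact h z hz
      _ ≤ ε := hn
  · have : Pp K (fun z => Complex.log (1 + - a z)) := by
      refine Pp.closed fun ε hε => ?_
      obtain ⟨n, hn⟩ := hlim ε hε
      refine ⟨fun z => Complex.logTaylor (n + 1) (- a z), ?_, fun z hz => ?_⟩
      · unfold Complex.logTaylor
        refine Pp.sum _ fun i => ?_
        refine (Pp.mul hK (Pp.const ((-1) ^ (i + 1) * (-1) ^ i / i)) (ha.pow hK i)).congr fun z _ => ?_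
        rw [neg_pow (a z)]; ring
      · have h1 : ‖- a z‖ ≤ 1 / 2 := by rw [norm_neg]; exact h z hz
        refine (Complex.norm_log_sub_logTaylor_le n (by linarith)).trans ?_
        refine le_trans ?_ hn
        calc ‖- a z‖ ^ (n + 1) * (1 - ‖- a z‖)⁻¹ / (n + 1) ≤ ‖- a z‖ ^ (n + 1) * (1 - ‖- a z‖)⁻¹ := by
              apply div_le_self
              · apply mul_nonneg (by positivity)
                rw [inv_nonneg]; linarith
              · linarith [(Nat.cast_nonneg n : (0:ℝ) ≤ n)]
          _ ≤ (1 / 2) ^ (n + 1) * 2 := by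
              gcongr
              · rw [inv_nonneg]; linarith
              · rw [inv_le_comm₀ (by linarith) two_pos]; linarith
          _ ≤ 2 * (1 / 2) ^ n := by
              rw [pow_succ]; have : (0:ℝ) < (1/2)^n := by positivity
              linarith
    refine this.re.congr fun z _ => ?_
    rw [Complex.log_re, sub_eq_add_neg]

open Set Filter Topology in
theorem runge {K : Set ℂ} (hK : IsCompact K) (hc : IsPreconnected Kᶜ) {ζ : ℂ} (hζ : ζ ∉ K) :
    Pp K (fun z => (z - ζ)⁻¹) ∧ Rp K (fun z => Real.log ‖z - ζ‖) := by
  rcases K.eq_empty_or_nonempty with rfl | hne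
  · exact ⟨fun ε _ => ⟨0, fun z hz => hz.elim⟩, fun ε _ => ⟨0, fun z hz => hz.elim⟩⟩
  set A : Set ℂ := {ζ | ζ ∉ K ∧ Pp K (fun z => (z - ζ)⁻¹) ∧ Rp K (fun z => Real.log ‖z - ζ‖)} with hA
  have step : ∀ ζ ∈ A, ∀ ζ', (∀ z ∈ K, ‖ζ' - ζ‖ ≤ 1 / 2 * ‖z - ζ‖) → ζ' ∈ A := by
    rintro ζ ⟨h0, h1, h2⟩ ζ' h
    have hne : ∀ z ∈ K, z - ζ ≠ 0 := fun z hz h => h0 (by rw [sub_eq_zero] at h; rwa [← h])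
    set a : ℂ → ℂ := fun z => (ζ' - ζ) * (z - ζ)⁻¹ with ha
    have hPa : Pp K a := Pp.mul hK (Pp.const _) h1
    have hab : ∀ z ∈ K, ‖a z‖ ≤ 1 / 2 := by
      intro z hz
      have := norm_pos_iff.2 (hne z hz)
      simp only [ha]
      rw [norm_mul, norm_inv, ← div_eq_mul_inv, div_le_iff₀ this]
      exact h z hz
    have hz' : ∀ z ∈ K, z - ζ' = (z - ζ) * (1 - a z) := by
      intro z hz
      have := hne z hz
      simp only [ha]; field_simp; ring
    have h1a : ∀ z ∈ K, 1 - a z ≠ 0 := by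
      intro z hz h3
      have := hab z hz
      rw [sub_eq_zero] at h3
      rw [← h3, norm_one] at this; norm_num at this
    obtain ⟨h3, h4⟩ := hPa.one_sub hK hab
    refine ⟨fun hin => ?_, (Pp.mul hK h1 h3).congr fun z hz => ?_, (h2.add h4).congr fun z hz => ?_⟩
    · have := hz' ζ' hin
      rw [sub_self, eq_comm, mul_eq_zero] at this
      exact this.elim (hne _ hin) (h1a _ hin)
    · rw [hz' z hz, mul_inv]
    · rw [hz' z hz, norm_mul, Real.log_mul (norm_ne_zero_iff.2 (hne z hz)) (norm_ne_zero_iff.2 (h1a z hz))]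
  have hpos : ∀ ζ ∉ K, 0 < Metric.infDist ζ K := fun ζ h => 
    (hK.isClosed.notMem_iff_infDist_pos hne).1 h
  have hdist : ∀ ζ, ∀ z ∈ K, Metric.infDist ζ K ≤ ‖z - ζ‖ := by
    intro ζ z hz
    rw [← dist_eq_norm, dist_comm]; exact Metric.infDist_le_dist_of_mem hz
  have hopen : IsOpen A := by
    rw [Metric.isOpen_iff]
    intro ζ hζ
    refine ⟨Metric.infDist ζ K / 2, half_pos (hpos ζ hζ.1), fun ζ' hζ' => step ζ hζ ζ' fun z hz => ?_⟩
    rw [Metric.mem_ball, dist_eq_norm] at hζ'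
    linarith [hdist ζ z hz]
  obtain ⟨R, hR0, hR⟩ : ∃ R : ℝ, 0 < R ∧ ∀ z ∈ K, ‖z‖ ≤ R := by
    obtain ⟨R, hR⟩ := hK.isBounded.exists_norm_le
    exact ⟨max R 1, by positivity, fun z hz => (hR z hz).trans (le_max_left _ _)⟩
  have hstart : ((2 * R : ℝ) : ℂ) ∈ A := by
    set ζ : ℂ := ((2 * R : ℝ) : ℂ) with hζd
    have hζn : ‖ζ‖ = 2 * R := by rw [hζd, Complex.norm_real, Real.norm_of_nonneg (by positivity)]
    have hζ0 : ζ ≠ 0 := by rw [← norm_pos_iff, hζn]; positivity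
    set a : ℂ → ℂ := fun z => ζ⁻¹ * z with ha
    have hPa : Pp K a := Pp.mul hK (Pp.const _) Pp.id
    have hab : ∀ z ∈ K, ‖a z‖ ≤ 1 / 2 := by
      intro z hz
      simp only [ha]
      rw [norm_mul, norm_inv, hζn, inv_mul_le_iff₀ (by positivity)]
      linarith [hR z hz]
    have hz' : ∀ z, z - ζ = (-ζ) * (1 - a z) := by
      intro z
      simp only [ha]; field_simp; ring
    have h1a : ∀ z ∈ K, 1 - a z ≠ 0 := by
      intro z hz h3
      have := hab z hz
      rw [sub_eq_zero] at h3
      rw [← h3, norm_one] at this; norm_num at this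
    obtain ⟨h3, h4⟩ := hPa.one_sub hK hab
    refine ⟨fun hin => ?_, (Pp.mul hK (Pp.const (-ζ)⁻¹) h3).congr fun z hz => ?_,
      ((Rp.const (Real.log ‖-ζ‖)).add h4).congr fun z hz => ?_⟩
    · have := hR _ hin; rw [hζn] at this; linarith
    · rw [hz' z, mul_inv]
    · rw [hz' z, norm_mul, Real.log_mul (norm_ne_zero_iff.2 (neg_ne_zero.2 hζ0)) (norm_ne_zero_iff.2 (h1a z hz))]
  have := hc.subset_of_closure_inter_subset hopen ⟨_, hstart.1, hstart⟩ ?_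
  · exact (this hζ).2
  rintro ζ' ⟨hcl, hK'⟩
  have hp := hpos ζ' hK'
  obtain ⟨ζ, hζA, hd⟩ := Metric.mem_closure_iff.1 hcl (Metric.infDist ζ' K / 3) (by positivity)
  refine step ζ hζA ζ' fun z hz => ?_
  rw [dist_eq_norm] at hd
  have h1 := hdist ζ' z hz
  have h2 : ‖z - ζ'‖ ≤ ‖z - ζ‖ + ‖ζ' - ζ‖ := by
    calc ‖z - ζ'‖ = ‖(z - ζ) - (ζ' - ζ)‖ := by congr 1; ring
      _ ≤ _ := norm_sub_le _ _
  linarith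

lemma sum_log_le (N : ℕ) : ∑ j ∈ Finset.Icc 1 N, Real.log (2 * N / j) ≤ 2 * N := by
  have h1 : ∀ n : ℕ, ∀ x : ℝ, 0 < x → ∑ j ∈ Finset.Icc 1 n, Real.log (x / j) = Real.log (x ^ n / n.factorial) := by
    intro n x hx
    induction n with
    | zero => simp
    | succ n ih =>
      rw [Finset.sum_Icc_succ_top (by omega), ih, ← Real.log_mul (by positivity) (by positivity)]
      congr 1
      rw [Nat.factorial_succ]; push_cast; field_simp; ring
  rcases N.eq_zero_or_pos with rfl | hN
  · simp
  have hN' : (0:ℝ) < N := by exact_mod_cast hN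
  rw [h1 N (2 * N) (by positivity)]
  rw [Real.log_le_iff_le_exp (by positivity)]
  exact Real.pow_div_factorial_le_exp _ (by positivity) N

lemma logsum {N : ℕ} (hN : 1 ≤ N) (y : ℝ) : ∃ m ∈ Finset.Icc 1 N,
    (∀ k ∈ (Finset.Icc 1 N).erase m, 0 < |y - k|) ∧
    ∑ k ∈ (Finset.Icc 1 N).erase m, Real.log (N / |y - k|) ≤ 4 * N := by
  have hN' : (0:ℝ) < N := by exact_mod_cast hN
  obtain ⟨m, hm, hmin⟩ := Finset.exists_min_image (Finset.Icc 1 N) (fun k : ℕ => |y - k|) ⟨1, by simp [hN]⟩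
  have hbd : ∀ k ∈ (Finset.Icc 1 N).erase m, |(m:ℝ) - k| / 2 ≤ |y - k| ∧ 0 < |(m:ℝ) - k| := by
    intro k hk
    rw [Finset.mem_erase] at hk
    have h1 := hmin k hk.2
    have h2 : |(m:ℝ) - k| ≤ |y - m| + |y - k| := by
      calc |(m:ℝ) - k| = |(y - k) - (y - m)| := by congr 1; ring
        _ ≤ |y - k| + |y - m| := abs_sub _ _
        _ = _ := add_comm _ _
    refine ⟨by linarith, abs_pos.2 (sub_ne_zero.2 ?_)⟩
    exact_mod_cast hk.1.symm
  refine ⟨m, hm, fun k hk => by linarith [(hbd k hk).1, (hbd k hk).2], ?_⟩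
  set g : ℕ → ℝ := fun j => Real.log (2 * N / j) with hg
  have hg0 : ∀ j ∈ Finset.Icc 1 N, 0 ≤ g j := by
    intro j hj
    rw [Finset.mem_Icc] at hj
    apply Real.log_nonneg
    have hj0 : (0:ℝ) < j := by exact_mod_cast hj.1
    have hjN : (j:ℝ) ≤ N := by exact_mod_cast hj.2
    rw [le_div_iff₀ hj0]; linarith
  have hmI := Finset.mem_Icc.1 hm
  have h1 : ∑ k ∈ (Finset.Icc 1 N).erase m, Real.log (N / |y - k|) ≤
      ∑ k ∈ (Finset.Icc 1 N).erase m, Real.log (2 * N / |(m:ℝ) - k|) := by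
    refine Finset.sum_le_sum fun k hk => ?_
    obtain ⟨a, b⟩ := hbd k hk
    have hyk : 0 < |y - k| := by linarith
    apply Real.log_le_log (by positivity)
    rw [div_le_div_iff₀ hyk b]
    nlinarith
  have h2 : (Finset.Icc 1 N).erase m = Finset.Ico 1 m ∪ Finset.Ioc m N := by
    ext k; simp only [Finset.mem_erase, Finset.mem_Icc, Finset.mem_union, Finset.mem_Ico, Finset.mem_Ioc]; omega
  have h3 : ∑ k ∈ Finset.Ico 1 m, Real.log (2 * N / |(m:ℝ) - k|) ≤ 2 * N := by
    calc _ = ∑ k ∈ Finset.Ico 1 m, g (m - k) := by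
          refine Finset.sum_congr rfl fun k hk => ?_
          rw [Finset.mem_Ico] at hk
          have : (k:ℝ) ≤ m := by exact_mod_cast hk.2.le
          simp only [hg]; rw [Nat.cast_sub hk.2.le, abs_of_nonneg (by linarith)]
      _ = ∑ j ∈ (Finset.Ico 1 m).image (fun k => m - k), g j := by
          rw [Finset.sum_image]
          intro a ha b hb hab
          rw [Finset.mem_coe, Finset.mem_Ico] at ha hb
          simp only at hab; omega
      _ ≤ ∑ j ∈ Finset.Icc 1 N, g j := by
          refine Finset.sum_le_sum_of_subset_of_nonneg ?_ fun j hj _ => hg0 j hj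
          intro j hj
          simp only [Finset.mem_image, Finset.mem_Ico] at hj
          obtain ⟨k, hk, rfl⟩ := hj
          rw [Finset.mem_Icc]; omega
      _ ≤ _ := sum_log_le N
  have h4 : ∑ k ∈ Finset.Ioc m N, Real.log (2 * N / |(m:ℝ) - k|) ≤ 2 * N := by
    calc _ = ∑ k ∈ Finset.Ioc m N, g (k - m) := by
          refine Finset.sum_congr rfl fun k hk => ?_
          rw [Finset.mem_Ioc] at hk
          have : (m:ℝ) ≤ k := by exact_mod_cast hk.1.le
          simp only [hg]; rw [Nat.cast_sub hk.1.le, abs_of_nonpos (by linarith), neg_sub]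
      _ = ∑ j ∈ (Finset.Ioc m N).image (fun k => k - m), g j := by
          rw [Finset.sum_image]
          intro a ha b hb hab
          rw [Finset.mem_coe, Finset.mem_Ioc] at ha hb
          simp only at hab; omega
      _ ≤ ∑ j ∈ Finset.Icc 1 N, g j := by
          refine Finset.sum_le_sum_of_subset_of_nonneg ?_ fun j hj _ => hg0 j hj
          intro j hj
          simp only [Finset.mem_image, Finset.mem_Ioc] at hj
          obtain ⟨k, hk, rfl⟩ := hj
          rw [Finset.mem_Icc]; omega
      _ ≤ _ := sum_log_le N
  refine h1.trans ?_
  rw [h2, Finset.sum_union]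
  · linarith
  · rw [Finset.disjoint_left]; intro k hk hk'
    rw [Finset.mem_Ico] at hk; rw [Finset.mem_Ioc] at hk'; omega

open Set Filter Topology in
lemma path_points {K : Set ℂ} (hK : IsCompact K) (hne : K.Nonempty) (hc : IsPreconnected Kᶜ) {a : ℂ} (ha : a ∉ K) {R : ℝ} (hR : 0 < R) :
    ∃ d > 0, ∀ r, 0 ≤ r → r ≤ R → ∃ e ∉ K, ‖e - a‖ = r ∧ ∀ z ∈ K, d ≤ ‖z - e‖ := by
  obtain ⟨B, hB⟩ := hK.isBounded.exists_norm_le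
  set b : ℂ := ((|B| + ‖a‖ + R + 1 : ℝ) : ℂ) with hb
  have hbn : ‖b‖ = |B| + ‖a‖ + R + 1 := by rw [hb, Complex.norm_real, Real.norm_of_nonneg (by positivity)]
  have hbK : b ∉ K := by
    intro h; have := hB b h; rw [hbn] at this; linarith [le_abs_self B, norm_nonneg a]
  have hpc : IsPathConnected Kᶜ := by
    rw [hK.isClosed.isOpen_compl.isConnected_iff_isPathConnected.symm]
    exact ⟨⟨a, ha⟩, hc⟩
  obtain ⟨γ, hγ⟩ := hpc.joinedIn a ha b hbK
  have hpos : ∀ s, 0 < Metric.infDist (γ s) K := fun s => (hK.isClosed.notMem_iff_infDist_pos hne).1 (hγ s)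
  obtain ⟨s0, -, hs0⟩ := (isCompact_univ (X := unitInterval)).exists_isMinOn ⟨0, mem_univ _⟩
    (f := fun s => Metric.infDist (γ s) K) ((Metric.continuous_infDist_pt K).comp γ.continuous).continuousOn
  refine ⟨Metric.infDist (γ s0) K, hpos s0, fun r hr0 hrR => ?_⟩
  have hcont : Continuous fun s => ‖γ s - a‖ := by fun_prop
  have hab : R ≤ ‖b - a‖ := by
    have := norm_sub_norm_le b a
    rw [hbn] at this; linarith [abs_nonneg B]
  obtain ⟨s, hs⟩ := mem_range_of_exists_le_of_exists_ge hcont ⟨0, by simpa using hr0⟩ ⟨1, by simpa using hrR.trans hab⟩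
  refine ⟨γ s, hγ s, hs, fun z hz => ?_⟩
  have h1 : Metric.infDist (γ s0) K ≤ Metric.infDist (γ s) K := hs0 (mem_univ s)
  refine h1.trans ?_
  rw [← dist_eq_norm, dist_comm]; exact Metric.infDist_le_dist_of_mem hz

open Set Filter Topology in
lemma barrier0 {K : Set ℂ} (hK : IsCompact K) (hc : IsPreconnected Kᶜ) {z0 : ℂ} (hz0 : z0 ∈ frontier K)
    {R ρ : ℝ} (hR : 0 < R) (hρ : 0 < ρ) :
    ∃ b : ℂ → ℝ, Rp K b ∧ (∀ z ∈ K, ρ + 2 * R ≤ ‖z - z0‖ → b z ≤ 0) ∧ (∀ z ∈ K, b z ≤ Real.log (ρ / R) + 5) ∧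
      (∀ z ∈ K, ‖z - z0‖ ≤ R → Real.log (ρ / R) - 2 ≤ b z) := by
  have hz0K : z0 ∈ K := hK.isClosed.frontier_subset hz0
  have hne : K.Nonempty := ⟨z0, hz0K⟩
  have hz0c : z0 ∈ closure Kᶜ := by
    rw [frontier_eq_closure_inter_closure] at hz0; exact hz0.2
  obtain ⟨a, ha, had⟩ := Metric.mem_closure_iff.1 hz0c R hR
  rw [dist_eq_norm] at had
  obtain ⟨d, hd, hpath⟩ := path_points hK hne hc ha hR
  obtain ⟨N, hN⟩ := exists_nat_ge (max 1 (Real.log (R / d)))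
  have hN1' : (1:ℝ) ≤ N := (le_max_left _ _).trans hN
  have hN1 : 1 ≤ N := by exact_mod_cast hN1'
  have hN0 : (0:ℝ) < N := by linarith
  have hNd : Real.log (R / d) ≤ N := (le_max_right _ _).trans hN
  have hex : ∀ k : ℕ, ∃ e, k ∈ Finset.Icc 1 N → e ∉ K ∧ ‖e - a‖ = R * k / N ∧ ∀ z ∈ K, d ≤ ‖z - e‖ := by
    intro k
    by_cases hk : k ∈ Finset.Icc 1 N
    · rw [Finset.mem_Icc] at hk
      have hkN : (k:ℝ) ≤ N := by exact_mod_cast hk.2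
      obtain ⟨e, h1, h2, h3⟩ := hpath (R * k / N) (by positivity) (by rw [div_le_iff₀ hN0]; gcongr)
      exact ⟨e, fun _ => ⟨h1, h2, h3⟩⟩
    · exact ⟨0, fun h => (hk h).elim⟩
  choose e he using hex
  have hek : ∀ k ∈ Finset.Icc 1 N, ‖e k - a‖ ≤ R := by
    intro k hk
    rw [(he k hk).2.1]
    rw [Finset.mem_Icc] at hk
    have hkN : (k:ℝ) ≤ N := by exact_mod_cast hk.2
    rw [div_le_iff₀ hN0]; gcongr
  have hpos : ∀ k ∈ Finset.Icc 1 N, ∀ z ∈ K, 0 < ‖z - e k‖ := fun k hk z hz => hd.trans_le ((he k hk).2.2 z hz)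
  have hcard : ∀ c : ℝ, ∑ k ∈ Finset.Icc 1 N, c = N * c := by intro c; simp
  refine ⟨fun z => (1 / N) * ∑ k ∈ Finset.Icc 1 N, Real.log (ρ / ‖z - e k‖), ?_, ?_, ?_, ?_⟩
  · refine Rp.smul _ (Rp.sum _ fun k hk => ?_)
    refine ((Rp.const (Real.log ρ)).add ((runge hK hc (he k hk).1).2.smul (-1))).congr fun z hz => ?_
    rw [Real.log_div hρ.ne' (hpos k hk z hz).ne']; ring
  · intro z hz hzd
    refine mul_nonpos_of_nonneg_of_nonpos (by positivity) (Finset.sum_nonpos fun k hk => ?_)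
    have h1 : ‖z - z0‖ ≤ ‖z - e k‖ + ‖e k - a‖ + ‖z0 - a‖ := by
      calc ‖z - z0‖ = ‖(z - e k) + (e k - a) - (z0 - a)‖ := by congr 1; ring
        _ ≤ ‖(z - e k) + (e k - a)‖ + ‖z0 - a‖ := norm_sub_le _ _
        _ ≤ _ := by gcongr; exact norm_add_le _ _
    have h2 := hek k hk
    apply Real.log_nonpos (by positivity)
    rw [div_le_one (hpos k hk z hz)]; linarith
  · intro z hz
    obtain ⟨m, hm, hmp, hsum⟩ := logsum hN1 (‖z - a‖ * N / R)
    rw [one_div, inv_mul_le_iff₀ hN0]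
    have h1 : ∀ k ∈ Finset.Icc 1 N, Real.log (ρ / ‖z - e k‖) = Real.log (ρ / R) + Real.log (R / ‖z - e k‖) := by
      intro k hk
      have := hpos k hk z hz
      rw [← Real.log_mul (by positivity) (by positivity)]; congr 1; field_simp
    rw [Finset.sum_congr rfl h1, Finset.sum_add_distrib, hcard, ← Finset.add_sum_erase _ _ hm]
    have h2 : Real.log (R / ‖z - e m‖) ≤ N := by
      refine le_trans ?_ hNd
      have := hpos m hm z hz
      apply Real.log_le_log (by positivity)
      gcongr; exact (he m hm).2.2 z hz
    have h3 : ∑ k ∈ (Finset.Icc 1 N).erase m, Real.log (R / ‖z - e k‖) ≤ 4 * N := by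
      refine le_trans (Finset.sum_le_sum fun k hk => ?_) hsum
      have hkp := hmp k hk
      have hkI := Finset.mem_of_mem_erase hk
      have hzp := hpos k hkI z hz
      apply Real.log_le_log (by positivity)
      rw [div_le_div_iff₀ hzp hkp]
      have h4 : |‖z - a‖ - ‖e k - a‖| ≤ ‖z - e k‖ := by
        refine (abs_norm_sub_norm_le _ _).trans (le_of_eq ?_); congr 1; ring
      rw [(he k hkI).2.1] at h4
      have h5 : ‖z - a‖ * N / R - k = (‖z - a‖ - R * k / N) * (N / R) := by field_simp
      rw [h5, abs_mul, abs_of_pos (by positivity : (0:ℝ) < N / R)]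
      calc R * (|‖z - a‖ - R * k / N| * (N / R)) = N * |‖z - a‖ - R * k / N| := by field_simp
        _ ≤ _ := by gcongr
    linarith
  · intro z hz hzd
    rw [one_div, le_inv_mul_iff₀ hN0, ← hcard]
    refine Finset.sum_le_sum fun k hk => ?_
    have hzp := hpos k hk z hz
    have h1 : ‖z - e k‖ ≤ 3 * R := by
      calc ‖z - e k‖ = ‖(z - z0) + (z0 - a) - (e k - a)‖ := by congr 1; ring
        _ ≤ ‖(z - z0) + (z0 - a)‖ + ‖e k - a‖ := norm_sub_le _ _
        _ ≤ ‖z - z0‖ + ‖z0 - a‖ + ‖e k - a‖ := by gcongr; exact norm_add_le _ _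
        _ ≤ _ := by linarith [hek k hk]
    have h2 : Real.log 3 ≤ 2 := by
      have := Real.log_le_sub_one_of_pos (show (0:ℝ) < 3 by norm_num); linarith
    have h3 : Real.log (ρ / R) - Real.log 3 = Real.log (ρ / (3 * R)) := by
      rw [← Real.log_div (by positivity) (by norm_num)]; congr 1; field_simp
    have h4 : Real.log (ρ / (3 * R)) ≤ Real.log (ρ / ‖z - e k‖) := by
      apply Real.log_le_log (by positivity); gcongr
    linarith

open Set Filter Topology in
lemma barrier1 {K : Set ℂ} (hK : IsCompact K) (hc : IsPreconnected Kᶜ) {z0 : ℂ} (hz0 : z0 ∈ frontier K)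
    {ε : ℝ} (hε : 0 < ε) : ∃ F : Polynomial ℂ, (∀ z ∈ K, ‖z‖ ^ 2 < (F.eval z).re) ∧
      ∃ r > 0, ∀ z ∈ K, ‖z - z0‖ ≤ r → (F.eval z).re < ‖z‖ ^ 2 + ε := by
  have hz0K : z0 ∈ K := hK.isClosed.frontier_subset hz0
  obtain ⟨M, hM0, hM⟩ : ∃ M : ℝ, 0 < M ∧ ∀ z ∈ K, ‖z‖ ≤ M := by
    obtain ⟨R, hR⟩ := hK.isBounded.exists_norm_le
    exact ⟨max R 1, by positivity, fun z hz => (hR z hz).trans (le_max_left _ _)⟩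
  have hcont : ContinuousAt (fun z : ℂ => ‖z‖ ^ 2) z0 := by fun_prop
  obtain ⟨δ, hδ, hδc⟩ := Metric.continuousAt_iff.1 hcont (ε / 8) (by positivity)
  set ρ := δ / 2 with hρ
  have hρ0 : 0 < ρ := by positivity
  set X := 28 * M ^ 2 / ε + 6 with hX
  have hX0 : 0 < X := by positivity
  set R := ρ * exp (-X) with hR
  have hR0 : 0 < R := by positivity
  have hlog : Real.log (ρ / R) = X := by
    have : ρ / R = exp X := by rw [hR, exp_neg]; field_simp
    rw [this, Real.log_exp]
  have hRρ : R ≤ ρ / 4 := by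
    have h1 : 6 + 1 ≤ exp X := by
      refine le_trans ?_ (Real.add_one_le_exp X)
      have : 0 ≤ 28 * M ^ 2 / ε := by positivity
      linarith
    rw [hR, exp_neg, div_eq_mul_inv]
    gcongr; linarith
  obtain ⟨b, hb, hb1, hb2, hb3⟩ := barrier0 hK hc hz0 hR0 hρ0
  rw [hlog] at hb2 hb3
  have hq : Rp K (fun z => (‖z0‖ ^ 2 + ε / 4 + M ^ 2) + (-(M ^ 2 / (X + 5))) * b z) := (Rp.const _).add (hb.smul _)
  obtain ⟨F, hF⟩ := hq (ε / 16) (by positivity)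
  have hMX : M ^ 2 / (X + 5) * 7 ≤ ε / 4 := by
    rw [div_mul_eq_mul_div, div_le_iff₀ (by positivity)]
    have : ε / 4 * (28 * M ^ 2 / ε) = 7 * M ^ 2 := by field_simp; norm_num
    have h2 : ε / 4 * X = 7 * M ^ 2 + ε / 4 * 6 := by rw [hX, mul_add, this]
    nlinarith
  have hc0 : 0 < M ^ 2 / (X + 5) := by positivity
  have hcX : M ^ 2 / (X + 5) * (X + 5) = M ^ 2 := by field_simp
  generalize M ^ 2 / (X + 5) = c at *
  refine ⟨F, fun z hz => ?_, R, hR0, fun z hz hzR => ?_⟩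
  · have h1 := abs_le.1 (hF z hz)
    by_cases hzd : ‖z - z0‖ < δ
    · have h2 := hδc (x := z) (by rwa [dist_eq_norm])
      rw [Real.dist_eq, abs_lt] at h2
      have h3 := mul_le_mul_of_nonneg_left (hb2 z hz) hc0.le
      linarith
    · push Not at hzd
      have h2 := hb1 z hz (by linarith)
      have h3 : ‖z‖ ^ 2 ≤ M ^ 2 := by gcongr; exact hM z hz
      have h4 : 0 ≤ ‖z0‖ ^ 2 := by positivity
      have h5 := mul_nonpos_of_nonneg_of_nonpos hc0.le h2
      linarith
  · have h1 := abs_le.1 (hF z hz)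
    have h2 := hδc (x := z) (by rw [dist_eq_norm]; linarith)
    rw [Real.dist_eq, abs_lt] at h2
    have h3 := mul_le_mul_of_nonneg_left (hb3 z hz hzR) hc0.le
    linarith

open Set Filter Topology in
theorem barrier {K : Set ℂ} (hK : IsCompact K) (hc : IsPreconnected Kᶜ) {ε : ℝ} (hε : 0 < ε) :
    ∃ S : Finset (Polynomial ℂ), (∀ F ∈ S, ∀ z ∈ K, ‖z‖ ^ 2 < (F.eval z).re) ∧
      ∀ z ∈ frontier K, ∃ F ∈ S, (F.eval z).re < ‖z‖ ^ 2 + ε := by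
  classical
  have h : ∀ z0 : ℂ, ∃ F : Polynomial ℂ, ∃ r > 0, z0 ∈ frontier K → (∀ z ∈ K, ‖z‖ ^ 2 < (F.eval z).re) ∧
       ∀ z ∈ K, ‖z - z0‖ ≤ r → (F.eval z).re < ‖z‖ ^ 2 + ε := by
    intro z0
    by_cases hz : z0 ∈ frontier K
    · obtain ⟨F, h1, r, hr, h2⟩ := barrier1 hK hc hz hε
      exact ⟨F, r, hr, fun _ => ⟨h1, h2⟩⟩
    · exact ⟨0, 1, one_pos, fun h => (hz h).elim⟩
  choose F r hr hF using h
  have hfc : IsCompact (frontier K) := hK.of_isClosed_subset isClosed_frontier hK.isClosed.frontier_subset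
  obtain ⟨t, ht, hcov⟩ := hfc.elim_nhds_subcover (fun z => Metric.ball z (r z)) (fun z _ => Metric.ball_mem_nhds z (hr z))
  refine ⟨t.image F, ?_, ?_⟩
  · intro G hG
    obtain ⟨z0, hz0, rfl⟩ := Finset.mem_image.1 hG
    exact (hF z0 (ht z0 hz0)).1
  · intro z hz
    obtain ⟨z0, hz0, hzb⟩ := mem_iUnion₂.1 (hcov hz)
    refine ⟨F z0, Finset.mem_image_of_mem _ hz0, (hF z0 (ht z0 hz0)).2 z (hK.isClosed.frontier_subset hz) ?_⟩
    rw [← dist_eq_norm]; exact (Metric.mem_ball.1 hzb).le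

open Set Filter Topology in
lemma exists_beta {δ : ℝ} (hδ : 0 < δ) : ∃ β : ℝ → ℝ, ContDiff ℝ 1 β ∧ (∀ x, 0 ≤ deriv β x ∧ deriv β x ≤ 1) ∧
    (∀ x ≤ 0, β x = 0) ∧ (∀ x, 0 ≤ x → 0 ≤ β x ∧ β x ≤ x ∧ x - δ ≤ β x) := by
  set T : ℝ → ℝ := fun y => min 1 (max 0 (y / δ)) with hT
  have hTc : Continuous T := by rw [hT]; fun_prop
  have hT0 : ∀ y, 0 ≤ T y := fun y => le_min zero_le_one (le_max_left _ _)
  have hT1 : ∀ y, T y ≤ 1 := fun y => min_le_left _ _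
  have hd : ∀ x, HasDerivAt (fun x => ∫ y in (0:ℝ)..x, T y) (T x) x := fun x => 
    intervalIntegral.integral_hasDerivAt_right (hTc.intervalIntegrable _ _)
      (hTc.stronglyMeasurableAtFilter _ _) hTc.continuousAt
  have hd' : deriv (fun x => ∫ y in (0:ℝ)..x, T y) = T := funext fun x => (hd x).deriv
  refine ⟨fun x => ∫ y in (0:ℝ)..x, T y, ?_, ?_, ?_, ?_⟩
  · rw [contDiff_one_iff_deriv]
    refine ⟨fun x => (hd x).differentiableAt, ?_⟩
    rw [hd']; exact hTc
  · intro x; rw [hd']; exact ⟨hT0 x, hT1 x⟩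
  · intro x hx
    simp only
    rw [intervalIntegral.integral_congr (g := fun _ => 0)]
    · simp
    · intro y hy
      rw [uIcc_of_ge hx] at hy
      simp only [hT]
      rw [max_eq_left (div_nonpos_of_nonpos_of_nonneg hy.2 hδ.le)]; simp
  · intro x hx
    refine ⟨intervalIntegral.integral_nonneg hx fun y _ => hT0 y, ?_, ?_⟩
    · calc ∫ y in (0:ℝ)..x, T y ≤ ∫ y in (0:ℝ)..x, (1:ℝ) :=
            intervalIntegral.integral_mono_on hx (hTc.intervalIntegrable _ _) (by simp) fun y _ => hT1 y
        _ = x := by simp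
    · by_cases h : x ≤ δ
      · have : 0 ≤ ∫ y in (0:ℝ)..x, T y := intervalIntegral.integral_nonneg hx fun y _ => hT0 y
        simp only; linarith
      · push Not at h
        simp only
        rw [← intervalIntegral.integral_add_adjacent_intervals (hTc.intervalIntegrable 0 δ) (hTc.intervalIntegrable δ x)]
        have h1 : 0 ≤ ∫ y in (0:ℝ)..δ, T y := intervalIntegral.integral_nonneg hδ.le fun y _ => hT0 y
        have h2 : ∫ y in δ..x, T y = x - δ := by
          rw [intervalIntegral.integral_congr (g := fun _ => 1)]
          · simp
          · intro y hy
            rw [uIcc_of_le h.le] at hy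
            simp only [hT]
            rw [min_eq_left]
            exact le_max_of_le_right (by rw [le_div_iff₀ hδ]; linarith [hy.1])
        linarith

lemma gdot_comm (f g : ℂ → ℝ) (z : ℂ) : gdot f g z = gdot g f z := by unfold gdot; ring

lemma gdot_add_right {f g h : ℂ → ℝ} {z : ℂ} (hg : DifferentiableAt ℝ g z) (hh : DifferentiableAt ℝ h z) :
    gdot f (fun z => g z + h z) z = gdot f g z + gdot f h z := by
  unfold gdot; rw [fderiv_fun_add hg hh]; simp only [add_apply]; ring

lemma gdot_add_left {f g h : ℂ → ℝ} {z : ℂ} (hg : DifferentiableAt ℝ g z) (hh : DifferentiableAt ℝ h z) :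
    gdot (fun z => g z + h z) f z = gdot g f z + gdot h f z := by
  rw [gdot_comm, gdot_add_right hg hh, gdot_comm f, gdot_comm f]

lemma gdot_const_mul_right {f g : ℂ → ℝ} {z : ℂ} (c : ℝ) (hg : DifferentiableAt ℝ g z) :
    gdot f (fun z => c * g z) z = c * gdot f g z := by
  apply gdot_smul_right
  rw [fderiv_const_mul hg]

lemma gdot_const_mul_left {f g : ℂ → ℝ} {z : ℂ} (c : ℝ) (hg : DifferentiableAt ℝ g z) :
    gdot (fun z => c * g z) f z = c * gdot g f z := by
  rw [gdot_comm, gdot_const_mul_right c hg, gdot_comm]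

lemma gdot_neg_left (f g : ℂ → ℝ) (z : ℂ) : gdot (fun z => - f z) g z = - gdot f g z := by
  unfold gdot; rw [fderiv_fun_neg]; simp only [neg_apply]; ring

lemma gdot_neg_right (f g : ℂ → ℝ) (z : ℂ) : gdot g (fun z => - f z) z = - gdot g f z := by
  rw [gdot_comm, gdot_neg_left, gdot_comm]

lemma gdot_zero_of_notMem {f g : ℂ → ℝ} {z : ℂ} (h : z ∉ tsupport g) : gdot f g z = 0 := by
  have h2 := notMem_tsupport_iff_eventuallyEq.1 h
  unfold gdot; rw [h2.fderiv_eq]; simp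

lemma continuous_gdot {f g : ℂ → ℝ} (hf : ContDiff ℝ 1 f) (hg : ContDiff ℝ 1 g) : Continuous (gdot f g) := by
  rw [← continuousOn_univ]
  exact gdot_continuousOn isOpen_univ hf.contDiffOn hg.contDiffOn

open Set in
lemma integrableOn_bdd {G : Set ℂ} (hb : Bornology.IsBounded G) {f : ℂ → ℝ} (hf : Continuous f) : IntegrableOn f G :=
  (hf.continuousOn.integrableOn_compact hb.isCompact_closure).mono_set subset_closure

lemma integrable_gdot_of_compact {f g : ℂ → ℝ} (hf : ContDiff ℝ 1 f) (hg : ContDiff ℝ 1 g) (hc : HasCompactSupport g) :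
    Integrable (gdot f g) := by
  refine (continuous_gdot hf hg).integrable_of_hasCompactSupport ?_
  refine HasCompactSupport.intro (K := tsupport g) hc ?_
  intro z hz; exact gdot_zero_of_notMem hz

lemma setIntegral_gdot {f g : ℂ → ℝ} {G : Set ℂ} (h : tsupport g ⊆ G) : ∫ z in G, gdot f g z = ∫ z, gdot f g z :=
  setIntegral_eq_integral_of_forall_compl_eq_zero fun _ hz => gdot_zero_of_notMem fun h' => hz (h h')

/-- competitors for the Dirichlet problem with boundary values `u` -/
def Adm (G : Set ℂ) (u H : ℂ → ℝ) : Prop :=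
  ContDiff ℝ 1 H ∧ HasCompactSupport (fun z => H z - u z) ∧ tsupport (fun z => H z - u z) ⊆ G

open Set Filter Topology in
lemma Adm.add {G : Set ℂ} {u H χ : ℂ → ℝ} (h : Adm G u H) (hχ : ContDiff ℝ 1 χ) (hc : HasCompactSupport χ)
    (ht : tsupport χ ⊆ G) : Adm G u (fun z => H z + χ z) := by
  have e : (fun z => H z + χ z - u z) = (fun z => (H z - u z) + χ z) := by ext z; ring
  refine ⟨h.1.add hχ, ?_, ?_⟩
  · rw [e]; exact h.2.1.add hc
  · rw [e]
    exact (tsupport_add _ _).trans (union_subset h.2.2 ht)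

open Set Filter Topology in
lemma Adm.neg {G : Set ℂ} {u H : ℂ → ℝ} (h : Adm G u H) : Adm G (fun z => - u z) (fun z => - H z) := by
  have e : (fun z => - H z - - u z) = -(fun z => H z - u z) := by ext z; simp; ring
  refine ⟨h.1.neg, ?_, ?_⟩
  · rw [e]; exact h.2.1.neg
  · rw [e]
    have : tsupport (-(fun z => H z - u z)) = tsupport (fun z => H z - u z) := by
      unfold tsupport; rw [Function.support_neg]
    rw [this]; exact h.2.2

open Set Filter Topology in
lemma energy_add {G : Set ℂ} (hb : Bornology.IsBounded G) {H χ : ℂ → ℝ} (hH : ContDiff ℝ 1 H) (hχ : ContDiff ℝ 1 χ)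
    (t : ℝ) :
    ∫ z in G, gdot (fun z => H z + t * χ z) (fun z => H z + t * χ z) z =
      (∫ z in G, gdot H H z) + 2 * t * (∫ z in G, gdot H χ z) + t ^ 2 * ∫ z in G, gdot χ χ z := by
  have dH := hH.differentiable one_ne_zero
  have dχ := hχ.differentiable one_ne_zero
  have i1 := integrableOn_bdd hb (continuous_gdot hH hH)
  have i2 : IntegrableOn (fun z => (2 * t) * gdot H χ z) G := (integrableOn_bdd hb (continuous_gdot hH hχ)).const_mul _
  have i3 : IntegrableOn (fun z => t ^ 2 * gdot χ χ z) G := (integrableOn_bdd hb (continuous_gdot hχ hχ)).const_mul _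
  have i4 : IntegrableOn (fun z => gdot H H z + (2 * t) * gdot H χ z) G := i1.add i2
  rw [← integral_const_mul, ← integral_const_mul, ← integral_add i1 i2, ← integral_add i4 i3]
  congr 1; ext z
  rw [gdot_add_left (dH z) ((dχ z).const_mul t), gdot_add_right (dH z) ((dχ z).const_mul t),
    gdot_add_right (dH z) ((dχ z).const_mul t), gdot_const_mul_left t (dχ z), gdot_const_mul_left t (dχ z),
    gdot_const_mul_right t (dχ z), gdot_const_mul_right t (dχ z), gdot_comm χ H]
  ring

open Set Filter Topology in
lemma trunc {G : Set ℂ} (hG : IsOpen G) (hb : Bornology.IsBounded G) {u H s : ℂ → ℝ} (hH : Adm G u H) (hs : ContDiff ℝ 1 s)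
    (hsu : ∀ z ∈ G, s z ≤ u z)
    (hsub : ∀ η : ℂ → ℝ, ContDiff ℝ 1 η → HasCompactSupport η → tsupport η ⊆ G → (∀ z, 0 ≤ η z) → ∫ z, gdot s η z ≤ 0)
    {δ : ℝ} (hδ : 0 < δ) :
    ∃ H', Adm G u H' ∧ (∫ z in G, gdot H' H' z ≤ ∫ z in G, gdot H H z) ∧
      ∀ z ∈ G, H z ≤ H' z ∧ H' z ≤ max (H z) (s z) ∧ s z - δ ≤ H' z := by
  obtain ⟨β, hβ, hβd, hβ0, hβ1⟩ := exists_beta hδ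
  have hβn : ∀ x, 0 ≤ β x := fun x => (le_total x 0).elim (fun h => (hβ0 x h).ge) (fun h => (hβ1 x h).1)
  set η : ℂ → ℝ := G.indicator (fun z => β (s z - H z)) with hη
  have hηG : ∀ z ∈ G, η z = β (s z - H z) := fun z hz => indicator_of_mem hz _
  have hηs : tsupport η ⊆ tsupport (fun z => H z - u z) := by
    apply closure_mono
    intro z hz
    rw [Function.mem_support] at hz ⊢
    have hzG : z ∈ G := by by_contra h; exact hz (indicator_of_notMem h _)
    intro h0
    apply hz
    rw [hηG z hzG]
    apply hβ0
    linarith [hsu z hzG]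
  have hηc : HasCompactSupport η := hH.2.1.of_isClosed_subset (isClosed_tsupport _) hηs
  have hηG' : tsupport η ⊆ G := hηs.trans hH.2.2
  have hη1 : ContDiff ℝ 1 η := by
    refine contDiff_of_tsupport hG ?_ hηG'
    refine ((hβ.comp (hs.sub hH.1)).contDiffOn).congr fun z hz => ?_
    rw [hηG z hz]; rfl
  have hη0 : ∀ z, 0 ≤ η z := fun z => indicator_nonneg (fun z _ => hβn _) z
  have dH := hH.1.differentiable one_ne_zero
  have ds := hs.differentiable one_ne_zero
  refine ⟨fun z => H z + 1 * η z, ?_, ?_, ?_⟩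
  · simpa using hH.add hη1 hηc hηG'
  · rw [energy_add hb hH.1 hη1]
    have hle : 2 * (∫ z in G, gdot H η z) + ∫ z in G, gdot η η z ≤ 2 * ∫ z in G, gdot s η z := by
      have i2 : IntegrableOn (fun z => 2 * gdot H η z) G := (integrableOn_bdd hb (continuous_gdot hH.1 hη1)).const_mul _
      have i3 : IntegrableOn (fun z => gdot η η z) G := (integrableOn_bdd hb (continuous_gdot hη1 hη1))
      have i4 : IntegrableOn (fun z => 2 * gdot s η z) G := (integrableOn_bdd hb (continuous_gdot hs hη1)).const_mul _
      rw [← integral_const_mul, ← integral_const_mul, ← integral_add i2 i3]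
      refine setIntegral_mono_on (i2.add i3) i4 hG.measurableSet fun z hz => ?_
      have e1 : fderiv ℝ η z = deriv β (s z - H z) • (fderiv ℝ s z - fderiv ℝ H z) := by
        have h1 : η =ᶠ[𝓝 z] β ∘ (fun z => s z - H z) := by
          filter_upwards [hG.mem_nhds hz] with y hy using hηG y hy
        rw [h1.fderiv_eq]
        have h2 := (hβ.differentiable one_ne_zero (s z - H z)).hasDerivAt
        have h3 := (ds z).hasFDerivAt.fun_sub (dH z).hasFDerivAt
        exact (h2.comp_hasFDerivAt z h3).fderiv
      obtain ⟨b0, b1⟩ := hβd (s z - H z)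
      generalize deriv β (s z - H z) = b at *
      unfold gdot
      rw [e1]
      simp only [smul_apply, sub_apply, smul_eq_mul]
      generalize fderiv ℝ s z 1 = s1
      generalize fderiv ℝ s z Complex.I = s2
      generalize fderiv ℝ H z 1 = h1
      generalize fderiv ℝ H z Complex.I = h2
      have : 0 ≤ b * (2 - b) * ((s1 - h1) ^ 2 + (s2 - h2) ^ 2) :=
        mul_nonneg (mul_nonneg b0 (by linarith)) (by positivity)
      nlinarith
    have hs0 := hsub η hη1 hηc hηG' hη0
    rw [setIntegral_gdot (f := s) hηG'] at hle
    linarith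
  · intro z hz
    simp only [one_mul]
    rw [hηG z hz]
    rcases le_total (s z - H z) 0 with h | h
    · rw [hβ0 _ h, add_zero]
      exact ⟨le_rfl, le_max_left _ _, by linarith⟩
    · obtain ⟨h1, h2, h3⟩ := hβ1 _ h
      exact ⟨by linarith, le_max_of_le_right (by linarith), by linarith⟩

open Set Filter Topology in
lemma trunc_list {G : Set ℂ} (hG : IsOpen G) (hb : Bornology.IsBounded G) {u H : ℂ → ℝ} (hH : Adm G u H)
    {δ : ℝ} (hδ : 0 < δ) {ι : Type*} (s : ι → ℂ → ℝ) (L : Finset ι)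
    (hL : ∀ i ∈ L, ContDiff ℝ 1 (s i) ∧ (∀ z ∈ G, s i z ≤ u z) ∧
    (∀ η : ℂ → ℝ, ContDiff ℝ 1 η → HasCompactSupport η → tsupport η ⊆ G → (∀ z, 0 ≤ η z) → ∫ z, gdot (s i) η z ≤ 0)) :
    ∃ H', Adm G u H' ∧ (∫ z in G, gdot H' H' z ≤ ∫ z in G, gdot H H z) ∧
      (∀ z ∈ G, H z ≤ H' z ∧ H' z ≤ max (H z) (u z)) ∧ ∀ i ∈ L, ∀ z ∈ G, s i z - δ ≤ H' z := by
  classical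
  induction L using Finset.induction_on with
  | empty => exact ⟨H, hH, le_rfl, fun z _ => ⟨le_rfl, le_max_left _ _⟩, by simp⟩
  | insert a L ha ih =>
    obtain ⟨H1, h1, h2, h3, h4⟩ := ih fun i hi => hL i (Finset.mem_insert_of_mem hi)
    obtain ⟨k1, k2, k3⟩ := hL a (Finset.mem_insert_self _ _)
    obtain ⟨H2, g1, g2, g3⟩ := trunc hG hb h1 k1 k2 k3 hδ
    refine ⟨H2, g1, g2.trans h2, fun z hz => ?_, fun i hi z hz => ?_⟩
    · obtain ⟨a1, a2, a3⟩ := g3 z hz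
      obtain ⟨b1, b2⟩ := h3 z hz
      refine ⟨b1.trans a1, a2.trans (max_le b2 (le_max_of_le_right (k2 z hz)))⟩
    · obtain ⟨a1, a2, a3⟩ := g3 z hz
      rcases Finset.mem_insert.1 hi with rfl | hi
      · exact a3
      · exact (h4 i hi z hz).trans a1

open Set Filter Topology in
theorem near_min {G : Set ℂ} (hG : IsOpen G) (hb : Bornology.IsBounded G) {u : ℂ → ℝ} (hu : ContDiff ℝ 1 u)
    {δ e : ℝ} (hδ : 0 < δ) (he : 0 < e) {ι : Type*} (s s' : ι → ℂ → ℝ) (L : Finset ι)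
    (hL : ∀ i ∈ L, ContDiff ℝ 1 (s i) ∧ (∀ z ∈ G, s i z ≤ u z) ∧
    (∀ η : ℂ → ℝ, ContDiff ℝ 1 η → HasCompactSupport η → tsupport η ⊆ G → (∀ z, 0 ≤ η z) → ∫ z, gdot (s i) η z ≤ 0))
    (hL' : ∀ i ∈ L, ContDiff ℝ 1 (s' i) ∧ (∀ z ∈ G, u z ≤ s' i z) ∧
    (∀ η : ℂ → ℝ, ContDiff ℝ 1 η → HasCompactSupport η → tsupport η ⊆ G → (∀ z, 0 ≤ η z) → 0 ≤ ∫ z, gdot (s' i) η z)) :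
    ∃ H, ContDiff ℝ 1 H ∧ (∀ i ∈ L, ∀ z ∈ G, s i z - δ ≤ H z ∧ H z ≤ s' i z + δ) ∧
      ∀ χ : ℂ → ℝ, ContDiff ℝ 1 χ → HasCompactSupport χ → tsupport χ ⊆ G →
        (∫ z, gdot H χ z) ^ 2 ≤ e * ∫ z, gdot χ χ z := by
  set Es : Set ℝ := {x | ∃ H, Adm G u H ∧ x = ∫ z in G, gdot H H z} with hEs
  have hbd : BddBelow Es := by
    refine ⟨0, ?_⟩
    rintro x ⟨H, -, rfl⟩
    exact integral_nonneg fun z => gdot_self_nonneg _ _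
  have huA : Adm G u u := by
    have : (fun z => u z - u z) = fun _ => 0 := by ext z; ring
    refine ⟨hu, ?_, ?_⟩
    · rw [this]; exact HasCompactSupport.zero
    · have h0 : tsupport (fun _ : ℂ => (0:ℝ)) = ∅ := tsupport_eq_empty_iff.2 rfl
      rw [this, h0]; exact empty_subset _
  obtain ⟨x, ⟨H0, hH0, rfl⟩, hx⟩ := Real.lt_sInf_add_pos (s := Es) ⟨_, u, huA, rfl⟩ he
  obtain ⟨H1, a1, a2, a3, a4⟩ := trunc_list hG hb hH0 hδ s L hL
  obtain ⟨H2, b1, b2, b3, b4⟩ := trunc_list hG hb a1.neg hδ (fun i z => - s' i z) L (by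
    intro i hi
    obtain ⟨c1, c2, c3⟩ := hL' i hi
    refine ⟨c1.neg, fun z hz => neg_le_neg (c2 z hz), fun η h1 h2 h3 h4 => ?_⟩
    have := c3 η h1 h2 h3 h4
    simp only [gdot_neg_left, integral_neg]; linarith)
  have b1' := b1.neg
  simp only [neg_neg] at b1'
  refine ⟨fun z => - H2 z, b1'.1, ?_, ?_⟩
  · intro i hi z hz
    have c1 := a4 i hi z hz
    have c2 := (b3 z hz).2
    have c3 := b4 i hi z hz
    have c4 := (hL i hi).2.1 z hz
    refine ⟨?_, by linarith⟩
    have : max (- H1 z) (- u z) ≤ - (s i z - δ) := max_le (by linarith) (by linarith)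
    linarith
  · intro χ hχ hχc hχG
    have hmin : ∀ t : ℝ, 0 ≤ (∫ z, gdot χ χ z) * (t * t) + (2 * ∫ z, gdot (fun z => - H2 z) χ z) * t + e := by
      intro t
      have hA : Adm G u (fun z => (- H2 z) + t * χ z) := by
        refine b1'.add (contDiff_const.mul hχ) ?_ ?_
        · exact hχc.mul_left
        · refine (tsupport_mul_subset_right).trans hχG
      have h1 : sInf Es ≤ _ := csInf_le hbd ⟨_, hA, rfl⟩
      rw [energy_add hb b1'.1 hχ, setIntegral_gdot hχG, setIntegral_gdot hχG] at h1
      have h2 : ∫ z in G, gdot (fun z => - H2 z) (fun z => - H2 z) z ≤ ∫ z in G, gdot H1 H1 z := by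
        simp only [gdot_neg_left, gdot_neg_right, neg_neg] at b2 ⊢
        exact b2
      nlinarith
    have := discrim_le_zero hmin
    rw [discrim] at this
    nlinarith

/-- Laplacian on the complex plane -/
def lapC (f : ℂ → ℝ) (z : ℂ) : ℝ :=
  fderiv ℝ (fun x => fderiv ℝ f x 1) z 1 + fderiv ℝ (fun x => fderiv ℝ f x Complex.I) z Complex.I

lemma contDiffOn_fderiv_app {f : ℂ → ℝ} {O : Set ℂ} (hO : IsOpen O) (hf : ContDiffOn ℝ 2 f O) (v : ℂ) :
    ContDiffOn ℝ 1 (fun x => fderiv ℝ f x v) O := by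
  have h1 : ContDiffOn ℝ 1 (fderiv ℝ f) O := hf.fderiv_of_isOpen hO (by norm_num)
  exact h1.clm_apply contDiffOn_const

lemma contDiff_fderiv_app {f : ℂ → ℝ} (hf : ContDiff ℝ 2 f) (v : ℂ) :
    ContDiff ℝ 1 (fun x => fderiv ℝ f x v) := by
  rw [← contDiffOn_univ]; exact contDiffOn_fderiv_app isOpen_univ hf.contDiffOn v

lemma lapC_continuousOn {f : ℂ → ℝ} {O : Set ℂ} (hO : IsOpen O) (hf : ContDiffOn ℝ 2 f O) :
    ContinuousOn (lapC f) O := by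
  have h : ∀ v : ℂ, ContinuousOn (fun z => fderiv ℝ (fun x => fderiv ℝ f x v) z v) O := by
    intro v
    have h1 := (contDiffOn_fderiv_app hO hf v).continuousOn_fderiv_of_isOpen hO (le_refl _)
    exact h1.clm_apply continuousOn_const
  exact (h 1).add (h Complex.I)

lemma lapC_continuous {f : ℂ → ℝ} (hf : ContDiff ℝ 2 f) : Continuous (lapC f) := by
  rw [← continuousOn_univ]; exact lapC_continuousOn isOpen_univ hf.contDiffOn

open Set Filter Topology in
lemma integrable_mul_tsupport {g η : ℂ → ℝ} {O : Set ℂ} (hg : ContinuousOn g O) (hη : Continuous η)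
    (hc : HasCompactSupport η) (hs : tsupport η ⊆ O) : Integrable (fun z => g z * η z) := by
  have h1 : IntegrableOn (fun z => g z * η z) (tsupport η) :=
    ((hg.mono hs).mul hη.continuousOn).integrableOn_compact hc
  refine h1.integrable_of_forall_notMem_eq_zero fun z hz => ?_
  rw [image_eq_zero_of_notMem_tsupport hz, mul_zero]

open Set Filter Topology in
lemma integrable_gdot_on {f η : ℂ → ℝ} {O : Set ℂ} (hO : IsOpen O) (hf : ContDiffOn ℝ 1 f O) (hη : ContDiff ℝ 1 η)
    (hc : HasCompactSupport η) (hs : tsupport η ⊆ O) : Integrable (gdot f η) := by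
  have h1 : IntegrableOn (gdot f η) (tsupport η) :=
    ((gdot_continuousOn hO hf hη.contDiffOn).mono hs).integrableOn_compact hc
  exact h1.integrable_of_forall_notMem_eq_zero fun z hz => gdot_zero_of_notMem hz

open Set Filter Topology in
lemma green1 {f η : ℂ → ℝ} {O : Set ℂ} (hO : IsOpen O) (hf : ContDiffOn ℝ 2 f O) (hη : ContDiff ℝ 1 η)
    (hc : HasCompactSupport η) (hs : tsupport η ⊆ O) : ∫ z, gdot f η z = - ∫ z, lapC f z * η z := by
  have key : ∀ v : ℂ, Integrable (fun z => η z * fderiv ℝ (fun x => fderiv ℝ f x v) z v + fderiv ℝ f z v * fderiv ℝ η z v)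
      ∧ ∫ z, (η z * fderiv ℝ (fun x => fderiv ℝ f x v) z v + fderiv ℝ f z v * fderiv ℝ η z v) = 0 := by
    intro v
    have hts : tsupport (fun z => η z * fderiv ℝ f z v) ⊆ tsupport η := by
      refine closure_mono ?_
      intro z hz hz0
      apply hz; simp [hz0]
    have hP : ContDiff ℝ 1 (fun z => η z * fderiv ℝ f z v) := by
      refine contDiff_of_tsupport hO (hη.contDiffOn.mul (contDiffOn_fderiv_app hO hf v)) (hts.trans hs)
    have hPc : HasCompactSupport (fun z => η z * fderiv ℝ f z v) := hc.mul_right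
    have e : (fun z => η z * fderiv ℝ (fun x => fderiv ℝ f x v) z v + fderiv ℝ f z v * fderiv ℝ η z v)
        = fun z => fderiv ℝ (fun z => η z * fderiv ℝ f z v) z v := by
      ext z
      by_cases hz : z ∈ tsupport η
      · have d1 : DifferentiableAt ℝ (fun x => fderiv ℝ f x v) z :=
          ((contDiffOn_fderiv_app hO hf v).contDiffAt (hO.mem_nhds (hs hz))).differentiableAt (by norm_num)
        rw [fderiv_fun_mul (hη.differentiable (by norm_num) z) d1]
        simp
      · have h2 := notMem_tsupport_iff_eventuallyEq.1 hz
        have h3 := notMem_tsupport_iff_eventuallyEq.1 (fun h => hz (hts h))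
        rw [h3.fderiv_eq, h2.fderiv_eq, h2.eq_of_nhds]; simp
    rw [e]
    refine ⟨?_, integral_fderiv_zero hP hPc v⟩
    refine Continuous.integrable_of_hasCompactSupport ((hP.continuous_fderiv (by norm_num)).clm_apply continuous_const) ?_
    exact hPc.fderiv_apply ℝ v
  have h1 := key 1
  have h2 := key Complex.I
  have h3 := integral_add h1.1 h2.1
  rw [h1.2, h2.2] at h3
  have h4 : ∫ z, (gdot f η z + lapC f z * η z) = 0 := by
    rw [zero_add] at h3
    rw [← h3]; congr 1; ext z; unfold gdot lapC; ring
  rw [integral_add (integrable_gdot_on hO (hf.of_le (by norm_num)) hη hc hs)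
    (integrable_mul_tsupport (lapC_continuousOn hO hf) hη.continuous hc hs)] at h4
  linarith

lemma lapC_zero_of_notMem {f : ℂ → ℝ} {z : ℂ} (h : z ∉ tsupport f) : lapC f z = 0 := by
  have h2 := notMem_tsupport_iff_eventuallyEq.1 h
  have h3 : ∀ v : ℂ, (fun x => fderiv ℝ f x v) =ᶠ[nhds z] fun _ => 0 := by
    intro v
    filter_upwards [h2.eventuallyEq_nhds] with x hx
    rw [hx.fderiv_eq]; simp
  unfold lapC
  rw [(h3 1).fderiv_eq, (h3 Complex.I).fderiv_eq]; simp

open Set Filter Topology in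
lemma green2 {f η : ℂ → ℝ} (hf : ContDiff ℝ 2 f) (hη : ContDiff ℝ 1 η)
    (hc : HasCompactSupport f) : ∫ z, gdot f η z = - ∫ z, lapC f z * η z := by
  obtain ⟨θ, h1, h2, -, h4, -, -⟩ := exists_cutoff (K := tsupport f) (V := univ) hc isOpen_univ (subset_univ _)
  have g := green1 (η := fun z => θ z * η z) isOpen_univ hf.contDiffOn
    ((h1.of_le (by exact_mod_cast le_top)).mul hη) (h2.mul_right) (subset_univ _)
  have e1 : gdot f η = gdot f (fun z => θ z * η z) := by
    ext z
    by_cases hz : z ∈ tsupport f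
    · have : (fun z => θ z * η z) =ᶠ[𝓝 z] η := by
        filter_upwards [eventually_nhdsSet_iff_forall.1 h4 z hz] with x hx
        rw [hx, one_mul]
      unfold gdot; rw [this.fderiv_eq]
    · rw [gdot_comm, gdot_zero_of_notMem hz, gdot_comm, gdot_zero_of_notMem hz]
  have e2 : (fun z => lapC f z * η z) = (fun z => lapC f z * (θ z * η z)) := by
    ext z
    by_cases hz : z ∈ tsupport f
    · rw [(eventually_nhdsSet_iff_forall.1 h4 z hz).self_of_nhds, one_mul]
    · rw [lapC_zero_of_notMem hz]; simp
  rw [e1, e2]; exact g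

open Set Filter Topology in
lemma lapC_congr {f g : ℂ → ℝ} {z : ℂ} (h : f =ᶠ[𝓝 z] g) : lapC f z = lapC g z := by
  have h3 : ∀ v : ℂ, (fun x => fderiv ℝ f x v) =ᶠ[nhds z] fun x => fderiv ℝ g x v := by
    intro v
    filter_upwards [h.eventuallyEq_nhds] with x hx
    rw [hx.fderiv_eq]
  unfold lapC
  rw [(h3 1).fderiv_eq, (h3 Complex.I).fderiv_eq]

open Set Filter Topology in
lemma lapC_lin {f g : ℂ → ℝ} {z : ℂ} (hf : ContDiffAt ℝ 2 f z) (hg : ContDiffAt ℝ 2 g z) (a b : ℝ) :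
    lapC (fun z => a * f z + b * g z) z = a * lapC f z + b * lapC g z := by
  have hd : ∀ {f : ℂ → ℝ}, ContDiffAt ℝ 2 f z → ∀ v : ℂ, DifferentiableAt ℝ (fun x => fderiv ℝ f x v) z := by
    intro f hf v
    have : ContDiffAt ℝ 1 (fderiv ℝ f) z := hf.fderiv_right (by norm_num)
    exact (this.differentiableAt (by norm_num)).clm_apply (differentiableAt_const v)
  have h : ∀ v : ℂ, fderiv ℝ (fun x => fderiv ℝ (fun z => a * f z + b * g z) x v) z v =
      a * fderiv ℝ (fun x => fderiv ℝ f x v) z v + b * fderiv ℝ (fun x => fderiv ℝ g x v) z v := by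
    intro v
    have e : (fun x => fderiv ℝ (fun z => a * f z + b * g z) x v) =ᶠ[𝓝 z]
        fun x => a * fderiv ℝ f x v + b * fderiv ℝ g x v := by
      filter_upwards [hf.eventually (by simp), hg.eventually (by simp)] with x hx hy
      have dx := hx.differentiableAt (by norm_num)
      have dy := hy.differentiableAt (by norm_num)
      rw [fderiv_fun_add (dx.const_mul a) (dy.const_mul b), fderiv_const_mul dx, fderiv_const_mul dy]
      simp
    rw [e.fderiv_eq, fderiv_fun_add ((hd hf v).const_mul a) ((hd hg v).const_mul b), fderiv_const_mul (hd hf v), fderiv_const_mul (hd hg v)]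
    simp
  unfold lapC; rw [h, h]; ring

lemma lapC_sub_const (f : ℂ → ℝ) (a z : ℂ) : lapC (fun x => f (x - a)) z = lapC f (z - a) := by
  have h : ∀ v : ℂ, (fun x => fderiv ℝ (fun x => f (x - a)) x v) = fun x => (fun y => fderiv ℝ f y v) (x - a) := by
    intro v; ext x; rw [fderiv_comp_sub]
  unfold lapC
  rw [h, h, fderiv_comp_sub (f := fun y => fderiv ℝ f y 1), fderiv_comp_sub (f := fun y => fderiv ℝ f y Complex.I)]

/-- Laplacian of a radial function -/
lemma lapC_radial {L L1 L2 : ℝ → ℝ} (h1 : ∀ x, HasDerivAt L (L1 x) x) (h2 : ∀ x, HasDerivAt L1 (L2 x) x) (z : ℂ) :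
    lapC (fun z => L (z.re ^ 2 + z.im ^ 2)) z = 4 * L1 (z.re ^ 2 + z.im ^ 2) + 4 * (z.re ^ 2 + z.im ^ 2) * L2 (z.re ^ 2 + z.im ^ 2) := by
  have hre : ∀ z : ℂ, HasFDerivAt (fun z : ℂ => z.re) Complex.reCLM z := fun z => Complex.reCLM.hasFDerivAt
  have him : ∀ z : ℂ, HasFDerivAt (fun z : ℂ => z.im) Complex.imCLM z := fun z => Complex.imCLM.hasFDerivAt
  have hq : ∀ z : ℂ, HasFDerivAt (fun z : ℂ => z.re ^ 2 + z.im ^ 2) ((2 * z.re) • Complex.reCLM + (2 * z.im) • Complex.imCLM) z := by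
    intro z
    refine (((hre z).pow 2).add ((him z).pow 2)).congr_fderiv ?_
    ext <;> simp
  have d1 : ∀ v : ℂ, (fun x => fderiv ℝ (fun z : ℂ => L (z.re ^ 2 + z.im ^ 2)) x v) =
      fun x => L1 (x.re ^ 2 + x.im ^ 2) * (2 * (x.re * v.re + x.im * v.im)) := by
    intro v; ext x
    have := ((h1 _).comp_hasFDerivAt x (hq x)).fderiv
    rw [show (fun z : ℂ => L (z.re ^ 2 + z.im ^ 2)) = L ∘ (fun z : ℂ => z.re ^ 2 + z.im ^ 2) from rfl, this]; simp; ring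
  have d2 : ∀ v z : ℂ, HasFDerivAt (fun x : ℂ => L1 (x.re ^ 2 + x.im ^ 2) * (2 * (x.re * v.re + x.im * v.im)))
      (L1 (z.re ^ 2 + z.im ^ 2) • ((2 * v.re) • Complex.reCLM + (2 * v.im) • Complex.imCLM)
        + (2 * (z.re * v.re + z.im * v.im)) • (L2 (z.re ^ 2 + z.im ^ 2) • ((2 * z.re) • Complex.reCLM + (2 * z.im) • Complex.imCLM))) z := by
    intro v z
    have a1 := (h2 _).comp_hasFDerivAt z (hq z)
    have a2 : HasFDerivAt (fun x : ℂ => 2 * (x.re * v.re + x.im * v.im)) ((2 * v.re) • Complex.reCLM + (2 * v.im) • Complex.imCLM) z := by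
      refine ((((hre z).mul_const v.re).add ((him z).mul_const v.im)).const_mul 2).congr_fderiv ?_
      ext; simp; ring
    exact a1.mul a2
  unfold lapC
  rw [d1, d1, (d2 1 z).fderiv, (d2 Complex.I z).fderiv]
  simp; ring

lemma lapC_re {F F1 F2 : ℂ → ℂ} (h1 : ∀ z, HasDerivAt F (F1 z) z) (h2 : ∀ z, HasDerivAt F1 (F2 z) z) (z : ℂ) :
    lapC (fun z => (F z).re) z = 0 := by
  have d1 : ∀ v : ℂ, (fun x => fderiv ℝ (fun z : ℂ => (F z).re) x v) = fun x => (v * F1 x).re := by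
    intro v; ext x
    have := Complex.reCLM.hasFDerivAt.comp x (hasFDerivAt_real (h1 x))
    rw [show (fun z : ℂ => (F z).re) = Complex.reCLM ∘ F from rfl, this.fderiv]; simp
  have d2 : ∀ v z: ℂ, fderiv ℝ (fun x => (v * F1 x).re) z v = (v * v * F2 z).re := by
    intro v z
    have := Complex.reCLM.hasFDerivAt.comp z (hasFDerivAt_real ((h2 z).const_mul v))
    rw [show (fun x => (v * F1 x).re) = Complex.reCLM ∘ (fun x => v * F1 x) from rfl, this.fderiv]
    simp only [ContinuousLinearMap.comp_apply, Complex.reCLM_apply]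
    simp; ring
  unfold lapC
  rw [d1, d1, d2, d2]; simp

open Set Filter Topology in
lemma log_kernel {a : ℝ} (ha : 0 < a) : ∃ L L1 L2 : ℝ → ℝ, (∀ x, HasDerivAt L (L1 x) x) ∧ (∀ x, HasDerivAt L1 (L2 x) x) ∧
    Continuous L2 ∧ (∀ x, a ≤ x → L x = Real.log x) ∧ (∀ x, a ≤ x → L1 x + x * L2 x = 0) ∧ (∀ x, x ≤ a → 0 ≤ L1 x + x * L2 x) ∧
    0 < L1 0 := by
  set m : ℝ → ℝ := fun t => 1 / (max t a) ^ 2 with hm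
  have hmpos : ∀ t, 0 < max t a := fun t => lt_max_of_lt_right ha
  have hmc : Continuous m := by
    refine continuous_const.div (by fun_prop) fun t => by have := hmpos t; positivity
  set L1 : ℝ → ℝ := fun x => 1 / a - ∫ t in a..x, m t with hL1
  have d2 : ∀ x, HasDerivAt L1 (- m x) x := by
    intro x
    exact (intervalIntegral.integral_hasDerivAt_right (hmc.intervalIntegrable _ _)
      (hmc.stronglyMeasurableAtFilter _ _) hmc.continuousAt).const_sub (1 / a)
  have hL1c : Continuous L1 := continuous_iff_continuousAt.2 fun x => (d2 x).continuousAt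
  set L : ℝ → ℝ := fun x => Real.log a + ∫ t in a..x, L1 t with hL
  have d1 : ∀ x, HasDerivAt L (L1 x) x := by
    intro x
    exact (intervalIntegral.integral_hasDerivAt_right (hL1c.intervalIntegrable _ _)
      (hL1c.stronglyMeasurableAtFilter _ _) hL1c.continuousAt).const_add (Real.log a)
  have hL1big : ∀ x, a ≤ x → L1 x = 1 / x := by
    intro x hx
    have : ∫ t in a..x, m t = (- x⁻¹) - (- a⁻¹) := by
      refine intervalIntegral.integral_eq_sub_of_hasDerivAt (f := fun t => - t⁻¹) ?_ (hmc.intervalIntegrable _ _)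
      intro t ht
      rw [uIcc_of_le hx] at ht
      have ht0 : t ≠ 0 := (ha.trans_le ht.1).ne'
      have := (hasDerivAt_inv ht0).neg
      refine this.congr_deriv ?_
      simp only [hm]; rw [max_eq_left ht.1]; simp
    simp only [hL1]; rw [this]; simp
  have hL1small : ∀ x, x ≤ a → L1 x = 1 / a + (a - x) / a ^ 2 := by
    intro x hx
    have : ∫ t in a..x, m t = ∫ t in a..x, 1 / a ^ 2 := by
      refine intervalIntegral.integral_congr fun t ht => ?_
      rw [uIcc_of_ge hx] at ht
      simp only [hm]; rw [max_eq_right ht.2]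
    simp only [hL1]; rw [this, intervalIntegral.integral_const, smul_eq_mul]
    ring
  refine ⟨L, L1, fun x => - m x, d1, d2, hmc.neg, ?_, ?_, ?_, ?_⟩
  · intro x hx
    have : ∫ t in a..x, L1 t = Real.log x - Real.log a := by
      refine intervalIntegral.integral_eq_sub_of_hasDerivAt (f := Real.log) ?_ (hL1c.intervalIntegrable _ _)
      intro t ht
      rw [uIcc_of_le hx] at ht
      have ht0 : t ≠ 0 := (ha.trans_le ht.1).ne'
      rw [hL1big t ht.1, one_div]; exact Real.hasDerivAt_log ht0
    simp only [hL]; rw [this]; ring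
  · intro x hx
    have hx0 : 0 < x := ha.trans_le hx
    rw [hL1big x hx]; simp only [hm]; rw [max_eq_left hx]; field_simp; ring
  · intro x hx
    rw [hL1small x hx]; simp only [hm]; rw [max_eq_right hx]
    have : 1 / a + (a - x) / a ^ 2 + x * -(1 / a ^ 2) = 2 * (a - x) / a ^ 2 := by field_simp; ring
    rw [this]
    have : 0 ≤ a - x := by linarith
    positivity
  · rw [hL1small 0 ha.le]; simp only [sub_zero]; positivity

lemma normSq_rw (z : ℂ) : z.re ^ 2 + z.im ^ 2 = ‖z‖ ^ 2 := by
  rw [Complex.sq_norm, Complex.normSq_apply]; ring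

open Set Filter Topology in
lemma kernel {r : ℝ} (hr : 0 < r) : ∃ l : ℂ → ℝ, ContDiff ℝ 2 l ∧ (∀ z, r ≤ ‖z‖ → l z = Real.log ‖z‖) ∧
    (∀ z, 0 ≤ lapC l z) ∧ (∀ z, r ≤ ‖z‖ → lapC l z = 0) ∧ 0 < ∫ z, lapC l z := by
  obtain ⟨L, L1, L2, h1, h2, h3, h4, h5, h6, h7⟩ := log_kernel (a := r ^ 2) (by positivity)
  have hLc : ContDiff ℝ 2 L := by
    have e1 : deriv L = L1 := funext fun x => (h1 x).deriv
    have e2 : deriv L1 = L2 := funext fun x => (h2 x).deriv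
    rw [show (2 : WithTop ℕ∞) = 1 + 1 by norm_num, contDiff_succ_iff_deriv]
    refine ⟨fun x => (h1 x).differentiableAt, by simp, ?_⟩
    rw [e1, contDiff_one_iff_deriv, e2]
    exact ⟨fun x => (h2 x).differentiableAt, h3⟩
  have hq : ContDiff ℝ 2 (fun z : ℂ => z.re ^ 2 + z.im ^ 2) :=
    (Complex.reCLM.contDiff.pow 2).add (Complex.imCLM.contDiff.pow 2)
  have hl0 : ContDiff ℝ 2 (fun z : ℂ => L (z.re ^ 2 + z.im ^ 2)) := hLc.comp hq
  have hl : ContDiff ℝ 2 (fun z : ℂ => (1 / 2) * L (z.re ^ 2 + z.im ^ 2)) := contDiff_const.mul hl0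
  have hlap : ∀ z, lapC (fun z : ℂ => (1 / 2) * L (z.re ^ 2 + z.im ^ 2)) z = 2 * (L1 (‖z‖ ^ 2) + ‖z‖ ^ 2 * L2 (‖z‖ ^ 2)) := by
    intro z
    have e : (fun z : ℂ => (1 / 2) * L (z.re ^ 2 + z.im ^ 2)) = fun z : ℂ => (1 / 2) * L (z.re ^ 2 + z.im ^ 2) + 0 * L (z.re ^ 2 + z.im ^ 2) := by
      ext z; ring
    rw [e, lapC_lin hl0.contDiffAt hl0.contDiffAt, lapC_radial h1 h2, normSq_rw]; ring
  have hbig : ∀ z : ℂ, r ≤ ‖z‖ → lapC (fun z : ℂ => (1 / 2) * L (z.re ^ 2 + z.im ^ 2)) z = 0 := by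
    intro z hz
    rw [hlap, h5 _ (by gcongr)]; simp
  have hnn : ∀ z : ℂ, 0 ≤ lapC (fun z : ℂ => (1 / 2) * L (z.re ^ 2 + z.im ^ 2)) z := by
    intro z
    rcases le_total r ‖z‖ with hz | hz
    · rw [hbig z hz]
    · rw [hlap]; have := h6 (‖z‖ ^ 2) (by gcongr); linarith
  refine ⟨_, hl, ?_, hnn, hbig, ?_⟩
  · intro z hz
    rw [normSq_rw, h4 _ (by gcongr), Real.log_pow]; push_cast; ring
  · refine (lapC_continuous hl).integral_pos_of_hasCompactSupport_nonneg_nonzero ?_ hnn (x := 0) ?_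
    · refine HasCompactSupport.intro (K := Metric.closedBall 0 r) (isCompact_closedBall 0 r) ?_
      intro z hz
      apply hbig
      rw [Metric.mem_closedBall, dist_zero_right] at hz; linarith
    · rw [hlap]; simp; exact h7.ne'

open Set Filter Topology in
lemma Rp_integral {K : Set ℂ} (hK : IsCompact K) {m : ℂ → ℝ} (hm : Continuous m) (hmc : HasCompactSupport m)
    {k : ℂ → ℂ → ℝ} (hk : Continuous (fun p : ℂ × ℂ => k p.1 p.2)) (hR : ∀ ζ, m ζ ≠ 0 → Rp K (k ζ)) :
    Rp K (fun z => ∫ ζ, m ζ * k ζ z) := by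
  have : CompactSpace K := isCompact_iff_compactSpace.1 hK
  set V : Set C(K, ℝ) := {f | ∀ ε : ℝ, 0 < ε → ∃ P : Polynomial ℂ, ∀ z : K, |f z - (P.eval (z : ℂ)).re| ≤ ε} with hV
  have hVR : ∀ f : ℂ → ℝ, ∀ g : C(K, ℝ), (∀ z : K, g z = f z) → (Rp K f ↔ g ∈ V) := by
    intro f g hfg
    constructor
    · intro h ε hε
      obtain ⟨P, hP⟩ := h ε hε
      exact ⟨P, fun z => by rw [hfg]; exact hP z z.2⟩
    · intro h ε hε
      obtain ⟨P, hP⟩ := h ε hε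
      exact ⟨P, fun z hz => by have := hP ⟨z, hz⟩; rwa [hfg] at this⟩
  have hVex : ∀ g : C(K, ℝ), ∃ f : ℂ → ℝ, ∀ z : K, g z = f z := by
    intro g
    classical
    refine ⟨fun z => if h : z ∈ K then g ⟨z, h⟩ else 0, fun z => by simp⟩
  have hVc : IsClosed V := by
    refine isClosed_of_closure_subset ?_
    intro f hf
    obtain ⟨f', hf'⟩ := hVex f
    rw [← hVR f' f hf']
    refine Rp.closed fun ε hε => ?_
    obtain ⟨g, hg, hd⟩ := Metric.mem_closure_iff.1 hf ε hε
    obtain ⟨g', hg'⟩ := hVex g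
    refine ⟨g', (hVR g' g hg').2 hg, fun z hz => ?_⟩
    have := (ContinuousMap.dist_apply_le_dist (f := f) (g := g) ⟨z, hz⟩).trans hd.le
    rw [Real.dist_eq, hf', hg'] at this; exact this
  have hVcv : Convex ℝ V := by
    intro f hf g hg a b _ _ _
    obtain ⟨f', hf'⟩ := hVex f
    obtain ⟨g', hg'⟩ := hVex g
    refine (hVR (fun z => a * f' z + b * g' z) _ ?_).1 ((((hVR _ _ hf').2 hf).smul a).add (((hVR _ _ hg').2 hg).smul b))
    intro z; simp [hf', hg']
  set Kc : C(ℂ, C(K, ℝ)) := ContinuousMap.curry ⟨fun p : ℂ × K => k p.1 p.2, by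
    exact hk.comp (continuous_fst.prodMk (continuous_subtype_val.comp continuous_snd))⟩ with hKc
  set F : ℂ → C(K, ℝ) := fun ζ => m ζ • Kc ζ with hF
  have hFc : Continuous F := hm.smul Kc.continuous
  have hFcs : HasCompactSupport F := hmc.smul_right
  have hFi : Integrable F := hFc.integrable_of_hasCompactSupport hFcs
  obtain ⟨R, hR0, hRs⟩ : ∃ R : ℝ, 0 < R ∧ tsupport F ⊆ Metric.closedBall 0 R := by
    obtain ⟨R, hR⟩ := hFcs.isBounded.subset_closedBall 0
    exact ⟨max R 1, by positivity, hR.trans (Metric.closedBall_subset_closedBall (le_max_left _ _))⟩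
  have hFV : ∀ ζ, F ζ ∈ V := by
    intro ζ
    refine (hVR (fun z => m ζ * k ζ z) _ ?_).1 ?_
    · intro z; simp [hF, hKc]
    · by_cases h : m ζ = 0
      · simp only [h, zero_mul]; exact Rp.const 0
      · exact (hR ζ h).smul _
  have hav := hVcv.set_average_mem (μ := volume) hVc (t := Metric.closedBall (0:ℂ) R) (f := F)
    (Metric.measure_closedBall_pos _ _ hR0).ne' (measure_closedBall_lt_top).ne (ae_of_all _ hFV) hFi.integrableOn
  rw [setAverage_eq, setIntegral_eq_integral_of_forall_compl_eq_zero
    (fun z hz => image_eq_zero_of_notMem_tsupport fun h => hz (hRs h))] at hav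
  set v := volume.real (Metric.closedBall (0:ℂ) R) with hv
  have hv0 : v ≠ 0 := by
    rw [hv]; exact (ENNReal.toReal_pos (Metric.measure_closedBall_pos _ _ hR0).ne' (measure_closedBall_lt_top).ne).ne'
  obtain ⟨g', hg'⟩ := hVex (v⁻¹ • ∫ ζ, F ζ)
  have h1 := ((hVR _ _ hg').2 hav).smul v
  refine h1.congr fun z hz => ?_
  have h2 := hg' ⟨z, hz⟩
  have h3 : (∫ ζ, F ζ) ⟨z, hz⟩ = ∫ ζ, (F ζ) ⟨z, hz⟩ := by
    have := (ContinuousMap.evalCLM ℝ (⟨z, hz⟩ : K)).integral_comp_comm (μ := volume) hFi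
    simpa using this.symm
  rw [ContinuousMap.smul_apply, h3, smul_eq_mul] at h2
  rw [← h2, mul_inv_cancel_left₀ hv0]
  rfl

open Set Filter Topology in
lemma green_id {H θ k : ℂ → ℝ} (hH : ContDiff ℝ 1 H) (hθ : ContDiff ℝ 2 θ) (hθc : HasCompactSupport θ) (hk : ContDiff ℝ 2 k) :
    ∫ z, gdot H (fun z => θ z * k z) z = (∫ z, (H z * lapC θ z + 2 * gdot H θ z) * k z) - ∫ z, θ z * H z * lapC k z := by
  have hθ1 : ContDiff ℝ 1 θ := hθ.of_le (by norm_num)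
  have hk1 : ContDiff ℝ 1 k := hk.of_le (by norm_num)
  have dH := hH.differentiable (by norm_num)
  have dθ := hθ1.differentiable (by norm_num)
  have dk := hk1.differentiable (by norm_num)
  have hθH : ContDiff ℝ 1 (fun z => θ z * H z) := hθ1.mul hH
  have hHk : ContDiff ℝ 1 (fun z => H z * k z) := hH.mul hk1
  have hθHc : HasCompactSupport (fun z => θ z * H z) := hθc.mul_right
  have e : ∀ z, gdot H (fun z => θ z * k z) z = gdot k (fun z => θ z * H z) z - gdot θ (fun z => H z * k z) z + 2 * (gdot H θ z * k z) := by
    intro z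
    unfold gdot
    rw [fderiv_fun_mul (dθ z) (dk z), fderiv_fun_mul (dθ z) (dH z), fderiv_fun_mul (dH z) (dk z)]
    simp only [add_apply, smul_apply, smul_eq_mul]; ring
  have i1 := integrable_gdot_of_compact hk1 hθH hθHc
  have i2 : Integrable (gdot θ (fun z => H z * k z)) := by
    have := integrable_gdot_of_compact hHk hθ1 hθc
    refine this.congr (ae_of_all _ fun z => ?_)
    exact gdot_comm _ _ _
  have i3 : Integrable (fun z => gdot H θ z * k z) := by
    refine ((continuous_gdot hH hθ1).mul hk1.continuous).integrable_of_hasCompactSupport ?_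
    refine HasCompactSupport.intro (K := tsupport θ) hθc ?_
    intro z hz; simp only [Pi.mul_apply]; rw [gdot_zero_of_notMem hz, zero_mul]
  have i4 : Integrable (fun z => lapC θ z * (H z * k z)) := by
    refine ((lapC_continuous hθ).mul hHk.continuous).integrable_of_hasCompactSupport ?_
    refine HasCompactSupport.intro (K := tsupport θ) hθc ?_
    intro z hz; simp only [Pi.mul_apply]; rw [lapC_zero_of_notMem hz, zero_mul]
  simp_rw [e]
  rw [integral_add (f := fun z => gdot k (fun z => θ z * H z) z - gdot θ (fun z => H z * k z) z) (i1.sub i2) (i3.const_mul 2), integral_sub i1 i2, green1 isOpen_univ hk.contDiffOn hθH hθHc (subset_univ _),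
    green2 hθ hHk hθc, integral_const_mul]
  have e2 : ∀ z, (H z * lapC θ z + 2 * gdot H θ z) * k z = lapC θ z * (H z * k z) + 2 * (gdot H θ z * k z) := fun z => by ring
  simp_rw [e2]
  rw [integral_add i4 (i3.const_mul 2), integral_const_mul]
  have e3 : ∀ z, θ z * H z * lapC k z = lapC k z * (θ z * H z) := fun z => by ring
  simp_rw [e3]; ring

lemma poly_re_contDiff (F : Polynomial ℂ) : ContDiff ℝ 2 (fun z : ℂ => (F.eval z).re) := by
  have h : ContDiff ℂ 2 (fun z : ℂ => F.eval z) := by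
    simpa [Polynomial.aeval_def] using F.contDiff_aeval (𝕜 := ℂ) (n := 2)
  exact Complex.reCLM.contDiff.comp (h.restrict_scalars ℝ)

lemma poly_re_lap (F : Polynomial ℂ) (z : ℂ) : lapC (fun z : ℂ => (F.eval z).re) z = 0 :=
  lapC_re (fun z => F.hasDerivAt z) (fun z => (Polynomial.derivative F).hasDerivAt z) z

lemma sq_contDiff : ContDiff ℝ 2 (fun z : ℂ => ‖z‖ ^ 2) := by
  have hq : ContDiff ℝ 2 (fun z : ℂ => z.re ^ 2 + z.im ^ 2) :=
    (Complex.reCLM.contDiff.pow 2).add (Complex.imCLM.contDiff.pow 2)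
  simpa only [normSq_rw] using hq

lemma sq_lap (z : ℂ) : lapC (fun z : ℂ => ‖z‖ ^ 2) z = 4 := by
  have := lapC_radial (L := fun x => x) (L1 := fun _ => 1) (L2 := fun _ => 0) (fun x => hasDerivAt_id x) (fun x => hasDerivAt_const x 1) z
  simp only [normSq_rw] at this
  rw [this]; ring

open Set Filter Topology in
set_option maxHeartbeats 2000000 in
theorem WL {K : Set ℂ} (hK : IsCompact K) (hc : IsPreconnected Kᶜ) {u : ℂ → ℝ} (hu : ContDiff ℝ 2 u) {η : ℝ} (hη : 0 < η) :
    ∃ P : Polynomial ℂ, ∀ z ∈ frontier K, |u z - (P.eval z).re| ≤ η := by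
  classical
  obtain ⟨R0, hR0⟩ : ∃ R0 : ℝ, ∀ z ∈ K, ‖z‖ < R0 := by
    obtain ⟨R, hR⟩ := hK.isBounded.exists_norm_le
    exact ⟨R + 1, fun z hz => (hR z hz).trans_lt (by linarith)⟩
  obtain ⟨C, hC0, hC⟩ : ∃ C : ℝ, 0 < C ∧ ∀ z : ℂ, ‖z‖ ≤ R0 → |lapC u z| ≤ 4 * C := by
    obtain ⟨C, hC⟩ := (isCompact_closedBall (0:ℂ) R0).exists_bound_of_continuousOn (lapC_continuous hu).continuousOn
    refine ⟨max C 1, by positivity, fun z hz => ?_⟩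
    have := hC z (by simpa using hz)
    rw [Real.norm_eq_abs] at this
    have h2 := le_max_left C 1
    have h3 : 0 ≤ max C 1 := by positivity
    linarith
  set ε : ℝ := η / (8 * C) with hε
  set δ : ℝ := η / 8 with hδ
  have hε0 : 0 < ε := by positivity
  have hδ0 : 0 < δ := by positivity
  obtain ⟨S, hS1, hS2⟩ := barrier hK hc hε0
  set G : Set ℂ := {z | ‖z‖ < R0} ∩ {z | ∀ F ∈ S, ‖z‖ ^ 2 < (F.eval z).re} with hG
  have hGo : IsOpen G := by
    refine (isOpen_lt continuous_norm continuous_const).inter ?_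
    have : {z : ℂ | ∀ F ∈ S, ‖z‖ ^ 2 < (F.eval z).re} = ⋂ F ∈ S, {z : ℂ | ‖z‖ ^ 2 < (F.eval z).re} := by
      ext z; simp
    rw [this]
    exact isOpen_biInter_finset fun F _ => isOpen_lt (by fun_prop) (Complex.continuous_re.comp F.continuous)
  have hGb : Bornology.IsBounded G := Metric.isBounded_ball (x := (0:ℂ)) (r := R0) |>.subset (fun z hz => by simpa using hz.1)
  have hKG : K ⊆ G := fun z hz => ⟨hR0 z hz, fun F hF => hS1 F hF z hz⟩
  set s : Polynomial ℂ → ℂ → ℝ := fun F z => u z + C * (‖z‖ ^ 2 - (F.eval z).re) with hs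
  set s' : Polynomial ℂ → ℂ → ℝ := fun F z => u z - C * (‖z‖ ^ 2 - (F.eval z).re) with hs'
  have hd2 : ∀ F : Polynomial ℂ, ContDiff ℝ 2 (fun z : ℂ => ‖z‖ ^ 2 - (F.eval z).re) := fun F => sq_contDiff.sub (poly_re_contDiff F)
  have hdl : ∀ F : Polynomial ℂ, ∀ z, lapC (fun z : ℂ => ‖z‖ ^ 2 - (F.eval z).re) z = 4 := by
    intro F z
    have e : (fun z : ℂ => ‖z‖ ^ 2 - (F.eval z).re) = fun z : ℂ => 1 * ‖z‖ ^ 2 + (-1) * (F.eval z).re := by ext z; ring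
    rw [e, lapC_lin sq_contDiff.contDiffAt (poly_re_contDiff F).contDiffAt, sq_lap, poly_re_lap]; ring
  have hsc : ∀ F, ContDiff ℝ 2 (s F) := fun F => hu.add (contDiff_const.mul (hd2 F))
  have hsc' : ∀ F, ContDiff ℝ 2 (s' F) := fun F => hu.sub (contDiff_const.mul (hd2 F))
  have hsl : ∀ F z, lapC (s F) z = lapC u z + 4 * C := by
    intro F z
    have e : s F = fun z => 1 * u z + C * (‖z‖ ^ 2 - (F.eval z).re) := by ext z; simp only [hs]; ring
    rw [e, lapC_lin hu.contDiffAt (hd2 F).contDiffAt, hdl]; ring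
  have hsl' : ∀ F z, lapC (s' F) z = lapC u z - 4 * C := by
    intro F z
    have e : s' F = fun z => 1 * u z + (- C) * (‖z‖ ^ 2 - (F.eval z).re) := by ext z; simp only [hs']; ring
    rw [e, lapC_lin hu.contDiffAt (hd2 F).contDiffAt, hdl]; ring
  -- the small radius
  obtain ⟨r1, hr1, hr1G⟩ := hK.exists_cthickening_subset_open hGo hKG
  obtain ⟨r2, hr2, hr2s⟩ : ∃ r2 : ℝ, 0 < r2 ∧ ∀ z ∈ K, ∀ ζ : ℂ, ‖ζ - z‖ < r2 → ‖ζ‖ ≤ R0 → ∀ F ∈ S, |s F ζ - s F z| < δ ∧ |s' F ζ - s' F z| < δ := by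
    set Φ : ℂ → (S → ℝ × ℝ) := fun z F => (s F z, s' F z) with hΦ
    have hΦc : Continuous Φ := continuous_pi fun F => ((hsc F).continuous.prodMk (hsc' F).continuous)
    have huc := (isCompact_closedBall (0:ℂ) R0).uniformContinuousOn_of_continuous hΦc.continuousOn
    obtain ⟨r2, hr2, h⟩ := Metric.uniformContinuousOn_iff.1 huc δ hδ0
    refine ⟨r2, hr2, fun z hz ζ hζ hζR F hF => ?_⟩
    have h1 := h ζ (by simpa using hζR) z (by simpa using (hR0 z hz).le) (by rwa [dist_eq_norm])
    have h2 := (dist_le_pi_dist (Φ ζ) (Φ z) ⟨F, hF⟩).trans_lt h1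
    rw [Prod.dist_eq, max_lt_iff, Real.dist_eq, Real.dist_eq] at h2
    exact h2
  set r : ℝ := min r1 (r2 / 2) with hr
  have hr0 : 0 < r := lt_min hr1 (by positivity)
  obtain ⟨θ, hθs, hθc, hθG, hθ1, hθ0, hθle⟩ := exists_cutoff (K := Metric.cthickening r K) (V := G) hK.cthickening hGo
    ((Metric.cthickening_mono (min_le_left _ _) K).trans hr1G)
  have hθ2 : ContDiff ℝ 2 θ := hθs.of_le (by norm_cast)
  have hθC1 : ContDiff ℝ 1 θ := hθ2.of_le (by norm_num)
  obtain ⟨l, hl, hl1, hl2, hl3, hl4⟩ := kernel hr0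
  have hlC1 : ContDiff ℝ 1 l := hl.of_le (by norm_num)
  set c : ℝ := ∫ z, lapC l z with hcdef
  have hk : ∀ z : ℂ, ContDiff ℝ 2 (fun ζ => l (ζ - z)) := fun z => hl.comp (contDiff_id.sub contDiff_const)
  have hk1 : ∀ z : ℂ, ContDiff ℝ 1 (fun ζ => l (ζ - z)) := fun z => (hk z).of_le (by norm_num)
  have hχ : ∀ z : ℂ, ContDiff ℝ 1 (fun ζ => θ ζ * l (ζ - z)) := fun z => hθC1.mul (hk1 z)
  have hχt : ∀ z : ℂ, tsupport (fun ζ => θ ζ * l (ζ - z)) ⊆ tsupport θ := fun z => tsupport_mul_subset_left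
  obtain ⟨B, hB0, hB⟩ : ∃ B : ℝ, 0 < B ∧ ∀ z ∈ K, ∫ ζ, gdot (fun ζ => θ ζ * l (ζ - z)) (fun ζ => θ ζ * l (ζ - z)) ζ ≤ B := by
    have hfd : ∀ z ζ v : ℂ, fderiv ℝ (fun ζ => θ ζ * l (ζ - z)) ζ v = θ ζ * fderiv ℝ l (ζ - z) v + l (ζ - z) * fderiv ℝ θ ζ v := by
      intro z ζ v
      rw [fderiv_fun_mul (hθC1.differentiable (by norm_num) ζ) ((hk1 z).differentiable (by norm_num) ζ), fderiv_comp_sub]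
      simp
    set Ψ : ℂ × ℂ → ℝ := fun p => gdot (fun ζ => θ ζ * l (ζ - p.1)) (fun ζ => θ ζ * l (ζ - p.1)) p.2 with hΨ
    have hΨc : Continuous Ψ := by
      have c1 := hθC1.continuous
      have c2 := hlC1.continuous
      have c3 := hθC1.continuous_fderiv (by norm_num)
      have c4 := hlC1.continuous_fderiv (by norm_num)
      simp only [hΨ, gdot, hfd]
      fun_prop
    obtain ⟨B, hB⟩ := (hK.prod (show IsCompact (tsupport θ) from hθc)).exists_bound_of_continuousOn hΨc.continuousOn
    set vv := volume.real (tsupport θ) with hvv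
    refine ⟨max B 0 * vv + 1, by positivity, fun z hz => ?_⟩
    rw [← setIntegral_gdot (hχt z)]
    have : ‖∫ ζ in tsupport θ, gdot (fun ζ => θ ζ * l (ζ - z)) (fun ζ => θ ζ * l (ζ - z)) ζ‖ ≤ B * vv := by
      refine norm_setIntegral_le_of_norm_le_const (IsCompact.measure_lt_top hθc) ?_
      intro ζ hζ
      exact hB (z, ζ) ⟨hz, hζ⟩
    have h2 := (le_abs_self _).trans this
    have h3 : B * vv ≤ max B 0 * vv := by
      have : 0 ≤ vv := measureReal_nonneg
      gcongr; exact le_max_left _ _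
    linarith
  set e : ℝ := (c * η / 4) ^ 2 / B with he
  have he0 : 0 < e := by positivity
  obtain ⟨H, hH1, hH2, hH3⟩ := near_min hGo hGb (hu.of_le (by norm_num)) hδ0 he0 s s' S (by
    intro F hF
    refine ⟨(hsc F).of_le (by norm_num), fun z hz => ?_, fun χ h1 h2 h3 h4 => ?_⟩
    · have := hz.2 F hF
      simp only [hs]; nlinarith
    · rw [green1 isOpen_univ (hsc F).contDiffOn h1 h2 (subset_univ _)]
      have : 0 ≤ ∫ z, lapC (s F) z * χ z := by
        refine integral_nonneg fun z => ?_
        by_cases hz : z ∈ G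
        · refine mul_nonneg ?_ (h4 z)
          rw [hsl]
          have := abs_le.1 (hC z hz.1.le); linarith
        · have : χ z = 0 := image_eq_zero_of_notMem_tsupport fun h => hz (h3 h)
          simp [this]
      linarith) (by
    intro F hF
    refine ⟨(hsc' F).of_le (by norm_num), fun z hz => ?_, fun χ h1 h2 h3 h4 => ?_⟩
    · have := hz.2 F hF
      simp only [hs']; nlinarith
    · rw [green1 isOpen_univ (hsc' F).contDiffOn h1 h2 (subset_univ _)]
      have : ∫ z, lapC (s' F) z * χ z ≤ 0 := by
        refine integral_nonpos fun z => ?_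
        by_cases hz : z ∈ G
        · refine mul_nonpos_of_nonpos_of_nonneg ?_ (h4 z)
          rw [hsl']
          have := abs_le.1 (hC z hz.1.le); linarith
        · have : χ z = 0 := image_eq_zero_of_notMem_tsupport fun h => hz (h3 h)
          simp [this]
      linarith)
  set m : ℂ → ℝ := fun ζ => H ζ * lapC θ ζ + 2 * gdot H θ ζ with hm
  have hmc : Continuous m := (hH1.continuous.mul (lapC_continuous hθ2)).add (continuous_const.mul (continuous_gdot hH1 hθC1))
  have hmz : ∀ ζ, ζ ∉ tsupport θ → m ζ = 0 := by
    intro ζ hζ; simp only [hm]; rw [lapC_zero_of_notMem hζ, gdot_zero_of_notMem hζ]; simp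
  have hmz2 : ∀ ζ, ζ ∈ Metric.cthickening r K → m ζ = 0 := by
    intro ζ hζ
    have h1 : θ =ᶠ[𝓝 ζ] fun _ => 1 := eventually_nhdsSet_iff_forall.1 hθ1 ζ hζ
    have h2 : lapC θ ζ = 0 := by
      rw [lapC_congr h1]; unfold lapC; simp
    have h3 : gdot H θ ζ = 0 := by unfold gdot; rw [h1.fderiv_eq]; simp
    simp only [hm]; rw [h2, h3]; simp
  have hRp : Rp K (fun z => ∫ ζ, m ζ * l (ζ - z)) := by
    refine Rp_integral hK hmc (HasCompactSupport.intro hθc hmz) (k := fun ζ z => l (ζ - z)) ?_ ?_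
    · exact hl.continuous.comp (continuous_fst.sub continuous_snd)
    · intro ζ hζ
      have hζ2 : ζ ∉ Metric.cthickening r K := fun h => hζ (hmz2 ζ h)
      have hζK : ζ ∉ K := fun h => hζ2 (Metric.self_subset_cthickening K h)
      refine (runge hK hc hζK).2.congr fun z hz => ?_
      have hd : r ≤ ‖ζ - z‖ := by
        by_contra hlt
        push Not at hlt
        exact hζ2 (Metric.mem_cthickening_of_dist_le ζ z r K hz (by rw [dist_eq_norm]; exact hlt.le))
      rw [hl1 _ hd, norm_sub_rev]
  obtain ⟨P, hP⟩ := (hRp.smul c⁻¹) (η / 4) (by positivity)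
  refine ⟨P, fun z hzf => ?_⟩
  have hzK : z ∈ K := hK.isClosed.frontier_subset hzf
  have hid := green_id hH1 hθ2 hθc (hk z)
  have herr : |∫ ζ, gdot H (fun ζ => θ ζ * l (ζ - z)) ζ| ≤ c * η / 4 := by
    have h1 := hH3 _ (hχ z) hθc.mul_right ((hχt z).trans hθG)
    have h2 : e * ∫ ζ, gdot (fun ζ => θ ζ * l (ζ - z)) (fun ζ => θ ζ * l (ζ - z)) ζ ≤ (c * η / 4) ^ 2 := by
      calc _ ≤ e * B := by gcongr; exact hB z hzK
        _ = _ := by rw [he]; field_simp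
    exact abs_le_of_sq_le_sq (h1.trans h2) (by positivity)
  obtain ⟨F, hFS, hF⟩ := hS2 z hzf
  have hlapk : ∀ ζ, lapC (fun ζ => l (ζ - z)) ζ = lapC l (ζ - z) := fun ζ => lapC_sub_const l z ζ
  have hcz : ∫ ζ, lapC l (ζ - z) = c := integral_sub_right_eq_self (lapC l) z
  have hzF : |s F z - u z| ≤ C * ε ∧ |s' F z - u z| ≤ C * ε := by
    have h1 := hS1 F hFS z hzK
    have h3 : C * ((F.eval z).re - ‖z‖ ^ 2) ≤ C * ε := by gcongr; linarith
    have h4 : 0 ≤ C * ((F.eval z).re - ‖z‖ ^ 2) := mul_nonneg hC0.le (by linarith)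
    simp only [hs, hs']
    constructor <;> rw [abs_le] <;> constructor <;> linarith
  have hpt : ∀ ζ, ‖θ ζ * H ζ * lapC (fun ζ => l (ζ - z)) ζ - u z * lapC l (ζ - z)‖ ≤ (η / 2) * lapC l (ζ - z) := by
    intro ζ
    rw [hlapk]
    rcases le_or_gt r ‖ζ - z‖ with h | h
    · rw [hl3 _ h]; simp
    · have hζ : ζ ∈ Metric.cthickening r K :=
        Metric.mem_cthickening_of_dist_le ζ z r K hzK (by rw [dist_eq_norm]; exact h.le)
      have hθζ : θ ζ = 1 := (eventually_nhdsSet_iff_forall.1 hθ1 ζ hζ).self_of_nhds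
      have hζG : ζ ∈ G := hr1G (Metric.cthickening_mono (min_le_left _ _) K hζ)
      have h1 := hH2 F hFS ζ hζG
      have h2 := hr2s z hzK ζ (h.trans_le ((min_le_right _ _).trans (by linarith))) hζG.1.le F hFS
      rw [hθζ, one_mul, ← sub_mul, norm_mul, Real.norm_eq_abs, Real.norm_of_nonneg (hl2 _)]
      refine mul_le_mul_of_nonneg_right ?_ (hl2 _)
      have hCε : C * ε = η / 8 := by rw [hε]; field_simp
      rw [hCε] at hzF
      have a1 := abs_lt.1 h2.1
      have a2 := abs_lt.1 h2.2
      have a3 := abs_le.1 hzF.1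
      have a4 := abs_le.1 hzF.2
      have a5 : δ = η / 8 := hδ
      rw [abs_le]; constructor <;> linarith
  have hli : Integrable (fun ζ => lapC l (ζ - z)) := by
    have : Integrable (lapC l) := Integrable.of_integral_ne_zero hl4.ne'
    exact this.comp_sub_right z
  have hθi : Integrable (fun ζ => θ ζ * H ζ * lapC (fun ζ => l (ζ - z)) ζ) := by
    refine ((hθ2.continuous.mul hH1.continuous).mul (lapC_continuous (hk z))).integrable_of_hasCompactSupport ?_
    exact (hθc.mul_right).mul_right
  have hav : |(∫ ζ, θ ζ * H ζ * lapC (fun ζ => l (ζ - z)) ζ) - c * u z| ≤ c * (η / 2) := by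
    have h1 : (∫ ζ, θ ζ * H ζ * lapC (fun ζ => l (ζ - z)) ζ) - c * u z =
        ∫ ζ, (θ ζ * H ζ * lapC (fun ζ => l (ζ - z)) ζ - u z * lapC l (ζ - z)) := by
      rw [integral_sub hθi (hli.const_mul _), integral_const_mul, hcz]; ring
    rw [h1, ← Real.norm_eq_abs]
    calc _ ≤ ∫ ζ, (η / 2) * lapC l (ζ - z) := norm_integral_le_of_norm_le (hli.const_mul _) (ae_of_all _ hpt)
      _ = _ := by rw [integral_const_mul, hcz]; ring
  have hPz := hP z hzK
  set A := ∫ ζ, m ζ * l (ζ - z) with hA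
  have hid' : ∫ ζ, gdot H (fun ζ => θ ζ * l (ζ - z)) ζ = A - ∫ ζ, θ ζ * H ζ * lapC (fun ζ => l (ζ - z)) ζ := hid
  rw [hid'] at herr
  have h5 : |c⁻¹ * A - u z| ≤ η * (3 / 4) := by
    have : c⁻¹ * A - u z = c⁻¹ * (A - c * u z) := by field_simp
    rw [this, abs_mul, abs_of_pos (inv_pos.2 hl4)]
    have h6 : |A - c * u z| ≤ c * (η * (3 / 4)) := by
      have a1 := abs_le.1 herr
      have a2 := abs_le.1 hav
      rw [abs_le]; constructor <;> linarith
    calc _ ≤ c⁻¹ * (c * (η * (3 / 4))) := by gcongr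
      _ = _ := by field_simp
  have a1 := abs_le.1 h5
  have a2 := abs_le.1 hPz
  rw [abs_le]; constructor <;> linarith

/-- the filled hull of `K` with respect to the point `p` -/
def hull (p : ℂ) (K : Set ℂ) : Set ℂ := (connectedComponentIn Kᶜ p)ᶜ

open Set Filter Topology in
lemma hull_compl_preconn (p : ℂ) (K : Set ℂ) : IsPreconnected (hull p K)ᶜ := by
  unfold hull; rw [compl_compl]; exact isPreconnected_connectedComponentIn

open Set Filter Topology in
lemma hull_closed {p : ℂ} {K : Set ℂ} (hK : IsCompact K) : IsClosed (hull p K) := by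
  unfold hull; exact (hK.isClosed.isOpen_compl.connectedComponentIn).isClosed_compl

open Set Filter Topology in
lemma subset_hull (p : ℂ) (K : Set ℂ) : K ⊆ hull p K := fun z hz h => connectedComponentIn_subset _ _ h hz

open Set Filter Topology in
lemma hull_mono (p : ℂ) {K K' : Set ℂ} (h : K ⊆ K') : hull p K ⊆ hull p K' :=
  compl_subset_compl.2 (connectedComponentIn_mono p (compl_subset_compl.2 h))

open Set Filter Topology in
lemma far_preconn {R : ℝ} (hR : 0 < R) : IsPreconnected {z : ℂ | R ≤ ‖z‖} := by
  have : {z : ℂ | R ≤ ‖z‖} = (fun p : ℝ × ℝ => (p.1 : ℂ) * Complex.exp (p.2 * Complex.I)) '' (Ici R ×ˢ univ) := by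
    ext z
    constructor
    · intro hz
      exact ⟨(‖z‖, Complex.arg z), ⟨hz, mem_univ _⟩, Complex.norm_mul_exp_arg_mul_I z⟩
    · rintro ⟨⟨a, b⟩, ⟨ha, -⟩, rfl⟩
      have ha' : R ≤ a := ha
      simp only [mem_ofPred_eq, norm_mul, Complex.norm_exp_ofReal_mul_I, mul_one, Complex.norm_real, Real.norm_eq_abs]
      exact ha'.trans (le_abs_self a)
  rw [this]
  refine IsPreconnected.image (isPreconnected_Ici.prod isPreconnected_univ) _ ?_
  fun_prop

open Set Filter Topology in
lemma hull_subset_ball {p : ℂ} {K : Set ℂ} {R : ℝ} (hR : 0 < R) (hK : ∀ z ∈ K, ‖z‖ < R) (hp : R ≤ ‖p‖) :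
    ∀ z ∈ hull p K, ‖z‖ < R := by
  intro z hz
  by_contra h
  push Not at h
  have hsub : {z : ℂ | R ≤ ‖z‖} ⊆ Kᶜ := fun y hy hyK => absurd (hK y hyK) (not_lt.2 hy)
  exact hz ((far_preconn hR).subset_connectedComponentIn hp hsub h)

open Set Filter Topology in
lemma hull_compact {p : ℂ} {K : Set ℂ} (hKc : IsCompact K) {R : ℝ} (hR : 0 < R) (hK : ∀ z ∈ K, ‖z‖ < R) (hp : R ≤ ‖p‖) :
    IsCompact (hull p K) := by
  refine (isCompact_closedBall (0:ℂ) R).of_isClosed_subset (hull_closed hKc) fun z hz => ?_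
  simpa using (hull_subset_ball hR hK hp z hz).le

open Set Filter Topology in
lemma hull_frontier {p : ℂ} {K : Set ℂ} (hK : IsCompact K) : frontier (hull p K) ⊆ K := by
  intro z hz
  by_contra hzK
  have hV : IsOpen (connectedComponentIn Kᶜ p) := hK.isClosed.isOpen_compl.connectedComponentIn
  unfold hull at hz
  rw [frontier_compl, frontier_eq_closure_inter_closure, hV.isClosed_compl.closure_eq] at hz
  have hW : connectedComponentIn Kᶜ z ∈ 𝓝 z := connectedComponentIn_mem_nhds (hK.isClosed.isOpen_compl.mem_nhds hzK)
  obtain ⟨y, hy1, hy2⟩ := mem_closure_iff_nhds.1 hz.1 _ hW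
  apply hz.2
  rw [connectedComponentIn_eq hy2, ← connectedComponentIn_eq hy1]
  exact mem_connectedComponentIn hzK

open Set Filter Topology in
lemma no_log_circle {a : ℂ} {R : ℝ} (hR : 0 < R) {M : ℂ → ℂ} (hM : Continuous M)
    (h : ∀ z, ‖z - a‖ = R → Complex.exp (M z) = z - a) : False := by
  set c : ℝ → ℂ := fun t => a + R * Complex.exp (t * Complex.I) with hc
  have hcn : ∀ t, ‖c t - a‖ = R := by
    intro t; simp [hc, Complex.norm_exp_ofReal_mul_I, abs_of_pos hR]
  set g : ℝ → ℂ := fun t => M (c t) - t * Complex.I - Real.log R with hg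
  have hgc : Continuous g := by
    have : Continuous c := by fun_prop
    have := hM.comp this
    simp only [hg]; fun_prop
  have hge : ∀ t, Complex.exp (g t) = 1 := by
    intro t
    simp only [hg]
    rw [Complex.exp_sub, Complex.exp_sub, h _ (hcn t), ← Complex.ofReal_exp, Real.exp_log hR]
    simp only [hc, add_sub_cancel_left]
    have : (R : ℂ) ≠ 0 := by exact_mod_cast hR.ne'
    have := Complex.exp_ne_zero (t * Complex.I)
    field_simp
  choose n hn using fun t => Complex.exp_eq_one_iff.1 (hge t)
  have hnc : Continuous fun t => (n t : ℝ) := by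
    have : (fun t => (n t : ℝ)) = fun t => (g t).im / (2 * π) := by
      ext t; rw [hn t]; simp
    rw [this]
    exact (Complex.continuous_im.comp hgc).div_const _
  have hnc' : Continuous n := by
    exact Int.isClosedEmbedding_coe_real.isEmbedding.continuous_iff.2 hnc
  have hconst : n 0 = n (2 * π) := PreconnectedSpace.constant inferInstance hnc'
  have e1 := hn 0
  have e2 := hn (2 * π)
  have hc0 : c (2 * π) = c 0 := by
    simp only [hc]
    push_cast
    rw [Complex.exp_two_pi_mul_I]; simp
  rw [hconst, ← e2] at e1
  simp only [hg, hc0] at e1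
  have h3 : (2 * π : ℂ) * Complex.I = 0 := by
    have h4 : ((2 * π : ℝ) : ℂ) * Complex.I = ((0 : ℝ) : ℂ) * Complex.I := by linear_combination e1
    simpa using h4
  exact Complex.two_pi_I_ne_zero h3

open Set Filter Topology in
lemma hull_subset {Ω : Set ℂ} (hΩ : IsOpen Ω) (hsc : IsSimplyConnected Ω) {p : ℂ} {K : Set ℂ} (hKc : IsCompact K)
    (hKΩ : K ⊆ Ω) {R : ℝ} (hR : 0 < R) (hK : ∀ z ∈ K, ‖z‖ < R) (hp : R ≤ ‖p‖) : hull p K ⊆ Ω := by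
  classical
  intro a ha
  by_contra haΩ
  obtain ⟨L, hLc, hL⟩ := Complex.exists_continuousOn_eqOn_exp_comp hsc hΩ (g := fun z => z - a) (by fun_prop) (by
    rintro ⟨z, hz, h⟩
    exact haΩ (by rwa [← sub_eq_zero.1 h]))
  obtain ⟨L', hL'⟩ := ContinuousMap.exists_restrict_eq hKc.isClosed (⟨K.domRestrict L, (hLc.mono hKΩ).domRestrict⟩ : C(K, ℂ))
  have hL'K : ∀ z ∈ K, Complex.exp (L' z) = z - a := by
    intro z hz
    have h1 := congrArg (fun f : C(K, ℂ) => f ⟨z, hz⟩) hL'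
    have h2 : L' z = L z := h1
    rw [h2]; exact hL (hKΩ hz)
  set F : ℂ → ℂ := fun z => if z ∈ hull p K then Complex.exp (L' z) else z - a with hF
  have hFc : Continuous F := by
    refine Continuous.if ?_ (Complex.continuous_exp.comp L'.continuous) (by fun_prop)
    intro z hz
    exact hL'K z (hull_frontier hKc hz)
  have hF0 : ∀ z, F z ≠ 0 := by
    intro z
    simp only [hF]
    split_ifs with h
    · exact Complex.exp_ne_zero _
    · intro h0
      rw [sub_eq_zero.1 h0] at h; exact h ha
  have huniv : IsSimplyConnected (univ : Set ℂ) := by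
    have : ContractibleSpace (univ : Set ℂ) := (Homeomorph.Set.univ ℂ).contractibleSpace
    exact SimplyConnectedSpace.ofContractible (univ : Set ℂ)
  obtain ⟨M, hMc, hM⟩ := Complex.exists_continuousOn_eqOn_exp_comp huniv isOpen_univ (g := F) hFc.continuousOn (by
    rintro ⟨z, -, h⟩; exact hF0 z h)
  refine no_log_circle (a := a) (R := 2 * R) (by positivity) (continuousOn_univ.1 hMc) fun z hz => ?_
  have h1 : Complex.exp (M z) = F z := hM (mem_univ z)
  rw [h1]; simp only [hF]
  rw [if_neg]
  intro hzh
  have h2 := hull_subset_ball hR hK hp z hzh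
  have h3 := hull_subset_ball hR hK hp a ha
  have := norm_sub_le z a
  linarith

open Set Filter Topology in
/-- continuity of hulls -/
lemma hull_cont {p : ℂ} {K : ℝ → Set ℂ} {t t0 R : ℝ} (ht0 : t0 < t) (hKc : ∀ s, t0 < s → IsCompact (K s))
    (hmono : ∀ s s', t0 < s → s ≤ s' → K s' ⊆ K s) (hIntg : ∀ z, (∀ s, t0 < s → s < t → z ∈ K s) → z ∈ K t)
    (hR : 0 < R) (hK : ∀ s, t0 < s → ∀ z ∈ K s, ‖z‖ < R) (hp : R ≤ ‖p‖) {W : Set ℂ} (hW : IsOpen W) (hWK : hull p (K t) ⊆ W) :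
    ∃ s, t0 < s ∧ s < t ∧ hull p (K s) ⊆ W := by
  have key : ∀ A : ℝ → Set ℂ, (∀ s, t0 < s → s < t → IsCompact (A s)) → (∀ s s', t0 < s → s ≤ s' → s' < t → A s' ⊆ A s) →
      (∀ z, ¬ (∀ s, t0 < s → s < t → z ∈ A s)) → ∃ s, t0 < s ∧ s < t ∧ A s = ∅ := by
    intro A hA hAm hAe
    by_contra hcon
    push Not at hcon
    have : Nonempty (Ioo t0 t) := (nonempty_Ioo.2 ht0).to_subtype
    obtain ⟨z, hz⟩ := IsCompact.nonempty_iInter_of_directed_nonempty_isCompact_isClosed (fun s : Ioo t0 t => A s) (by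
      intro s s'
      refine ⟨⟨max s s', lt_max_of_lt_left s.2.1, max_lt s.2.2 s'.2.2⟩, ?_, ?_⟩
      · exact hAm _ _ s.2.1 (le_max_left _ _) (max_lt s.2.2 s'.2.2)
      · exact hAm _ _ s'.2.1 (le_max_right _ _) (max_lt s.2.2 s'.2.2)) (fun s => hcon s s.2.1 s.2.2)
      (fun s => hA s s.2.1 s.2.2) (fun s => (hA s s.2.1 s.2.2).isClosed)
    rw [mem_iInter] at hz
    exact hAe z fun s h1 h2 => hz ⟨s, h1, h2⟩
  obtain ⟨s, h1, h2, h3⟩ := key (fun s => hull p (K s) ∩ Wᶜ) (fun s h1 h2 =>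
      (hull_compact (hKc s h1) hR (hK s h1) hp).inter_right hW.isClosed_compl)
    (fun s s' h1 h2 _ => inter_subset_inter_left _ (hull_mono p (hmono s s' h1 h2))) (by
      intro z hz
      have hzs : ∀ s, t0 < s → s < t → z ∈ hull p (K s) := fun s h1 h2 => (hz s h1 h2).1
      obtain ⟨s1, hs1, hs1'⟩ := exists_between ht0
      apply (hz s1 hs1 hs1').2
      apply hWK
      -- z in hull of K t
      by_contra hzV
      have hzV' : z ∈ connectedComponentIn (K t)ᶜ p := by
        unfold hull at hzV; rwa [notMem_compl_iff] at hzV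
      have hopen : IsOpen (K t)ᶜ := (hKc t ht0).isClosed.isOpen_compl
      have hpm : p ∈ (K t)ᶜ := fun h => absurd (hK t ht0 p h) (not_lt.2 hp)
      have hconn : IsConnected (connectedComponentIn (K t)ᶜ p) := isConnected_connectedComponentIn_iff.2 hpm
      have hpc := (hopen.connectedComponentIn.isConnected_iff_isPathConnected).1 hconn
      obtain ⟨γ, hγ⟩ := hpc.joinedIn p (mem_connectedComponentIn hpm) z hzV'
      obtain ⟨s, k1, k2, k3⟩ := key (fun s => K s ∩ range γ) (fun s h1 _ => (hKc s h1).inter_right (isCompact_range γ.continuous).isClosed)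
        (fun s s' h1 h2 _ => inter_subset_inter_left _ (hmono s s' h1 h2)) (by
          intro y hy
          have hyK : y ∈ K t := hIntg y fun s h1 h2 => (hy s h1 h2).1
          obtain ⟨x, rfl⟩ := (hy s1 hs1 hs1').2
          exact connectedComponentIn_subset _ _ (hγ x) hyK)
      apply hzs s k1 k2
      have hsub : range γ ⊆ (K s)ᶜ := by
        intro y hy hyK
        have : y ∈ K s ∩ range γ := ⟨hyK, hy⟩
        rw [k3] at this; exact this
      have hpre : IsPreconnected (range γ) := isPreconnected_range γ.continuous
      exact hpre.subset_connectedComponentIn ⟨0, γ.source⟩ hsub ⟨1, γ.target⟩)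
  refine ⟨s, h1, h2, fun z hz => ?_⟩
  by_contra hzW
  have : z ∈ hull p (K s) ∩ Wᶜ := ⟨hz, hzW⟩
  rw [h3] at this; exact this

open Set Filter Topology in
lemma prim (P : Polynomial ℂ) (η : ℝ) : ∃ g : ℂ → ℂ, Differentiable ℂ g ∧
    ∀ z, ‖deriv g z‖ = exp (((P.eval z).re + 2 * η) / 2) := by
  have hd : Differentiable ℂ (fun z : ℂ => Complex.exp ((P.eval z + 2 * η) / 2)) := by
    have := P.differentiable
    fun_prop
  obtain ⟨g, hg⟩ := hd.isExactOn_univ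
  have hg' : ∀ z, HasDerivAt g (Complex.exp ((P.eval z + 2 * η) / 2)) z := fun z => hg z (mem_univ _)
  refine ⟨g, fun z => (hg' z).differentiableAt, fun z => ?_⟩
  rw [(hg' z).deriv, Complex.norm_exp]
  congr 1
  have : ((P.eval z + 2 * η) / 2 : ℂ) = (((1/2 : ℝ) : ℂ)) * (P.eval z + ((2 * η : ℝ) : ℂ)) := by push_cast; ring
  rw [this, Complex.re_ofReal_mul, Complex.add_re, Complex.ofReal_re]; ring

open Set Filter Topology in
lemma step1 {K : Set ℂ} (hK : IsCompact K) {u : ℂ → ℝ} (hu : ContDiff ℝ 2 u)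
    (hsub : ∀ z ∈ interior K, 0 ≤ lapC u z + exp (u z)) {P : Polynomial ℂ} {η : ℝ} (hη : 0 < η)
    (hP : ∀ z ∈ frontier K, |u z - (P.eval z).re| ≤ η) :
    (∫ z in K, exp (u z)) * (8 * π - ∫ z in K, exp (u z)) ≤ 8 * π * ∫ z in K, exp ((P.eval z).re + 2 * η) := by
  obtain ⟨g, hg, hg1⟩ := prim P η
  have hg2 : ∀ z, ‖deriv g z‖ ^ 2 = exp ((P.eval z).re + 2 * η) := by
    intro z; rw [hg1, ← Real.exp_nat_mul]; congr 1; push_cast; ring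
  set φ : ℂ → ℝ := fun z => u z - (P.eval z).re - 2 * η with hφ
  have hφc : ContDiff ℝ 2 φ := (hu.sub (poly_re_contDiff P)).sub contDiff_const
  have hPc : Continuous (fun z : ℂ => exp ((P.eval z).re + 2 * η)) := by
    have := (poly_re_contDiff P).continuous
    fun_prop
  have huc : Continuous (fun z => exp (u z)) := hu.continuous.rexp
  have he : ∀ z, ‖deriv g z‖ ^ 2 * exp (φ z) = exp (u z) := by
    intro z; rw [hg2, ← Real.exp_add]; congr 1; simp only [hφ]; ring
  have hlap : ∀ z, lapC φ z = lapC u z := by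
    intro z
    have e : φ = fun z : ℂ => 1 * u z + (-1) * ((P + Polynomial.C ((2 * η : ℝ) : ℂ)).eval z).re := by
      ext z; simp [hφ]; ring
    rw [e, lapC_lin hu.contDiffAt (poly_re_contDiff _).contDiffAt, poly_re_lap]; ring
  have hsubK := interior_subset (s := K)
  have hlev : ∀ s, 0 < s → lev (interior K) φ s = K ∩ {z | s ≤ φ z} := by
    intro s hs
    ext z
    constructor
    · rintro ⟨h1, h2⟩; exact ⟨hsubK h1, h2⟩
    · rintro ⟨h1, h2⟩
      refine ⟨?_, h2⟩
      by_contra h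
      have := hP z ⟨subset_closure h1, h⟩
      have h3 := (abs_le.1 this).2
      have h2' : s ≤ u z - (P.eval z).re - 2 * η := h2
      linarith
  have hIntg : ∀ {f : ℂ → ℝ} {A : Set ℂ}, Continuous f → A ⊆ K → IntegrableOn f A := fun hf hA =>
    (hf.continuousOn.integrableOn_compact hK).mono_set hA
  have key := bolA isOpen_interior (φ := φ) (g := g) (hφc.of_le (by norm_num)).contDiffOn hg.differentiableOn
    (by simp_rw [hg2]; exact hIntg hPc hsubK) (by
      intro s hs
      rw [hlev s hs]
      exact hK.inter_right (isClosed_le continuous_const hφc.continuous)) (by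
      intro ψ hψ hc hs h0
      rw [green1 isOpen_interior hφc.contDiffOn hψ hc hs, ← integral_neg]
      simp_rw [he]
      refine integral_mono ?_ ?_ ?_
      · exact (integrable_mul_tsupport (lapC_continuousOn isOpen_interior hφc.contDiffOn) hψ.continuous hc hs).neg
      · exact (integrable_mul_tsupport huc.continuousOn hψ.continuous hc hs)
      · intro z
        dsimp only
        by_cases hz : z ∈ tsupport ψ
        · have := hsub z (hs hz)
          rw [hlap]
          nlinarith [h0 z]
        · rw [image_eq_zero_of_notMem_tsupport hz]; simp)
  simp_rw [he, hg2] at key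
  set D := {z | z ∈ interior K ∧ 0 < φ z} with hD
  have hDK : D ⊆ K := fun z hz => hsubK hz.1
  have hDm : MeasurableSet D := (isOpen_interior.inter (isOpen_lt continuous_const hφc.continuous)).measurableSet
  have h1 := setIntegral_sdiff (f := fun z => exp (u z)) (μ := volume) hDm (hIntg huc subset_rfl) hDK
  have h2 := setIntegral_sdiff (f := fun z : ℂ => exp ((P.eval z).re + 2 * η)) (μ := volume) hDm (hIntg hPc subset_rfl) hDK
  have h3 : ∫ z in K \ D, exp (u z) ≤ ∫ z in K \ D, exp ((P.eval z).re + 2 * η) := by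
    refine setIntegral_mono_on (hIntg huc sdiff_subset) (hIntg hPc sdiff_subset) (hK.measurableSet.diff hDm) ?_
    rintro z ⟨hz, hzD⟩
    apply Real.exp_le_exp.2
    by_contra hlt
    push Not at hlt
    have h0 : 0 < φ z := by simp only [hφ]; linarith
    have : z ∈ lev (interior K) φ (φ z) := by rw [hlev _ h0]; exact ⟨hz, by simp⟩
    exact hzD ⟨this.1, h0⟩
  have h4 : 0 ≤ ∫ z in K \ D, exp (u z) := integral_nonneg fun z => (Real.exp_pos _).le
  have h5 : 0 ≤ ∫ z in D, exp (u z) := integral_nonneg fun z => (Real.exp_pos _).le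
  set a := ∫ z in K, exp (u z)
  set b := ∫ z in D, exp (u z)
  set α := ∫ z in K, exp ((P.eval z).re + 2 * η)
  set β := ∫ z in D, exp ((P.eval z).re + 2 * η)
  rw [h1] at h3 h4
  rw [h2] at h3
  nlinarith [Real.pi_pos, mul_nonneg h4 (by linarith : 0 ≤ a + b), mul_nonneg Real.pi_pos.le (sub_nonneg.2 h3)]

open Set Filter Topology in
lemma arith_iso {α Λ η η' a μ : ℝ} (hα : 0 ≤ α) (hη : 0 < η) (hη' : 0 < η')
    (h : 2 * √π * α ≤ (exp (2 * η) * Λ) * √(α + η')) (h1 : a * (8 * π - a) ≤ 8 * π * α)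
    (hμ : 0 ≤ μ) (hμa : μ ≤ a) (ha : a ≤ 4 * π) :
    (1/2) * μ * (8 * π - μ) - (32 * π ^ 2 * η + 4 * π * η') ≤ Λ ^ 2 := by
  have hpi := Real.pi_pos
  have hs := pow_le_pow_left₀ (by positivity) h 2
  have e1 : (2 * √π * α) ^ 2 = 4 * π * α ^ 2 := by rw [mul_pow, mul_pow, Real.sq_sqrt hpi.le]; ring
  have e2 : ((exp (2 * η) * Λ) * √(α + η')) ^ 2 = exp (4 * η) * Λ ^ 2 * (α + η') := by
    rw [mul_pow, mul_pow, Real.sq_sqrt (by positivity), ← Real.exp_nat_mul]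
    congr 3; push_cast; ring
  rw [e1, e2] at hs
  have h2 : 4 * π * (α - η') ≤ exp (4 * η) * Λ ^ 2 := by
    have h3 : 4 * π * (α - η') * (α + η') ≤ exp (4 * η) * Λ ^ 2 * (α + η') := by
      refine le_trans ?_ hs
      nlinarith [sq_nonneg η']
    exact le_of_mul_le_mul_right h3 (by positivity)
  set α0 := a * (8 * π - a) / (8 * π) with hα0
  have e3 : 8 * π * α0 = a * (8 * π - a) := by rw [hα0]; field_simp
  have h4 : α0 ≤ α := by
    rw [hα0, div_le_iff₀ (by positivity)]; linarith
  have h5 : α0 ≤ 2 * π := by nlinarith [sq_nonneg (a - 4 * π)]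
  have h50 : 0 ≤ α0 := by rw [hα0]; apply div_nonneg (mul_nonneg (hμ.trans hμa) (by linarith)) (by positivity)
  have h6 : μ * (8 * π - μ) ≤ a * (8 * π - a) := by nlinarith
  have h7 : exp (-(4 * η)) * (4 * π * (α0 - η')) ≤ Λ ^ 2 := by
    calc exp (-(4 * η)) * (4 * π * (α0 - η')) ≤ exp (-(4 * η)) * (exp (4 * η) * Λ ^ 2) := by
          apply mul_le_mul_of_nonneg_left _ (Real.exp_pos _).le
          nlinarith
      _ = Λ ^ 2 := by rw [← mul_assoc, ← Real.exp_add]; simp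
  have h8 : 1 - 4 * η ≤ exp (-(4 * η)) := by have := Real.add_one_le_exp (-(4 * η)); linarith
  have h9 : exp (-(4 * η)) ≤ 1 := Real.exp_le_one_iff.2 (by linarith)
  set E := exp (-(4 * η))
  have h10 : (1 - 4 * η) * α0 ≤ E * α0 := mul_le_mul_of_nonneg_right h8 h50
  have h11 : E * η' ≤ η' := by nlinarith
  have h12 : (1 - 4 * η) * α0 - η' ≤ E * (α0 - η') := by linarith
  have h13 : 4 * π * ((1 - 4 * η) * α0 - η') ≤ Λ ^ 2 := by nlinarith
  nlinarith [mul_le_mul_of_nonneg_left h5 (by positivity : 0 ≤ 16 * π * η)]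

open Set Filter Topology in
lemma psi_exists {Ω : Set ℂ} (hΩ : IsOpen Ω) {w : ℂ → ℝ} (hw : ContDiff ℝ 1 w) {K H : Set ℂ} (hK : IsClosed K) (hKΩ : K ⊆ Ω)
    {t t1 t2 : ℝ} {T : ℝ → ℝ} (hT : IsStep T t1 t2) (ht2 : t2 < t) (hfr : ∀ z ∈ frontier K, t ≤ w z)
    (hH : IsCompact H) (hHΩ : H ⊆ Ω) (hKH : K ⊆ H) (hwH : ∀ z ∈ Ω, t1 ≤ w z → z ∈ H) :
    ∃ ψ : ℂ → ℝ, ContDiff ℝ 1 ψ ∧ HasCompactSupport ψ ∧ tsupport ψ ⊆ H ∧ (∀ z, 0 ≤ ψ z) ∧ (∀ z ∈ K, ψ z = 1) ∧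
      (∀ z, gn ψ z ≠ 0 → z ∈ Ω ∧ z ∈ H ∧ z ∉ K ∧ gn ψ z = deriv T (w z) * gn w z) := by
  classical
  set ψ : ℂ → ℝ := fun z => if z ∈ K then 1 else if z ∈ Ω then T (w z) else 0 with hψ
  have hV2 : IsOpen {z | z ∈ Ω ∧ t2 < w z} := hΩ.inter (isOpen_lt continuous_const hw.continuous)
  have hV : IsOpen (interior K ∪ {z | z ∈ Ω ∧ t2 < w z}) := isOpen_interior.union hV2
  have hKV : K ⊆ interior K ∪ {z | z ∈ Ω ∧ t2 < w z} := by
    intro z hz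
    by_cases h : z ∈ interior K
    · exact Or.inl h
    · exact Or.inr ⟨hKΩ hz, ht2.trans_le (hfr z ⟨subset_closure hz, h⟩)⟩
  have hψ1 : ∀ z ∈ interior K ∪ {z | z ∈ Ω ∧ t2 < w z}, ψ z = 1 := by
    rintro z (hz | hz)
    · simp [hψ, interior_subset hz]
    · by_cases h : z ∈ K
      · simp [hψ, h]
      · have := hT.2.2.2.1 (w z) hz.2.le
        simp [hψ, h, hz.1, this]
  have hO2 : IsOpen (Ω \ K) := hΩ.sdiff hK
  have hψ2 : ∀ z ∈ Ω \ K, ψ z = T (w z) := by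
    rintro z ⟨h1, h2⟩; simp [hψ, h1, h2]
  have hsupp : tsupport ψ ⊆ H := by
    apply closure_minimal _ hH.isClosed
    intro z hz
    by_cases h : z ∈ K
    · exact hKH h
    · by_cases h2 : z ∈ Ω
      · apply hwH z h2
        by_contra h3
        push Not at h3
        apply hz
        rw [hψ2 z ⟨h2, h⟩]
        exact hT.2.2.1 _ h3.le
      · exact absurd (by simp [hψ, h, h2]) hz
  have ev1 : ∀ z ∈ K, ψ =ᶠ[𝓝 z] fun _ => 1 := fun z hz => by
    filter_upwards [hV.mem_nhds (hKV hz)] with x hx using hψ1 x hx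
  have ev2 : ∀ z ∈ Ω \ K, ψ =ᶠ[𝓝 z] fun z => T (w z) := fun z hz => by
    filter_upwards [hO2.mem_nhds hz] with x hx using hψ2 x hx
  have hTc : ContDiff ℝ 1 T := hT.2.1
  have hC1 : ContDiff ℝ 1 ψ := by
    refine contDiff_of_tsupport hΩ (fun z hz => ContDiffAt.contDiffWithinAt ?_) (hsupp.trans hHΩ)
    by_cases h : z ∈ K
    · exact contDiffAt_const.congr_of_eventuallyEq (ev1 z h)
    · exact ((hTc.comp hw).contDiffAt).congr_of_eventuallyEq (ev2 z ⟨hz, h⟩)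
  refine ⟨ψ, hC1, hH.of_isClosed_subset (isClosed_tsupport _) hsupp, hsupp, ?_, fun z hz => by simp [hψ, hz], ?_⟩
  · intro z
    simp only [hψ]
    split_ifs
    · exact zero_le_one
    · exact hT.nonneg _
    · exact le_rfl
  · intro z hz
    have hz1 : fderiv ℝ ψ z ≠ 0 := by
      intro h; apply hz; simp [gn, gdot, h]
    have hzt : z ∈ tsupport ψ := by
      by_contra h
      apply hz1
      have : ψ =ᶠ[𝓝 z] fun _ => 0 := by
        filter_upwards [(isClosed_tsupport ψ).isOpen_compl.mem_nhds h] with x hx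
        exact image_eq_zero_of_notMem_tsupport hx
      rw [this.fderiv_eq]; simp
    have hzΩ := hHΩ (hsupp hzt)
    have hzK : z ∉ K := by
      intro h; apply hz1; rw [(ev1 z h).fderiv_eq]; simp
    refine ⟨hzΩ, hsupp hzt, hzK, gn_smul (hT.2.2.2.2 _) ?_⟩
    rw [(ev2 z ⟨hzΩ, hzK⟩).fderiv_eq]
    have h1 := ((hTc.differentiable (by norm_num)) (w z)).hasDerivAt
    have h2 := ((hw.differentiable (by norm_num)) z).hasFDerivAt
    exact (h1.comp_hasFDerivAt z h2).fderiv

open Set Filter Topology in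
lemma outer_open {K : Set ℂ} (hK : IsCompact K) {f : ℂ → ℝ} (hf : Continuous f) {W0 : Set ℂ} (hW0 : IsOpen W0) (hKW0 : K ⊆ W0)
    {δ : ℝ} (hδ : 0 < δ) :
    ∃ W, IsOpen W ∧ K ⊆ W ∧ W ⊆ W0 ∧ IntegrableOn f W ∧ ∫ z in W, f z ≤ (∫ z in K, f z) + δ := by
  obtain ⟨R, hR⟩ := hK.isBounded.exists_norm_le
  obtain ⟨C, hC⟩ := (isCompact_closedBall (0:ℂ) (R + 1)).exists_bound_of_continuousOn (f := f) hf.continuousOn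
  have hC0 : 0 ≤ max C 0 := le_max_right _ _
  obtain ⟨W1, hKW1, hW1, -, hd⟩ := hK.measurableSet.exists_isOpen_sdiff_lt (μ := volume) hK.measure_lt_top.ne
    (ε := ENNReal.ofReal (δ / (max C 0 + 1))) (by simp; positivity)
  set W := W1 ∩ W0 ∩ Metric.ball 0 (R + 1) with hW
  have hKW : K ⊆ W := fun z hz => ⟨⟨hKW1 hz, hKW0 hz⟩, by simpa using (hR z hz).trans_lt (by linarith)⟩
  have hWo : IsOpen W := (hW1.inter hW0).inter Metric.isOpen_ball
  have hWB : W ⊆ Metric.closedBall 0 (R + 1) := inter_subset_right.trans Metric.ball_subset_closedBall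
  have hi : IntegrableOn f W := (hf.continuousOn.integrableOn_compact (isCompact_closedBall (0:ℂ) (R + 1))).mono_set hWB
  refine ⟨W, hWo, hKW, fun z hz => hz.1.2, hi, ?_⟩
  have h1 := setIntegral_sdiff (f := f) (μ := volume) hK.measurableSet hi hKW
  have hlt : volume (W \ K) < ENNReal.ofReal (δ / (max C 0 + 1)) :=
    (measure_mono (show W \ K ⊆ W1 \ K from fun z hz => ⟨hz.1.1.1, hz.2⟩)).trans_lt hd
  have h2 : ‖∫ z in W \ K, f z‖ ≤ max C 0 * (volume.real (W \ K)) :=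
    norm_setIntegral_le_of_norm_le_const (hlt.trans ENNReal.ofReal_lt_top) (fun z hz => (hC z (hWB hz.1)).trans (le_max_left _ _))
  have h3 : volume.real (W \ K) ≤ δ / (max C 0 + 1) := by
    have := ENNReal.toReal_mono ENNReal.ofReal_ne_top hlt.le
    rwa [ENNReal.toReal_ofReal (by positivity)] at this
  have h4 : max C 0 * (volume.real (W \ K)) ≤ δ := by
    calc _ ≤ (max C 0 + 1) * (δ / (max C 0 + 1)) := by gcongr; linarith
      _ = δ := by field_simp
  have h5 := (le_abs_self _).trans (h2.trans h4)
  linarith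

open Set Filter Topology in
lemma lev_compact {Ω : Set ℂ} (hb : Bornology.IsBounded Ω) (ho : IsOpen Ω) {w : ℂ → ℝ} (hw : Continuous w) (hwf : ∀ z ∈ frontier Ω, w z = 0)
    {s : ℝ} (hs : 0 < s) : IsCompact (lev Ω w s) := by
  have : lev Ω w s = closure Ω ∩ {z | s ≤ w z} := by
    ext z
    constructor
    · rintro ⟨h1, h2⟩; exact ⟨subset_closure h1, h2⟩
    · rintro ⟨h1, h2⟩
      refine ⟨?_, h2⟩
      by_contra h
      have h3 := hwf z ⟨h1, by rwa [ho.interior_eq]⟩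
      have h2' : s ≤ w z := h2
      linarith
  rw [this]
  exact hb.isCompact_closure.inter_right (isClosed_le continuous_const hw)

open Set Filter Topology in
set_option maxHeartbeats 2000000 in
lemma local_iso {Ω : Set ℂ} (hb : Bornology.IsBounded Ω) (ho : IsOpen Ω) (hsc : IsSimplyConnected Ω) {u w : ℂ → ℝ}
    (hu : ContDiff ℝ 2 u) (hw : ContDiff ℝ 2 w) (hwf : ∀ z ∈ frontier Ω, w z = 0)
    (hsub : ∀ z ∈ Ω, 0 ≤ lapC u z + exp (u z)) (hm : ∫ z in Ω, exp (u z) ≤ 4 * π) :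
    ∀ t, 0 < t → ∀ ε, 0 < ε → ∃ h0, 0 < h0 ∧ ∀ T t1 t2, IsStep T t1 t2 → t - h0 < t1 → 0 < t1 → t2 < t →
      (1/2) * (∫ z in lev Ω w t, exp (u z)) * (8 * π - 1 * ∫ z in lev Ω w t, exp (u z)) - ε ≤
        (∫ z in Ω, deriv T (w z) * gn w z * √(exp (u z))) ^ 2 := by
  intro t ht ε hε
  obtain ⟨R0, hR0⟩ := hb.exists_norm_le
  set R := |R0| + 1 with hR
  have hRpos : 0 < R := by positivity
  have hΩR : ∀ z ∈ Ω, ‖z‖ < R := fun z hz => (hR0 z hz).trans_lt (by rw [hR]; linarith [le_abs_self R0])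
  set p : ℂ := (R : ℂ) with hp
  have hpR : R ≤ ‖p‖ := by rw [hp, Complex.norm_real]; exact le_abs_self R
  set K := hull p (lev Ω w t) with hK
  have hlc : ∀ s, 0 < s → IsCompact (lev Ω w s) := fun s hs => lev_compact hb ho hw.continuous hwf hs
  have hlR : ∀ s, ∀ z ∈ lev Ω w s, ‖z‖ < R := fun s z hz => hΩR z hz.1
  have hKc : IsCompact K := hull_compact (hlc t ht) hRpos (hlR t) hpR
  have hhΩ : ∀ s, 0 < s → hull p (lev Ω w s) ⊆ Ω := fun s hs =>
    hull_subset ho hsc (hlc s hs) (fun z hz => hz.1) hRpos (hlR s) hpR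
  have hKΩ : K ⊆ Ω := hhΩ t ht
  have hKfr : frontier K ⊆ lev Ω w t := hull_frontier (hlc t ht)
  have hpi := Real.pi_pos
  set η := ε / (64 * π ^ 2) with hη
  set η' := ε / (8 * π) with hη'
  have hη0 : 0 < η := by positivity
  have hη'0 : 0 < η' := by positivity
  obtain ⟨P, hP⟩ := WL hKc (hull_compl_preconn p _) hu hη0
  obtain ⟨g, hg, hg1⟩ := prim P η
  have hg2 : ∀ z, ‖deriv g z‖ ^ 2 = exp ((P.eval z).re + 2 * η) := by
    intro z; rw [hg1, ← Real.exp_nat_mul]; congr 1; push_cast; ring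
  have hst1 := step1 hKc hu (fun z hz => hsub z (hKΩ (interior_subset hz))) hη0 hP
  have hPc := (poly_re_contDiff P).continuous
  have hGc : Continuous (fun z : ℂ => exp ((P.eval z).re + 2 * η)) := by fun_prop
  have hW0 : IsOpen (interior K ∪ {z | |u z - (P.eval z).re| < 2 * η}) :=
    isOpen_interior.union (isOpen_lt (hu.continuous.sub hPc).abs continuous_const)
  obtain ⟨W, hWo, hKW, hWW0, hWi, hWm⟩ := outer_open hKc hGc hW0 (by
    intro z hz
    by_cases h : z ∈ interior K
    · exact Or.inl h
    · right
      have := hP z ⟨subset_closure hz, h⟩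
      show |u z - (P.eval z).re| < 2 * η
      linarith) hη'0
  obtain ⟨s, hs0, hst, hsW⟩ := hull_cont (p := p) (K := lev Ω w) (R := R) (W := W) ht (fun s hs => hlc s hs)
    (fun s s' _ hss z hz => ⟨hz.1, hss.trans hz.2⟩) (by
      intro z hz
      refine ⟨(hz (t/2) (by linarith) (by linarith)).1, ?_⟩
      by_contra hlt
      push Not at hlt
      have hmx : max (w z) 0 < t := max_lt hlt ht
      have := (hz ((max (w z) 0 + t) / 2) (by linarith [le_max_right (w z) 0]) (by linarith)).2
      linarith [le_max_left (w z) 0]) hRpos (fun s _ => hlR s) hpR hWo hKW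
  refine ⟨t - s, by linarith, fun T t1 t2 hT h1 h10 h2 => ?_⟩
  have hts : s < t1 := by linarith
  have ht12 : t1 < t2 := hT.1
  have hHs : hull p (lev Ω w t1) ⊆ hull p (lev Ω w s) := hull_mono p fun z hz => ⟨hz.1, hts.le.trans hz.2⟩
  have hHc : IsCompact (hull p (lev Ω w t1)) := hull_compact (hlc t1 h10) hRpos (hlR t1) hpR
  have hw1 : ContDiff ℝ 1 w := hw.of_le (by norm_num)
  obtain ⟨ψ, hψ, hψc, hψs, hψ0, hψ1, hψg⟩ := psi_exists ho hw1 hKc.isClosed hKΩ hT h2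
    (fun z hz => (hKfr hz).2) hHc (hhΩ t1 h10) (hull_mono p fun z hz => ⟨hz.1, (by linarith [hz.2] : t1 ≤ w z)⟩)
    (fun z hz hz1 => subset_hull _ _ ⟨hz, hz1⟩)
  have hFI := FI isOpen_univ hg.differentiableOn hψ hψc (subset_univ _)
  simp_rw [hg2] at hFI
  set Λ := ∫ z in Ω, deriv T (w z) * gn w z * √(exp (u z)) with hΛ
  set α := ∫ z in K, exp ((P.eval z).re + 2 * η) with hα
  have hα0 : 0 ≤ α := integral_nonneg fun z => (Real.exp_pos _).le
  have hb1 : α ≤ ∫ z, ψ z * exp ((P.eval z).re + 2 * η) := by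
    rw [hα, ← integral_indicator hKc.measurableSet]
    refine integral_mono ?_ ?_ ?_
    · rw [integrable_indicator_iff hKc.measurableSet]; exact hGc.continuousOn.integrableOn_compact hKc
    · exact (hψ.continuous.mul hGc).integrable_of_hasCompactSupport hψc.mul_right
    · intro z
      by_cases h : z ∈ K
      · simp [h, hψ1 z h]
      · simp only [indicator_of_notMem h]; exact mul_nonneg (hψ0 z) (Real.exp_pos _).le
  have hb2 : ∫ z in tsupport ψ, exp ((P.eval z).re + 2 * η) ≤ α + η' := by
    refine le_trans ?_ hWm
    exact setIntegral_mono_set hWi (ae_of_all _ fun z => (Real.exp_pos _).le)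
      (hψs.trans (hHs.trans hsW)).eventuallyLE
  have hTd : Continuous (deriv T) := hT.2.1.continuous_deriv le_rfl
  have hgnc : Continuous (gn w) := by
    rw [← continuousOn_univ]; exact gn_continuousOn isOpen_univ hw1.contDiffOn
  have hcont : Continuous (fun z => deriv T (w z) * gn w z * √(exp (u z))) :=
    ((hTd.comp hw.continuous).mul hgnc).mul hu.continuous.rexp.sqrt
  have hb3 : ∫ z, gn ψ z * ‖deriv g z‖ ≤ exp (2 * η) * Λ := by
    rw [hΛ, ← integral_indicator ho.measurableSet, ← integral_const_mul]
    refine integral_mono_of_nonneg (ae_of_all _ fun z => mul_nonneg (gn_nonneg _ _) (norm_nonneg _)) ?_ (ae_of_all _ fun z => ?_)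
    · apply Integrable.const_mul
      rw [integrable_indicator_iff ho.measurableSet]
      exact integrableOn_bdd hb hcont
    · dsimp only
      have hnn : 0 ≤ deriv T (w z) * gn w z * √(exp (u z)) :=
        mul_nonneg (mul_nonneg (hT.2.2.2.2 _) (gn_nonneg _ _)) (Real.sqrt_nonneg _)
      by_cases h0 : gn ψ z = 0
      · rw [h0, zero_mul]
        apply mul_nonneg (Real.exp_pos _).le
        exact indicator_nonneg (fun x _ => mul_nonneg (mul_nonneg (hT.2.2.2.2 _) (gn_nonneg _ _)) (Real.sqrt_nonneg _)) z
      · obtain ⟨hzΩ, hzH, hzK, hz4⟩ := hψg z h0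
        rw [indicator_of_mem hzΩ, hz4, hg1]
        have hzW : |u z - (P.eval z).re| < 2 * η := by
          rcases hWW0 (hsW (hHs hzH)) with h | h
          · exact absurd (interior_subset h) hzK
          · exact h
        have h5 := (abs_lt.1 hzW).1
        have h6 : exp (((P.eval z).re + 2 * η) / 2) ≤ exp (2 * η) * √(exp (u z)) := by
          rw [Real.sqrt_eq_rpow, ← Real.exp_mul, ← Real.exp_add]
          apply Real.exp_le_exp.2; linarith
        calc _ ≤ deriv T (w z) * gn w z * (exp (2 * η) * √(exp (u z))) :=
              mul_le_mul_of_nonneg_left h6 (mul_nonneg (hT.2.2.2.2 _) (gn_nonneg _ _))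
          _ = _ := by ring
  have hΛ0 : 0 ≤ Λ := integral_nonneg fun z => mul_nonneg (mul_nonneg (hT.2.2.2.2 _) (gn_nonneg _ _)) (Real.sqrt_nonneg _)
  have hfin : 2 * √π * α ≤ (exp (2 * η) * Λ) * √(α + η') := by
    calc 2 * √π * α ≤ 2 * √π * ∫ z, ψ z * exp ((P.eval z).re + 2 * η) := by gcongr
      _ ≤ _ := hFI
      _ ≤ _ := by
        apply mul_le_mul hb3 (Real.sqrt_le_sqrt hb2) (Real.sqrt_nonneg _)
        positivity
  have hui : IntegrableOn (fun z => exp (u z)) Ω := integrableOn_bdd hb hu.continuous.rexp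
  have hμa : ∫ z in lev Ω w t, exp (u z) ≤ ∫ z in K, exp (u z) :=
    setIntegral_mono_set (hui.mono_set hKΩ) (ae_of_all _ fun z => (Real.exp_pos _).le) (subset_hull p _).eventuallyLE
  have haΩ : ∫ z in K, exp (u z) ≤ ∫ z in Ω, exp (u z) :=
    setIntegral_mono_set hui (ae_of_all _ fun z => (Real.exp_pos _).le) hKΩ.eventuallyLE
  have := arith_iso hα0 hη0 hη'0 hfin hst1 (integral_nonneg fun z => (Real.exp_pos _).le) hμa (haΩ.trans hm)
  have he : 32 * π ^ 2 * η + 4 * π * η' = ε := by rw [hη, hη']; field_simp; ring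
  rw [he] at this
  rw [one_mul]
  exact this

open Set Filter Topology in
theorem main_ineq {Ω : Set ℂ} (hne : Ω.Nonempty) (hb : Bornology.IsBounded Ω) (ho : IsOpen Ω) (hsc : IsSimplyConnected Ω) {u w : ℂ → ℝ}
    (hu : ContDiff ℝ 2 u) (hw : ContDiff ℝ 2 w) (hw0 : ∀ z ∈ Ω, 0 < w z) (hwf : ∀ z ∈ frontier Ω, w z = 0)
    (hsub : ∀ z ∈ Ω, 0 ≤ lapC u z + exp (u z)) (hsub2 : ∀ z ∈ Ω, - lapC w z ≤ exp (u z) * (exp (w z) - 1)) :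
    8 * π ≤ ∫ z in Ω, (exp (u z) + exp (u z + w z)) := by
  by_contra hlt
  push Not at hlt
  have hi1 : IntegrableOn (fun z => exp (u z)) Ω := integrableOn_bdd hb hu.continuous.rexp
  have hi2 : IntegrableOn (fun z => exp (u z + w z)) Ω := integrableOn_bdd hb (hu.continuous.add hw.continuous).rexp
  rw [integral_add hi1 hi2] at hlt
  have hpos : 0 < ∫ z in Ω, (exp (u z + w z) - exp (u z)) := by
    rw [setIntegral_pos_iff_support_of_nonneg_ae]
    · have : Function.support (fun z => exp (u z + w z) - exp (u z)) ∩ Ω = Ω := by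
        apply inter_eq_right.2
        intro z hz
        have := Real.exp_lt_exp.2 (by linarith [hw0 z hz] : u z < u z + w z)
        simp only [Function.mem_support]; linarith
      rw [this]; exact ho.measure_pos volume hne
    · filter_upwards [ae_restrict_mem ho.measurableSet] with z hz
      have := Real.exp_lt_exp.2 (by linarith [hw0 z hz] : u z < u z + w z)
      simp only [Pi.zero_apply]; linarith
    · exact hi2.sub hi1
  rw [integral_sub hi2 hi1] at hpos
  have hset : {z | z ∈ Ω ∧ 0 < w z} = Ω := by
    ext z; exact ⟨fun h => h.1, fun h => ⟨h, hw0 z h⟩⟩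
  have key := talenti (P := 8 * π) (κ := 1) (by positivity) zero_le_one le_rfl ho (φ := w) (ρ := fun z => exp (u z))
    (hw.of_le (by norm_num)).contDiffOn hu.continuous.rexp.continuousOn (fun z _ => (Real.exp_pos _).le) hi1
    (fun s hs => lev_compact hb ho hw.continuous hwf hs) (by
      intro ψ hψ hc hs h0
      rw [green1 ho hw.contDiffOn hψ hc hs, ← integral_neg]
      refine integral_mono ?_ ?_ ?_
      · exact (integrable_mul_tsupport (lapC_continuousOn ho hw.contDiffOn) hψ.continuous hc hs).neg
      · refine integrable_mul_tsupport (O := Ω) (g := fun z => exp (u z) * (exp (w z) - 1)) ?_ hψ.continuous hc hs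
        have := hu.continuous
        have := hw.continuous
        exact Continuous.continuousOn (by fun_prop)
      · intro z
        dsimp only
        by_cases hz : z ∈ tsupport ψ
        · have := hsub2 z (hs hz)
          nlinarith [h0 z]
        · rw [image_eq_zero_of_notMem_tsupport hz]; simp)
    (local_iso hb ho hsc hu hw hwf hsub (by linarith))
  rw [hset] at key
  simp_rw [← Real.exp_add] at key
  set μ := ∫ z in Ω, exp (u z)
  set ν := ∫ z in Ω, exp (u z + w z)
  nlinarith

open Set Filter Topology in
lemma contDiff2_of_tsupport {f : ℂ → ℝ} {O : Set ℂ}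
    (hO : IsOpen O) (hf : ContDiffOn ℝ 2 f O) (hs : tsupport f ⊆ O) : ContDiff ℝ 2 f := by
  rw [contDiff_iff_contDiffAt]
  intro x
  by_cases hx : x ∈ O
  · exact hf.contDiffAt (hO.mem_nhds hx)
  · have : f =ᶠ[𝓝 x] fun _ => 0 := by
      filter_upwards [(isClosed_tsupport f).isOpen_compl.mem_nhds (fun h => hx (hs h))] with y hy
      exact image_eq_zero_of_notMem_tsupport hy
    exact contDiffAt_const.congr_of_eventuallyEq this

open Set Filter Topology in
lemma cutoff_ext {Ω U : Set ℂ} (hb : Bornology.IsBounded Ω) (hU : IsOpen U) (hcl : closure Ω ⊆ U) {a : ℂ → ℝ} (ha : ContDiffOn ℝ 2 a U) :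
    ∃ u : ℂ → ℝ, ContDiff ℝ 2 u ∧ ∀ z ∈ closure Ω, u =ᶠ[𝓝 z] a := by
  obtain ⟨θ, hθ, hθc, hθs, hθ1, -, -⟩ := exists_cutoff hb.isCompact_closure hU hcl
  refine ⟨fun z => θ z * a z, ?_, ?_⟩
  · refine contDiff2_of_tsupport hU ((hθ.of_le (by norm_cast)).contDiffOn.mul ha) ?_
    exact (tsupport_mul_subset_left).trans hθs
  · intro z hz
    have := eventually_nhdsSet_iff_forall.1 hθ1 z hz
    filter_upwards [this] with y hy
    rw [hy, one_mul]

open Set Filter Topology in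
lemma lapC_sub {f g : ℂ → ℝ} {z : ℂ} (hf : ContDiffAt ℝ 2 f z) (hg : ContDiffAt ℝ 2 g z) :
    lapC (fun z => f z - g z) z = lapC f z - lapC g z := by
  have e : (fun z => f z - g z) = fun z => 1 * f z + (-1) * g z := by ext z; ring
  rw [e, lapC_lin hf hg]; ring

open Set Filter Topology in
lemma lapC_add_smul {f g : ℂ → ℝ} {z : ℂ} (hf : ContDiffAt ℝ 2 f z) (hg : ContDiffAt ℝ 2 g z) (ε : ℝ) :
    lapC (fun z => f z + ε * g z) z = lapC f z + ε * lapC g z := by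
  have e : (fun z => f z + ε * g z) = fun z => 1 * f z + ε * g z := by ext z; ring
  rw [e, lapC_lin hf hg]; ring

open Set Filter Topology in
theorem ineqC {Ω U : Set ℂ} (hne : Ω.Nonempty) (hb : Bornology.IsBounded Ω) (ho : IsOpen Ω) (hsc : IsSimplyConnected Ω)
    (hU : IsOpen U) (hcl : closure Ω ⊆ U) {a b : ℂ → ℝ}
    (ha : ContDiffOn ℝ 2 a U) (hbb : ContDiffOn ℝ 2 b U) (hlt : ∀ z ∈ Ω, a z < b z) (hfr : ∀ z ∈ frontier Ω, a z = b z)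
    (h1 : ∀ z ∈ Ω, 0 ≤ lapC a z + exp (a z)) (h2 : ∀ z ∈ Ω, lapC a z + exp (a z) ≤ lapC b z + exp (b z)) :
    8 * π ≤ ∫ z in Ω, (exp (a z) + exp (b z)) := by
  obtain ⟨u, hu, hua⟩ := cutoff_ext hb hU hcl ha
  obtain ⟨v, hv, hvb⟩ := cutoff_ext hb hU hcl hbb
  have hsc' := subset_closure (s := Ω)
  have eu : ∀ z ∈ closure Ω, u z = a z := fun z hz => (hua z hz).eq_of_nhds
  have ev : ∀ z ∈ closure Ω, v z = b z := fun z hz => (hvb z hz).eq_of_nhds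
  have key := main_ineq (u := u) (w := fun z => v z - u z) hne hb ho hsc hu (hv.sub hu)
    (fun z hz => by rw [eu z (hsc' hz), ev z (hsc' hz)]; linarith [hlt z hz])
    (fun z hz => by rw [eu z hz.1, ev z hz.1]; linarith [hfr z hz])
    (fun z hz => by rw [eu z (hsc' hz), lapC_congr (hua z (hsc' hz))]; exact h1 z hz)
    (fun z hz => by
      rw [lapC_sub hv.contDiffAt hu.contDiffAt, lapC_congr (hua z (hsc' hz)), lapC_congr (hvb z (hsc' hz)), mul_sub, ← Real.exp_add,
        eu z (hsc' hz), ev z (hsc' hz), add_sub_cancel]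
      linarith [h2 z hz])
  refine key.trans_eq (setIntegral_congr_fun ho.measurableSet fun z hz => ?_)
  simp only [eu z (hsc' hz), ev z (hsc' hz), add_sub_cancel]

open Set Filter Topology in
lemma lapC_comp {Λ Λ1 Λ2 : ℝ → ℝ} {w : ℂ → ℝ} {O : Set ℂ} (hO : IsOpen O) (hw : ContDiffOn ℝ 2 w O) 
    (h1 : ∀ z ∈ O, HasDerivAt Λ (Λ1 (w z)) (w z)) (h2 : ∀ z ∈ O, HasDerivAt Λ1 (Λ2 (w z)) (w z)) {z : ℂ} (hz : z ∈ O) :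
    lapC (fun z => Λ (w z)) z = Λ1 (w z) * lapC w z + Λ2 (w z) * gdot w w z := by
  have hwd : ∀ x ∈ O, HasFDerivAt w (fderiv ℝ w x) x := fun x hx =>
    ((hw.contDiffAt (hO.mem_nhds hx)).differentiableAt (by norm_num)).hasFDerivAt
  have hd : ∀ v : ℂ, DifferentiableAt ℝ (fun x => fderiv ℝ w x v) z := by
    intro v
    have : ContDiffAt ℝ 1 (fderiv ℝ w) z := (hw.contDiffAt (hO.mem_nhds hz)).fderiv_right (by norm_num)
    exact (this.differentiableAt (by norm_num)).clm_apply (differentiableAt_const v)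
  have h3 : ∀ v : ℂ, fderiv ℝ (fun x => fderiv ℝ (fun z => Λ (w z)) x v) z v =
      Λ1 (w z) * fderiv ℝ (fun x => fderiv ℝ w x v) z v + Λ2 (w z) * (fderiv ℝ w z v * fderiv ℝ w z v) := by
    intro v
    have ev : (fun x => fderiv ℝ (fun z => Λ (w z)) x v) =ᶠ[𝓝 z] fun x => Λ1 (w x) * fderiv ℝ w x v := by
      filter_upwards [hO.mem_nhds hz] with x hx
      have := ((h1 x hx).comp_hasFDerivAt x (hwd x hx)).fderiv
      have e : fderiv ℝ (fun z => Λ (w z)) x = Λ1 (w x) • fderiv ℝ w x := this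
      rw [e]; simp
    rw [ev.fderiv_eq]
    have h4 : HasFDerivAt (fun x => Λ1 (w x)) (Λ2 (w z) • fderiv ℝ w z) z := (h2 z hz).comp_hasFDerivAt z (hwd z hz)
    have h5 := h4.mul (hd v).hasFDerivAt
    have e : fderiv ℝ (fun x => Λ1 (w x) * fderiv ℝ w x v) z = _ := h5.fderiv
    rw [e]
    simp only [add_apply, smul_apply, smul_eq_mul]; ring
  unfold lapC gdot
  rw [h3, h3]; ring

open Set Filter Topology in
lemma small_lt {C d : ℝ} (hd : 0 < d) : ∀ᶠ ε in 𝓝[>] (0:ℝ), ε * C < d := by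
  have : Tendsto (fun ε : ℝ => ε * C) (𝓝[>] 0) (𝓝 (0 * C)) := (tendsto_id.mul_const C).mono_left nhdsWithin_le_nhds
  rw [zero_mul] at this
  exact this.eventually (eventually_lt_nhds hd)

open Set Filter Topology in
lemma pos_ball {Ω : Set ℂ} (ho : IsOpen Ω) {f : ℂ → ℝ} (hf : ContinuousOn f Ω) {z0 : ℂ} (hz0 : z0 ∈ Ω) (h0 : 0 < f z0) :
    ∃ r > 0, Metric.closedBall z0 r ⊆ Ω ∧ ∃ c > 0, ∀ z ∈ Metric.closedBall z0 r, c ≤ f z := by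
  have h1 : ∀ᶠ z in 𝓝 z0, z ∈ Ω ∧ f z0 / 2 < f z :=
    (ho.eventually_mem hz0).and ((hf.continuousAt (ho.mem_nhds hz0)).eventually (eventually_gt_nhds (by linarith)))
  obtain ⟨r, hr, h⟩ := Metric.nhds_basis_closedBall.eventually_iff.1 h1
  exact ⟨r, hr, fun z hz => (h hz).1, f z0 / 2, by linarith, fun z hz => (h hz).2.le⟩

open Set Filter Topology in
lemma bdd_on {B : Set ℂ} (hB : IsCompact B) {f : ℂ → ℝ} (hf : ContinuousOn f B) : ∃ M, 0 ≤ M ∧ ∀ z ∈ B, |f z| ≤ M := by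
  obtain ⟨C, hC⟩ := hB.exists_bound_of_continuousOn hf
  exact ⟨max C 0, le_max_right _ _, fun z hz => (hC z hz).trans (le_max_left _ _)⟩

open Set Filter Topology in
theorem eqC1 {Ω U : Set ℂ} (hne : Ω.Nonempty) (hb : Bornology.IsBounded Ω) (ho : IsOpen Ω) (hsc : IsSimplyConnected Ω)
    (hU : IsOpen U) (hcl : closure Ω ⊆ U) {a b : ℂ → ℝ}
    (ha : ContDiffOn ℝ 2 a U) (hbb : ContDiffOn ℝ 2 b U) (hlt : ∀ z ∈ Ω, a z < b z) (hfr : ∀ z ∈ frontier Ω, a z = b z)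
    (h1 : ∀ z ∈ Ω, 0 ≤ lapC a z + exp (a z)) (h2 : ∀ z ∈ Ω, lapC a z + exp (a z) ≤ lapC b z + exp (b z))
    (heq : ∫ z in Ω, (exp (a z) + exp (b z)) = 8 * π) :
    ∀ z ∈ Ω, lapC a z + exp (a z) = lapC b z + exp (b z) := by
  intro z0 hz0
  by_contra hne0
  have hΩU : Ω ⊆ U := subset_closure.trans hcl
  have haΩ := ha.mono hΩU
  have hbΩ := hbb.mono hΩU
  have hac := haΩ.continuousOn
  have hbc := hbΩ.continuousOn
  set D : ℂ → ℝ := fun z => (lapC b z + exp (b z)) - (lapC a z + exp (a z)) with hD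
  have hDc : ContinuousOn D Ω := ((lapC_continuousOn ho hbΩ).add hbc.rexp).sub ((lapC_continuousOn ho haΩ).add hac.rexp)
  have hD0 : 0 < D z0 := by
    have := lt_of_le_of_ne (h2 z0 hz0) hne0
    simp only [hD]; linarith
  obtain ⟨r, hr, hBΩ, d, hd, hDd⟩ := pos_ball ho hDc hz0 hD0
  set B := Metric.closedBall z0 r with hB
  have hBc : IsCompact B := isCompact_closedBall _ _
  obtain ⟨ζ, hζ, hζc, hζs, hζ1, hζ0, -⟩ := exists_cutoff (isCompact_singleton (x := z0)) Metric.isOpen_ball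
    (singleton_subset_iff.2 (Metric.mem_ball_self hr))
  have hζB : tsupport ζ ⊆ B := hζs.trans Metric.ball_subset_closedBall
  have hζ2 : ContDiff ℝ 2 ζ := hζ.of_le (by norm_cast)
  have hζz0 : ζ z0 = 1 := (eventually_nhdsSet_iff_forall.1 hζ1 z0 rfl).self_of_nhds
  obtain ⟨M1, hM10, hM1⟩ := bdd_on hBc (f := fun z => lapC ζ z + exp (b z) * ζ z)
    ((lapC_continuous hζ2).continuousOn.add ((hbc.mono hBΩ).rexp.mul hζ2.continuous.continuousOn))
  obtain ⟨M2, hM20, hM2⟩ := bdd_on hBc hζ2.continuous.continuousOn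
  obtain ⟨m, hm, hmin⟩ : ∃ m > 0, ∀ z ∈ B, m ≤ b z - a z := by
    obtain ⟨x, hx, hxm⟩ := hBc.exists_isMinOn (f := fun z => b z - a z) ⟨z0, Metric.mem_closedBall_self hr.le⟩
      ((hbc.mono hBΩ).sub (hac.mono hBΩ))
    exact ⟨b x - a x, by linarith [hlt x (hBΩ hx)], fun z hz => hxm hz⟩
  obtain ⟨ε, ⟨he1, he2⟩, he0⟩ := ((small_lt (C := M1) hd).and (small_lt (C := M2) hm)).and self_mem_nhdsWithin |>.exists
  have he0 : 0 < ε := he0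
  have hoff : ∀ z ∉ B, ζ z = 0 ∧ lapC ζ z = 0 := fun z hz =>
    ⟨image_eq_zero_of_notMem_tsupport fun h => hz (hζB h), lapC_zero_of_notMem fun h => hz (hζB h)⟩
  have hlap : ∀ z ∈ Ω, lapC (fun z => b z + (-ε) * ζ z) z = lapC b z + (-ε) * lapC ζ z := fun z hz =>
    lapC_add_smul (hbΩ.contDiffAt (ho.mem_nhds hz)) hζ2.contDiffAt _
  have key := ineqC hne hb ho hsc hU hcl ha (b := fun z => b z + (-ε) * ζ z) (hbb.add (contDiff_const.mul hζ2).contDiffOn)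
    (by
      intro z hz
      by_cases h : z ∈ B
      · have := hmin z h
        have h5 := (abs_le.1 (hM2 z h)).2
        nlinarith
      · rw [(hoff z h).1]; simpa using hlt z hz)
    (by
      intro z hz
      have : z ∉ B := fun h => by
        have h5 := hz.2
        rw [ho.interior_eq] at h5
        exact h5 (hBΩ h)
      rw [(hoff z this).1]; simpa using hfr z hz) h1
    (by
      intro z hz
      rw [hlap z hz]
      by_cases h : z ∈ B
      · have h5 := (abs_le.1 (hM1 z h)).2
        have h6 := hDd z h
        simp only [hD] at h6
        have h7 : exp (b z) - ε * (exp (b z) * ζ z) ≤ exp (b z + (-ε) * ζ z) := by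
          rw [Real.exp_add]
          have := Real.add_one_le_exp ((-ε) * ζ z)
          nlinarith [Real.exp_pos (b z)]
        nlinarith [mul_le_mul_of_nonneg_left h5 he0.le]
      · rw [(hoff z h).1, (hoff z h).2]; simpa using h2 z hz)
  have hΩi : ∀ {f : ℂ → ℝ}, ContinuousOn f U → IntegrableOn f Ω := fun hf =>
    ((hf.mono hcl).integrableOn_compact hb.isCompact_closure).mono_set subset_closure
  have hi1 := hΩi ha.continuousOn.rexp
  have hi2 := hΩi hbb.continuousOn.rexp
  have hi3 : IntegrableOn (fun z => exp (b z + (-ε) * ζ z)) Ω := hΩi (hbb.continuousOn.add (continuous_const.mul hζ2.continuous).continuousOn : ContinuousOn (fun z => b z + (-ε) * ζ z) U).rexp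
  rw [integral_add hi1 hi3] at key
  rw [integral_add hi1 hi2] at heq
  have hpos : 0 < ∫ z in Ω, (exp (b z) - exp (b z + (-ε) * ζ z)) := by
    have hnn : ∀ z, 0 ≤ exp (b z) - exp (b z + (-ε) * ζ z) := by
      intro z
      have := Real.exp_le_exp.2 (by nlinarith [hζ0 z] : b z + (-ε) * ζ z ≤ b z)
      linarith
    rw [setIntegral_pos_iff_support_of_nonneg_ae (ae_of_all _ hnn) (hi2.sub hi3)]
    have hop : IsOpen {z | 0 < ζ z} := isOpen_lt continuous_const hζ2.continuous
    refine lt_of_lt_of_le ((hop.inter ho).measure_pos volume ⟨z0, (by simp [hζz0]), hz0⟩) (measure_mono ?_)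
    rintro z ⟨hz1, hz2⟩
    refine ⟨?_, hz2⟩
    have hz1 : 0 < ζ z := hz1
    have := Real.exp_lt_exp.2 (by nlinarith : b z + (-ε) * ζ z < b z)
    simp only [Function.mem_support]; linarith
  rw [integral_sub hi2 hi3] at hpos
  linarith

open Set Filter Topology in
lemma lapC_smooth {Z : ℂ → ℝ} (hZ : ContDiff ℝ (⊤ : ℕ∞) Z) : ContDiff ℝ 2 (lapC Z) := by
  have h4 : ContDiff ℝ 4 Z := hZ.of_le (by norm_cast)
  have h : ∀ v : ℂ, ContDiff ℝ 2 (fun z => fderiv ℝ (fun x => fderiv ℝ Z x v) z v) := by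
    intro v
    have h3 : ContDiff ℝ 3 (fun x => fderiv ℝ Z x v) := (h4.fderiv_right (m := 3) (by norm_num)).clm_apply contDiff_const
    exact (h3.fderiv_right (m := 2) (by norm_num)).clm_apply contDiff_const
  exact (h 1).add (h Complex.I)

open Set Filter Topology in
lemma green_sym {Ω : Set ℂ} (ho : IsOpen Ω) {l Z ζ : ℂ → ℝ} (hl : ContDiffOn ℝ 2 l Ω) (hZ : ContDiff ℝ 2 Z) (hZc : HasCompactSupport Z)
    (hZs : tsupport Z ⊆ Ω) (hζ : ContDiff ℝ 2 ζ) (hζs : tsupport ζ ⊆ Ω) (hζ1 : ∀ z ∈ tsupport Z, ∀ᶠ x in 𝓝 z, ζ x = 1) :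
    ∫ z, l z * lapC Z z = ∫ z, lapC l z * Z z := by
  set η : ℂ → ℝ := fun z => ζ z * l z with hη
  have hη2 : ContDiff ℝ 2 η := contDiff2_of_tsupport ho (hζ.contDiffOn.mul hl) (tsupport_mul_subset_left.trans hζs)
  have g1 := green1 ho hl (hZ.of_le (by norm_num)) hZc hZs
  have g2 := green2 hZ (hη2.of_le (by norm_num)) hZc
  have ev : ∀ z ∈ tsupport Z, η =ᶠ[𝓝 z] l := fun z hz => by
    filter_upwards [hζ1 z hz] with x hx; simp [hη, hx]
  have e1 : ∫ z, gdot Z η z = ∫ z, gdot l Z z := by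
    congr 1; ext z
    by_cases hz : z ∈ tsupport Z
    · rw [gdot_comm]; unfold gdot; rw [(ev z hz).fderiv_eq]
    · rw [gdot_comm, gdot_zero_of_notMem hz, gdot_zero_of_notMem hz]
  have e2 : ∫ z, lapC Z z * η z = ∫ z, l z * lapC Z z := by
    congr 1; ext z
    by_cases hz : z ∈ tsupport Z
    · rw [(ev z hz).eq_of_nhds, mul_comm]
    · rw [lapC_zero_of_notMem hz]; simp
  linarith

open Set Filter Topology in
lemma coth_lap {Ω : Set ℂ} (ho : IsOpen Ω) {w : ℂ → ℝ} (hw : ContDiffOn ℝ 2 w Ω) (hw0 : ∀ z ∈ Ω, 0 < w z) (hl : ∀ z ∈ Ω, lapC w z ≤ 0) :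
    ∀ z ∈ Ω, 0 ≤ lapC (fun z => 1 + 2 / (exp (w z) - 1)) z := by
  intro z hz
  have hE : ∀ x : ℝ, 0 < x → 0 < exp x - 1 := fun x hx => by have := Real.one_lt_exp_iff.2 hx; linarith
  have h1 : ∀ x : ℝ, 0 < x → HasDerivAt (fun x => 1 + 2 / (exp x - 1)) (-2 * exp x / (exp x - 1) ^ 2) x := by
    intro x hx
    have h := ((hasDerivAt_const x (2:ℝ)).div ((Real.hasDerivAt_exp x).sub_const 1) (hE x hx).ne').const_add 1
    exact h.congr_deriv (by ring)
  have h2 : ∀ x : ℝ, 0 < x → HasDerivAt (fun x => -2 * exp x / (exp x - 1) ^ 2) (2 * exp x * (exp x + 1) / (exp x - 1) ^ 3) x := by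
    intro x hx
    have h := (((Real.hasDerivAt_exp x).const_mul (-2)).div (((Real.hasDerivAt_exp x).sub_const 1).pow 2) (pow_ne_zero 2 (hE x hx).ne'))
    refine h.congr_deriv ?_
    have := (hE x hx).ne'
    simp only [Nat.cast_ofNat, Pi.pow_apply]
    field_simp
    ring
  rw [lapC_comp (Λ := fun x => 1 + 2 / (exp x - 1)) (Λ1 := fun x => -2 * exp x / (exp x - 1) ^ 2)
    (Λ2 := fun x => 2 * exp x * (exp x + 1) / (exp x - 1) ^ 3) ho hw (fun z hz => h1 _ (hw0 z hz)) (fun z hz => h2 _ (hw0 z hz)) hz]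
  have hE' := hE _ (hw0 z hz)
  apply add_nonneg
  · apply mul_nonneg_of_nonpos_of_nonpos _ (hl z hz)
    apply div_nonpos_of_nonpos_of_nonneg _ (by positivity)
    have := Real.exp_pos (w z); linarith
  · exact mul_nonneg (by positivity) (gdot_self_nonneg _ _)

open Set Filter Topology in
set_option maxHeartbeats 2000000 in
lemma pert_exists {Ω : Set ℂ} (ho : IsOpen Ω) {a b : ℂ → ℝ}
    (ha : ContDiffOn ℝ 2 a Ω) (hb : ContDiffOn ℝ 2 b Ω) (hlt : ∀ z ∈ Ω, a z < b z)
    (hf : ∀ z ∈ Ω, lapC a z + exp (a z) = lapC b z + exp (b z)) {z0 : ℂ} {r : ℝ} (hr : 0 < r) (hB : Metric.closedBall z0 r ⊆ Ω) :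
    ∃ (Y Z : ℂ → ℝ) (κ : ℝ), 0 < κ ∧ ContDiff ℝ 2 Y ∧ ContDiff ℝ 2 Z ∧ tsupport Y ⊆ Metric.closedBall z0 r ∧
      tsupport Z ⊆ Metric.closedBall z0 r ∧ (∀ z, 0 ≤ Z z) ∧
      (∀ z ∈ tsupport Z, lapC Z z + exp (b z) * (Y z + Z z) - exp (a z) * Y z = (exp (b z) - exp (a z)) * κ) ∧
      (∀ z, z ∉ tsupport Z → 0 ≤ Y z) ∧ ∫ z in Ω, (exp (a z) * Y z + exp (b z) * (Y z + Z z)) < 0 := by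
  set B := Metric.closedBall z0 r with hBdef
  have hBcl : IsClosed B := Metric.isClosed_closedBall
  obtain ⟨Z, hZ, hZc, hZs, hZ1, hZ0, -⟩ := exists_cutoff (isCompact_singleton (x := z0)) Metric.isOpen_ball
    (singleton_subset_iff.2 (Metric.mem_ball_self hr))
  obtain ⟨ζ, hζ, hζc, hζs, hζ1, hζ0, -⟩ := exists_cutoff (K := tsupport Z) hZc Metric.isOpen_ball hZs
  have hZz0 : Z z0 = 1 := (eventually_nhdsSet_iff_forall.1 hZ1 z0 rfl).self_of_nhds
  have hζ1' := eventually_nhdsSet_iff_forall.1 hζ1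
  have hZB : tsupport Z ⊆ B := hZs.trans Metric.ball_subset_closedBall
  have hζB : tsupport ζ ⊆ B := hζs.trans Metric.ball_subset_closedBall
  have hZ2 : ContDiff ℝ 2 Z := hZ.of_le (by norm_cast)
  have hζ2 : ContDiff ℝ 2 ζ := hζ.of_le (by norm_cast)
  have hac := ha.continuousOn
  have hbc := hb.continuousOn
  have hpq : ∀ z ∈ Ω, 0 < exp (b z) - exp (a z) := fun z hz => sub_pos.2 (Real.exp_lt_exp.2 (hlt z hz))
  set l : ℂ → ℝ := fun z => 1 + 2 / (exp (b z - a z) - 1) with hl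
  have hE : ∀ z ∈ Ω, 0 < exp (b z - a z) - 1 := fun z hz => by
    have := Real.one_lt_exp_iff.2 (sub_pos.2 (hlt z hz)); linarith
  have hl2 : ContDiffOn ℝ 2 l Ω := contDiffOn_const.add
    (contDiffOn_const.div ((hb.sub ha).exp.sub contDiffOn_const) fun z hz => (hE z hz).ne')
  have hl1 : ∀ z ∈ Ω, 0 < l z - 1 := fun z hz => by
    have := hE z hz
    simp only [hl, add_sub_cancel_left]; positivity
  have hle : ∀ z ∈ Ω, l z * (exp (b z) - exp (a z)) = exp (a z) + exp (b z) := by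
    intro z hz
    have h1 := hE z hz
    have e : exp (b z) = exp (b z - a z) * exp (a z) := by rw [← Real.exp_add]; simp
    simp only [hl]
    rw [e]
    field_simp
    ring
  have hll : ∀ z ∈ Ω, 0 ≤ lapC l z := by
    refine coth_lap ho (w := fun z => b z - a z) (hb.sub ha) (fun z hz => sub_pos.2 (hlt z hz)) fun z hz => ?_
    rw [lapC_sub (hb.contDiffAt (ho.mem_nhds hz)) (ha.contDiffAt (ho.mem_nhds hz))]
    linarith [hf z hz, hpq z hz]
  -- the lap of Z
  have hLZ := lapC_smooth hZ
  have hLZs : tsupport (lapC Z) ⊆ tsupport Z := closure_minimal (fun z hz => by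
    by_contra h; exact hz (lapC_zero_of_notMem h)) (isClosed_tsupport _)
  have hLZc : HasCompactSupport (lapC Z) := hZc.of_isClosed_subset (isClosed_tsupport _) hLZs
  have i1 : Integrable (fun z => l z * lapC Z z) :=
    integrable_mul_tsupport hl2.continuousOn hLZ.continuous hLZc (hLZs.trans (hZB.trans hB))
  have i2 : Integrable (fun z => (exp (b z) * (l z - 1)) * Z z) :=
    integrable_mul_tsupport (hbc.rexp.mul (hl2.continuousOn.sub continuousOn_const)) hZ2.continuous hZc (hZB.trans hB)
  have i3 : Integrable (fun z => (exp (a z) + exp (b z)) * ζ z) :=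
    integrable_mul_tsupport (hac.rexp.add hbc.rexp) hζ2.continuous hζc (hζB.trans hB)
  have A1 : 0 ≤ ∫ z, l z * lapC Z z := by
    rw [green_sym ho hl2 hZ2 hZc (hZB.trans hB) hζ2 (hζB.trans hB) (fun z hz => hζ1' z hz)]
    refine integral_nonneg fun z => ?_
    by_cases hz : z ∈ tsupport Z
    · exact mul_nonneg (hll z (hB (hZB hz))) (hZ0 z)
    · simp [image_eq_zero_of_notMem_tsupport hz]
  have A2 : 0 < ∫ z, (exp (b z) * (l z - 1)) * Z z := by
    have hnn : ∀ z, 0 ≤ (exp (b z) * (l z - 1)) * Z z := by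
      intro z
      by_cases hz : z ∈ tsupport Z
      · exact mul_nonneg (mul_nonneg (Real.exp_pos _).le (hl1 z (hB (hZB hz))).le) (hZ0 z)
      · simp [image_eq_zero_of_notMem_tsupport hz]
    rw [integral_pos_iff_support_of_nonneg hnn i2]
    have hop : IsOpen {z | 0 < Z z} := isOpen_lt continuous_const hZ2.continuous
    refine lt_of_lt_of_le (hop.measure_pos volume ⟨z0, (by simp [hZz0])⟩) (measure_mono ?_)
    intro z hz
    have hz1 : 0 < Z z := hz
    have hzt : z ∈ tsupport Z := subset_tsupport _ hz1.ne'
    exact (mul_pos (mul_pos (Real.exp_pos _) (hl1 z (hB (hZB hzt)))) hz1).ne'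
  obtain ⟨κ, hκ, hκ0⟩ := ((small_lt (C := ∫ z, (exp (a z) + exp (b z)) * ζ z) A2).and self_mem_nhdsWithin).exists
  have hκ0 : 0 < κ := hκ0
  set Y : ℂ → ℝ := fun z => -((lapC Z z + exp (b z) * Z z) / (exp (b z) - exp (a z))) + κ * ζ z with hY
  have hoff : ∀ z, z ∉ tsupport Z → Z z = 0 ∧ lapC Z z = 0 := fun z hz =>
    ⟨image_eq_zero_of_notMem_tsupport hz, lapC_zero_of_notMem hz⟩
  have hYoff : ∀ z, z ∉ tsupport Z → Y z = κ * ζ z := fun z hz => by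
    simp only [hY, (hoff z hz).1, (hoff z hz).2]; simp
  have hYs : tsupport Y ⊆ B := closure_minimal (fun z hz => by
    by_contra h
    apply hz
    rw [hYoff z (fun h' => h (hZB h')), image_eq_zero_of_notMem_tsupport (fun h' => h (hζB h')), mul_zero]) hBcl
  have hY2 : ContDiff ℝ 2 Y := by
    refine contDiff2_of_tsupport ho ?_ (hYs.trans hB)
    exact ((hLZ.contDiffOn.add (hb.exp.mul hZ2.contDiffOn)).div (hb.exp.sub ha.exp) (fun z hz => (hpq z hz).ne')).neg.add
      (contDiffOn_const.mul hζ2.contDiffOn)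
  refine ⟨Y, Z, κ, hκ0, hY2, hZ2, hYs, hZB, hZ0, ?_, ?_, ?_⟩
  · intro z hz
    have h1 := (hpq z (hB (hZB hz))).ne'
    have h2 : ζ z = 1 := (hζ1' z hz).self_of_nhds
    simp only [hY, h2]
    field_simp
    ring
  · intro z hz
    rw [hYoff z hz]; exact mul_nonneg hκ0.le (hζ0 z)
  · have e1 : ∫ z in Ω, (exp (a z) * Y z + exp (b z) * (Y z + Z z)) =
        ∫ z in Ω, (κ * ((exp (a z) + exp (b z)) * ζ z) - (l z * lapC Z z + (exp (b z) * (l z - 1)) * Z z)) := by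
      refine setIntegral_congr_fun ho.measurableSet fun z hz => ?_
      have h1 := hpq z hz
      have h2 : (exp (a z) + exp (b z)) / (exp (b z) - exp (a z)) = l z := by rw [← hle z hz]; field_simp
      simp only [hY]
      rw [← h2]
      field_simp
      ring
    have i12 : Integrable (fun z => l z * lapC Z z + (exp (b z) * (l z - 1)) * Z z) := i1.add i2
    rw [e1, setIntegral_eq_integral_of_forall_compl_eq_zero, integral_sub (i3.const_mul κ) i12, integral_const_mul, integral_add i1 i2]
    · linarith
    · intro z hz
      rw [(hoff z fun h => hz (hB (hZB h))).1, (hoff z fun h => hz (hB (hZB h))).2,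
        image_eq_zero_of_notMem_tsupport (fun h' => hz (hB (hζB h')))]
      simp

open Set Filter Topology in
set_option maxHeartbeats 2000000 in
theorem eqC2 {Ω U : Set ℂ} (hne : Ω.Nonempty) (hb : Bornology.IsBounded Ω) (ho : IsOpen Ω) (hsc : IsSimplyConnected Ω)
    (hU : IsOpen U) (hcl : closure Ω ⊆ U) {a b : ℂ → ℝ}
    (ha : ContDiffOn ℝ 2 a U) (hbb : ContDiffOn ℝ 2 b U) (hlt : ∀ z ∈ Ω, a z < b z) (hfr : ∀ z ∈ frontier Ω, a z = b z)
    (h1 : ∀ z ∈ Ω, 0 ≤ lapC a z + exp (a z)) (h2 : ∀ z ∈ Ω, lapC a z + exp (a z) = lapC b z + exp (b z))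
    (heq : ∫ z in Ω, (exp (a z) + exp (b z)) = 8 * π) :
    ∀ z ∈ Ω, lapC a z + exp (a z) = 0 := by
  intro z0 hz0
  by_contra hne0
  have hΩU : Ω ⊆ U := subset_closure.trans hcl
  have haΩ := ha.mono hΩU
  have hbΩ := hbb.mono hΩU
  have hac := haΩ.continuousOn
  have hbc := hbΩ.continuousOn
  obtain ⟨r, hr, hBΩ, c, hc, hfc⟩ := pos_ball ho ((lapC_continuousOn ho haΩ).add hac.rexp) hz0
    (lt_of_le_of_ne (h1 z0 hz0) (Ne.symm hne0))
  obtain ⟨Y, Z, κ, hκ, hY, hZ, hYs, hZs, hZ0, hE1, hE2, hI⟩ := pert_exists ho haΩ hbΩ hlt h2 hr hBΩ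
  set B := Metric.closedBall z0 r with hB
  have hBc : IsCompact B := isCompact_closedBall _ _
  obtain ⟨M1, hM10, hM1⟩ := bdd_on hBc (f := fun z => lapC Y z + exp (a z) * Y z)
    ((lapC_continuous hY).continuousOn.add ((hac.mono hBΩ).rexp.mul hY.continuous.continuousOn))
  obtain ⟨M2, hM20, hM2⟩ := bdd_on hBc hY.continuous.continuousOn
  obtain ⟨M3, hM30, hM3⟩ := bdd_on hBc (f := fun z => Y z + Z z) (hY.continuous.add hZ.continuous).continuousOn
  obtain ⟨M4, hM40, hM4⟩ := bdd_on hBc (f := fun z => exp (a z) * Y z ^ 2) ((hac.mono hBΩ).rexp.mul (hY.continuous.continuousOn.pow 2))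
  obtain ⟨m, hm, hmin⟩ : ∃ m > 0, ∀ z ∈ B, m ≤ exp (b z) - exp (a z) := by
    obtain ⟨x, hx, hxm⟩ := hBc.exists_isMinOn (f := fun z => exp (b z) - exp (a z)) ⟨z0, Metric.mem_closedBall_self hr.le⟩
      ((hbc.mono hBΩ).rexp.sub (hac.mono hBΩ).rexp)
    exact ⟨exp (b x) - exp (a x), sub_pos.2 (Real.exp_lt_exp.2 (hlt x (hBΩ hx))), fun z hz => hxm hz⟩
  set I1 := ∫ z in Ω, (exp (a z) * Y z + exp (b z) * (Y z + Z z)) with hI1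
  set I2 := ∫ z in Ω, (exp (a z) * Y z ^ 2 + exp (b z) * (Y z + Z z) ^ 2) with hI2
  obtain ⟨ε, ⟨⟨⟨⟨he1, he2⟩, he3⟩, he4⟩, he5⟩, he0⟩ := (((((small_lt (C := M1) hc).and (small_lt (C := M2) one_pos)).and
    (small_lt (C := M3) one_pos)).and (small_lt (C := M4) (mul_pos hm hκ))).and (small_lt (C := I2) (neg_pos.2 hI))).and
    self_mem_nhdsWithin |>.exists
  have he0 : 0 < ε := he0
  have hYoff : ∀ z ∉ B, Y z = 0 ∧ lapC Y z = 0 := fun z hz =>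
    ⟨image_eq_zero_of_notMem_tsupport fun h => hz (hYs h), lapC_zero_of_notMem fun h => hz (hYs h)⟩
  have hZoff : ∀ z ∉ tsupport Z, Z z = 0 ∧ lapC Z z = 0 := fun z hz =>
    ⟨image_eq_zero_of_notMem_tsupport hz, lapC_zero_of_notMem hz⟩
  have hV : ContDiff ℝ 2 (fun z => Y z + Z z) := hY.add hZ
  have hlapV : ∀ z, lapC (fun z => Y z + Z z) z = lapC Y z + lapC Z z := by
    intro z
    have := lapC_add_smul hY.contDiffAt hZ.contDiffAt (z := z) 1
    simpa using this
  have hlapa : ∀ z ∈ Ω, lapC (fun z => a z + ε * Y z) z = lapC a z + ε * lapC Y z := fun z hz =>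
    lapC_add_smul (haΩ.contDiffAt (ho.mem_nhds hz)) hY.contDiffAt _
  have hlapb : ∀ z ∈ Ω, lapC (fun z => b z + ε * (Y z + Z z)) z = lapC b z + ε * (lapC Y z + lapC Z z) := fun z hz => by
    rw [lapC_add_smul (hbΩ.contDiffAt (ho.mem_nhds hz)) hV.contDiffAt, hlapV]
  have hYa : ∀ z, |ε * Y z| ≤ 1 := by
    intro z
    by_cases h : z ∈ B
    · rw [abs_mul, abs_of_pos he0]; nlinarith [hM2 z h]
    · rw [(hYoff z h).1]; simp
  have hVa : ∀ z, |ε * (Y z + Z z)| ≤ 1 := by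
    intro z
    by_cases h : z ∈ B
    · rw [abs_mul, abs_of_pos he0]; nlinarith [hM3 z h]
    · rw [(hYoff z h).1, (hZoff z fun h' => h (hZs h')).1]; simp
  have hexp : ∀ x : ℝ, |x| ≤ 1 → exp x ≤ 1 + x + x ^ 2 := fun x hx => by
    have := (abs_le.1 (Real.abs_exp_sub_one_sub_id_le hx)).2; linarith
  have hΩi : ∀ {f : ℂ → ℝ}, ContinuousOn f U → IntegrableOn f Ω := fun hf =>
    ((hf.mono hcl).integrableOn_compact hb.isCompact_closure).mono_set subset_closure
  have hfrB : ∀ z ∈ frontier Ω, z ∉ B := fun z hz h => by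
    have h5 := hz.2
    rw [ho.interior_eq] at h5
    exact h5 (hBΩ h)
  have cY : ContinuousOn Y U := hY.continuous.continuousOn
  have cV : ContinuousOn (fun z => Y z + Z z) U := hV.continuous.continuousOn
  have cA : ContinuousOn (fun z => exp (a z)) U := ha.continuousOn.rexp
  have cB : ContinuousOn (fun z => exp (b z)) U := hbb.continuousOn.rexp
  have cA' : ContinuousOn (fun z => exp (a z + ε * Y z)) U := (ha.continuousOn.add (continuousOn_const.mul cY)).rexp
  have cB' : ContinuousOn (fun z => exp (b z + ε * (Y z + Z z))) U := (hbb.continuousOn.add (continuousOn_const.mul cV)).rexp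
  have key := ineqC hne hb ho hsc hU hcl (a := fun z => a z + ε * Y z) (b := fun z => b z + ε * (Y z + Z z))
    (ha.add (contDiff_const.mul hY).contDiffOn) (hbb.add (contDiff_const.mul hV).contDiffOn)
    (by
      intro z hz
      have := hlt z hz
      have := mul_nonneg he0.le (hZ0 z)
      linarith)
    (by
      intro z hz
      have := hfrB z hz
      simp only [(hYoff z this).1, (hZoff z fun h' => this (hZs h')).1]
      simpa using hfr z hz)
    (by
      intro z hz
      rw [hlapa z hz]
      by_cases h : z ∈ B
      · have h5 := (abs_le.1 (hM1 z h)).1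
        have h6 : c ≤ lapC a z + exp (a z) := hfc z h
        have h7 : exp (a z) * (1 + ε * Y z) ≤ exp (a z + ε * Y z) := by
          rw [Real.exp_add]
          have := Real.add_one_le_exp (ε * Y z)
          exact mul_le_mul_of_nonneg_left (by linarith) (Real.exp_pos _).le
        have h8 := mul_le_mul_of_nonneg_left h5 he0.le
        nlinarith
      · rw [(hYoff z h).1, (hYoff z h).2]; simpa using h1 z hz)
    (by
      intro z hz
      rw [hlapa z hz, hlapb z hz]
      have hq : exp (b z) * (1 + ε * (Y z + Z z)) ≤ exp (b z + ε * (Y z + Z z)) := by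
        rw [Real.exp_add]
        have := Real.add_one_le_exp (ε * (Y z + Z z))
        exact mul_le_mul_of_nonneg_left (by linarith) (Real.exp_pos _).le
      have hp : exp (a z + ε * Y z) ≤ exp (a z) * (1 + ε * Y z + (ε * Y z) ^ 2) := by
        rw [Real.exp_add]
        exact mul_le_mul_of_nonneg_left (hexp _ (hYa z)) (Real.exp_pos _).le
      have h3 := h2 z hz
      by_cases h : z ∈ tsupport Z
      · have h4 := hE1 z h
        have h5 := (abs_le.1 (hM4 z (hZs h))).2
        have h6 := hmin z (hZs h)
        have h7 : ε * (exp (a z) * Y z ^ 2) ≤ (exp (b z) - exp (a z)) * κ := by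
          have := mul_le_mul_of_nonneg_left h5 he0.le
          have := mul_le_mul_of_nonneg_right h6 hκ.le
          linarith
        have h8 := mul_le_mul_of_nonneg_left h7 he0.le
        rw [← h4] at h8
        nlinarith
      · rw [(hZoff z h).1, (hZoff z h).2, add_zero, add_zero, Real.exp_add, Real.exp_add]
        have h4 : 1 ≤ exp (ε * Y z) := Real.one_le_exp (mul_nonneg he0.le (hE2 z h))
        have h5 := Real.exp_lt_exp.2 (hlt z hz)
        nlinarith)
  have hup : ∫ z in Ω, (exp (a z + ε * Y z) + exp (b z + ε * (Y z + Z z))) ≤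
      ∫ z in Ω, ((exp (a z) + exp (b z)) + (ε * (exp (a z) * Y z + exp (b z) * (Y z + Z z)) +
        ε ^ 2 * (exp (a z) * Y z ^ 2 + exp (b z) * (Y z + Z z) ^ 2))) := by
    refine setIntegral_mono_on (hΩi (cA'.add cB')) (hΩi ((cA.add cB).add ((continuousOn_const.mul ((cA.mul cY).add (cB.mul cV))).add
      (continuousOn_const.mul ((cA.mul (cY.pow 2)).add (cB.mul (cV.pow 2))))))) ho.measurableSet fun z hz => ?_
    rw [Real.exp_add, Real.exp_add (b z)]
    have e1 := mul_le_mul_of_nonneg_left (hexp _ (hYa z)) (Real.exp_pos (a z)).le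
    have e2 := mul_le_mul_of_nonneg_left (hexp _ (hVa z)) (Real.exp_pos (b z)).le
    linarith
  have j1 : IntegrableOn (fun z => exp (a z) * Y z + exp (b z) * (Y z + Z z)) Ω := hΩi ((cA.mul cY).add (cB.mul cV))
  have j2 : IntegrableOn (fun z => exp (a z) * Y z ^ 2 + exp (b z) * (Y z + Z z) ^ 2) Ω :=
    hΩi ((cA.mul (cY.pow 2)).add (cB.mul (cV.pow 2)))
  have j3 : IntegrableOn (fun z => exp (a z) + exp (b z)) Ω := hΩi (cA.add cB)
  have j12 : IntegrableOn (fun z => ε * (exp (a z) * Y z + exp (b z) * (Y z + Z z)) +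
        ε ^ 2 * (exp (a z) * Y z ^ 2 + exp (b z) * (Y z + Z z) ^ 2)) Ω := (j1.const_mul ε).add (j2.const_mul (ε ^ 2))
  rw [integral_add j3 j12, heq, integral_add (j1.const_mul ε) (j2.const_mul (ε ^ 2)), integral_const_mul, integral_const_mul] at hup
  nlinarith

end SCI

open Set Filter Topology in
lemma SCI.lap_transfer {U : Set (ℝ × ℝ)} (hU : IsOpen U) {w : ℝ × ℝ → ℝ} (hw : ContDiffOn ℝ 2 w U) {z : ℂ}
    (hz : Complex.equivRealProdCLM z ∈ U) :
    SCI.lapC (fun z => w (Complex.equivRealProdCLM z)) z = lap w (Complex.equivRealProdCLM z) := by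
  set e := Complex.equivRealProdCLM with he
  have h0 : ∀ x : ℂ, fderiv ℝ (fun z => w (e z)) x = (fderiv ℝ w (e x)).comp (e : ℂ →L[ℝ] ℝ × ℝ) := fun x =>
    e.comp_right_fderiv
  have h1 : ContDiffAt ℝ 1 (fderiv ℝ w) (e z) := (hw.contDiffAt (hU.mem_nhds hz)).fderiv_right (by norm_num)
  have h2 := (h1.differentiableAt (by norm_num)).hasFDerivAt
  have h3 : ∀ v : ℂ, fderiv ℝ (fun x => fderiv ℝ (fun z => w (e z)) x v) z v = fderiv ℝ (fderiv ℝ w) (e z) (e v) (e v) := by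
    intro v
    have e1 : (fun x => fderiv ℝ (fun z => w (e z)) x v) = fun x => fderiv ℝ w (e x) (e v) := by
      ext x; rw [h0]; rfl
    rw [e1]
    have h4 : HasFDerivAt (fun x => fderiv ℝ w (e x)) ((fderiv ℝ (fderiv ℝ w) (e z)).comp (e : ℂ →L[ℝ] ℝ × ℝ)) z :=
      h2.comp z e.hasFDerivAt
    have h5 := h4.clm_apply (hasFDerivAt_const (e v) z)
    rw [h5.fderiv]
    simp
  have e1 : e 1 = (1, 0) := by simp [he]
  have eI : e Complex.I = (0, 1) := by simp [he]
  unfold SCI.lapC lap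
  rw [h3, h3, iteratedFDeriv_two_apply, iteratedFDeriv_two_apply, e1, eI]
  simp

/-- Sphere Covering Inequality: if `Δwᵢ + e^{wᵢ} = fᵢ` on a nonempty bounded
open simply connected `Ω ⊂ ℝ²` with `0 ≤ f₁ ≤ f₂`, `w₂ > w₁` in `Ω` and `w₂ = w₁` on `∂Ω`,
then `∫_Ω (e^{w₁} + e^{w₂}) ≥ 8π`, with equality only if `f₁ ≡ f₂ ≡ 0` on `Ω`. -/
theorem sphere_covering_inequality
    (Ω : Set (ℝ × ℝ)) (hne : Ω.Nonempty) (hbdd : Bornology.IsBounded Ω)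
    (hopen : IsOpen Ω) (hsc : SimplyConnectedSpace Ω)
    (w₁ w₂ f₁ f₂ : ℝ × ℝ → ℝ)
    (U : Set (ℝ × ℝ)) (hU : IsOpen U) (hclU : closure Ω ⊆ U)
    (hw₁ : ContDiffOn ℝ 2 w₁ U) (hw₂ : ContDiffOn ℝ 2 w₂ U)
    (heq₁ : ∀ y ∈ Ω, lap w₁ y + Real.exp (w₁ y) = f₁ y)
    (heq₂ : ∀ y ∈ Ω, lap w₂ y + Real.exp (w₂ y) = f₂ y)
    (hf₁ : ∀ y ∈ Ω, 0 ≤ f₁ y) (hf₁₂ : ∀ y ∈ Ω, f₁ y ≤ f₂ y)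
    (hlt : ∀ y ∈ Ω, w₁ y < w₂ y)
    (hbd : ∀ y ∈ frontier Ω, w₁ y = w₂ y) :
    8 * Real.pi ≤ ∫ y in Ω, (Real.exp (w₁ y) + Real.exp (w₂ y)) ∧
    ((∫ y in Ω, (Real.exp (w₁ y) + Real.exp (w₂ y))) = 8 * Real.pi →
      ∀ y ∈ Ω, f₁ y = 0 ∧ f₂ y = 0) := by
  set e := Complex.equivRealProdCLM with he
  have hΩ'o : IsOpen (e ⁻¹' Ω) := hopen.preimage e.continuous
  have hcl : closure (e ⁻¹' Ω) = e ⁻¹' closure Ω := (e.toHomeomorph.preimage_closure Ω).symm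
  have hfr : frontier (e ⁻¹' Ω) = e ⁻¹' frontier Ω := (e.toHomeomorph.preimage_frontier Ω).symm
  have hsc' : IsSimplyConnected (e ⁻¹' Ω) := (e.toHomeomorph.isSimplyConnected_preimage (s := Ω)).2 hsc
  have hne' : (e ⁻¹' Ω).Nonempty := hne.preimage e.surjective
  have hb' : Bornology.IsBounded (e ⁻¹' Ω) := by
    have : e ⁻¹' Ω = e.symm '' Ω := by
      rw [e.symm.image_eq_preimage_symm]; rfl
    rw [this]
    exact e.symm.lipschitz.isBounded_image hbdd
  have hUo : IsOpen (e ⁻¹' U) := hU.preimage e.continuous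
  have hclU' : closure (e ⁻¹' Ω) ⊆ e ⁻¹' U := by rw [hcl]; exact Set.preimage_mono hclU
  have hc₁ : ContDiffOn ℝ 2 (fun z => w₁ (e z)) (e ⁻¹' U) := hw₁.comp e.contDiff.contDiffOn (fun z hz => hz)
  have hc₂ : ContDiffOn ℝ 2 (fun z => w₂ (e z)) (e ⁻¹' U) := hw₂.comp e.contDiff.contDiffOn (fun z hz => hz)
  have hΩU : Ω ⊆ U := subset_closure.trans hclU
  have hl₁ : ∀ z ∈ e ⁻¹' Ω, SCI.lapC (fun z => w₁ (e z)) z + Real.exp (w₁ (e z)) = f₁ (e z) := fun z hz => by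
    rw [SCI.lap_transfer hU hw₁ (hΩU hz)]; exact heq₁ _ hz
  have hl₂ : ∀ z ∈ e ⁻¹' Ω, SCI.lapC (fun z => w₂ (e z)) z + Real.exp (w₂ (e z)) = f₂ (e z) := fun z hz => by
    rw [SCI.lap_transfer hU hw₂ (hΩU hz)]; exact heq₂ _ hz
  have hlt' : ∀ z ∈ e ⁻¹' Ω, w₁ (e z) < w₂ (e z) := fun z hz => hlt _ hz
  have hbd' : ∀ z ∈ frontier (e ⁻¹' Ω), w₁ (e z) = w₂ (e z) := fun z hz => by
    rw [hfr] at hz; exact hbd _ hz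
  have h1 : ∀ z ∈ e ⁻¹' Ω, 0 ≤ SCI.lapC (fun z => w₁ (e z)) z + Real.exp (w₁ (e z)) := fun z hz => by
    rw [hl₁ z hz]; exact hf₁ _ hz
  have h2 : ∀ z ∈ e ⁻¹' Ω, SCI.lapC (fun z => w₁ (e z)) z + Real.exp (w₁ (e z)) ≤
      SCI.lapC (fun z => w₂ (e z)) z + Real.exp (w₂ (e z)) := fun z hz => by
    rw [hl₁ z hz, hl₂ z hz]; exact hf₁₂ _ hz
  have hIntg : ∫ y in Ω, (Real.exp (w₁ y) + Real.exp (w₂ y)) =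
      ∫ z in e ⁻¹' Ω, (Real.exp (w₁ (e z)) + Real.exp (w₂ (e z))) :=
    (Complex.volume_preserving_equiv_real_prod.setIntegral_preimage_emb
      Complex.measurableEquivRealProd.measurableEmbedding _ Ω).symm
  rw [hIntg]
  refine ⟨SCI.ineqC hne' hb' hΩ'o hsc' hUo hclU' hc₁ hc₂ hlt' hbd' h1 h2, fun h8 y hy => ?_⟩
  have h3 := SCI.eqC1 hne' hb' hΩ'o hsc' hUo hclU' hc₁ hc₂ hlt' hbd' h1 h2 h8
  have h4 := SCI.eqC2 hne' hb' hΩ'o hsc' hUo hclU' hc₁ hc₂ hlt' hbd' h1 h3 h8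
  have hy' : e.symm y ∈ e ⁻¹' Ω := by simpa using hy
  have h5 := h4 _ hy'
  have h6 := h3 _ hy'
  rw [hl₁ _ hy'] at h5 h6
  rw [hl₂ _ hy'] at h6
  rw [e.apply_symm_apply] at h5 h6
  exact ⟨h5, by rw [← h6]; exact h5⟩
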